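/- μ_{M,D} is a spectral measure if and only if M and D satisfy one of the following three conditions: (i) ρ₁ ≠ ρ₂, ρ₁⁻¹ is an integer divisible by p, and c'' = c/(ρ₁⁻¹ − ρ₂⁻¹) ∈ ℚ ∖ E_a; (ii) ρ₁ ≠ ρ₂, both ρ₁⁻¹ and ρ₂⁻¹ are integers divisible by p, and c'' = s/t ∈ E_a in lowest terms with t = p^ℓ·m for some ℓ ∈ ℕ and integer m with p ∤ m, and p^{ℓ+1} divides ρ₁⁻¹ − ρ₂⁻¹; (iii) ρ₁ = ρ₂, ρ₁⁻¹ is an integer divisible by p, and either c = 0 or c = t/s with t ∈ pℤ and gcd(s, t) = 1. -/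

import Mathlib

open MeasureTheory Complex Matrix
open scoped ENNReal

noncomputable section

/-- The exponential function `e_λ(x) = e^{-2πi⟨λ,x⟩}` on `ℝ²`. -/
def expChar (lam x : Fin 2 → ℝ) : ℂ :=
  Complex.exp ((-2 * Real.pi * Complex.I) * ((lam 0 * x 0 + lam 1 * x 1 : ℝ) : ℂ))

/-- The Fourier transform `μ̂(ξ) = ∫ e^{-2πi⟨ξ,x⟩} dμ(x)` of a measure on `ℝ²`. -/
def ftMeasure (μ : Measure (Fin 2 → ℝ)) (ξ : Fin 2 → ℝ) : ℂ :=
  ∫ x, expChar ξ x ∂μ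

/-- The mask `m_D(ξ) = (1/p) Σ_{d∈D} e^{-2πi⟨ξ,d⟩}` of a digit system `D : Fin p → ℝ²`. -/
def mask {p : ℕ} (D : Fin p → (Fin 2 → ℝ)) (ξ : Fin 2 → ℝ) : ℂ :=
  (p : ℂ)⁻¹ * ∑ i : Fin p, expChar ξ (D i)

/-- Integer digits, coerced to real vectors. -/
def digitR {p : ℕ} (D : Fin p → (Fin 2 → ℤ)) : Fin p → (Fin 2 → ℝ) :=
  fun i j => (D i j : ℝ)

/-- `μ` is the self-affine measure of the IFS `φ_d(x) = M⁻¹(x+d)`, `d ∈ D`: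
a compactly supported Borel probability measure with `μ = (1/#D) Σ_d μ ∘ φ_d⁻¹`. -/
def IsSelfAffine {p : ℕ} (μ : Measure (Fin 2 → ℝ)) (M : Matrix (Fin 2) (Fin 2) ℝ)
    (D : Fin p → (Fin 2 → ℝ)) : Prop :=
  IsProbabilityMeasure μ ∧ (∃ K : Set (Fin 2 → ℝ), IsCompact K ∧ μ Kᶜ = 0) ∧
  μ = (p : ℝ≥0∞)⁻¹ • ∑ i : Fin p, μ.map (fun x => M⁻¹.mulVec (x + D i))

/-- `Λ` is an orthogonal set of exponentials for `μ`. -/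
def IsOrthoSet (μ : Measure (Fin 2 → ℝ)) (Λ : Set (Fin 2 → ℝ)) : Prop :=
  ∀ l ∈ Λ, ∀ l' ∈ Λ, l ≠ l' → ftMeasure μ (l - l') = 0

/-- `μ` is a spectral measure: some countable set of exponentials forms an
orthonormal (Hilbert) basis of `L²(μ)`. -/
def IsSpectral (μ : Measure (Fin 2 → ℝ)) : Prop :=
  ∃ Λ : Set (Fin 2 → ℝ), Λ.Countable ∧
    ∃ b : HilbertBasis Λ ℂ (Lp ℂ 2 μ),
      ∀ lam : Λ, ⇑(b lam) =ᵐ[μ] expChar (lam : Fin 2 → ℝ)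

/-- The standing assumption on the digit set: `a = (a₁,a₂)` has entries in `[1,p-1]`
and `Z(m_D) = ⋃_{j=1}^{p-1} (j·a/p + ℤ²)`. -/
def ZeroSetCond (p : ℕ) (D : Fin p → (Fin 2 → ℤ)) (a : Fin 2 → ℤ) : Prop :=
  (∀ i, 1 ≤ a i ∧ a i ≤ (p : ℤ) - 1) ∧
  ∀ ξ : Fin 2 → ℝ, mask (digitR D) ξ = 0 ↔
    ∃ j : ℕ, 1 ≤ j ∧ j ≤ p - 1 ∧ ∃ k : Fin 2 → ℤ,
      ∀ i, ξ i = (j : ℝ) * (a i : ℝ) / p + (k i : ℝ)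

/-- The upper-triangular expanding matrix `M = [[ρ₁⁻¹, c],[0, ρ₂⁻¹]]`. -/
def Mupper (ρ₁ ρ₂ c : ℝ) : Matrix (Fin 2) (Fin 2) ℝ := !![ρ₁⁻¹, c; 0, ρ₂⁻¹]

/-- The set `E_a = {h/l : gcd(h,l)=1, l·a₂ − h·a₁ ∈ ℤ∖pℤ} ∪ {0}`. -/
def Ea (p : ℕ) (a : Fin 2 → ℤ) : Set ℝ :=
  {x | ∃ h l : ℤ, Int.gcd h l = 1 ∧ ¬ ((p : ℤ) ∣ (l * a 1 - h * a 0)) ∧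
    x = (h : ℝ) / (l : ℝ)} ∪ {0}


lemma expChar_norm (ξ x : Fin 2 → ℝ) : ‖expChar ξ x‖ = 1 := by
  unfold expChar
  have : (-2 * Real.pi * Complex.I) * ((ξ 0 * x 0 + ξ 1 * x 1 : ℝ) : ℂ)
      = ((-2 * Real.pi * (ξ 0 * x 0 + ξ 1 * x 1) : ℝ) : ℂ) * Complex.I := by
    push_cast; ring
  rw [this, Complex.norm_exp_ofReal_mul_I]

lemma expChar_add_left (ξ η x : Fin 2 → ℝ) :
    expChar (ξ + η) x = expChar ξ x * expChar η x := by
  unfold expChar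
  rw [← Complex.exp_add]; congr 1; push_cast [Pi.add_apply]; ring

lemma expChar_add_right (ξ x y : Fin 2 → ℝ) :
    expChar ξ (x + y) = expChar ξ x * expChar ξ y := by
  unfold expChar
  rw [← Complex.exp_add]; congr 1; push_cast [Pi.add_apply]; ring

lemma expChar_conj (ξ x : Fin 2 → ℝ) :
    (starRingEnd ℂ) (expChar ξ x) = expChar (-ξ) x := by
  unfold expChar
  rw [← Complex.exp_conj]; congr 1; simp [Complex.conj_ofReal, map_ofNat]; ring

lemma expChar_zero (x : Fin 2 → ℝ) : expChar 0 x = 1 := by simp [expChar]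
lemma expChar_zero_right (x : Fin 2 → ℝ) : expChar x 0 = 1 := by simp [expChar]

lemma expChar_continuous2 : Continuous (fun q : (Fin 2 → ℝ) × (Fin 2 → ℝ) => expChar q.1 q.2) := by
  unfold expChar; fun_prop

lemma expChar_continuous (ξ : Fin 2 → ℝ) : Continuous (expChar ξ) := by
  unfold expChar; fun_prop

lemma expChar_continuous_left (x : Fin 2 → ℝ) : Continuous (fun ξ => expChar ξ x) := by
  unfold expChar; fun_prop

lemma expChar_integrable (ν : Measure (Fin 2 → ℝ)) [IsProbabilityMeasure ν] (ξ : Fin 2 → ℝ) :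
    Integrable (expChar ξ) ν := by
  refine Integrable.of_bound (C := 1) (expChar_continuous ξ).aestronglyMeasurable ?_
  exact Filter.Eventually.of_forall fun x => (expChar_norm ξ x).le

lemma ft_continuous (ν : Measure (Fin 2 → ℝ)) [IsProbabilityMeasure ν] :
    Continuous (ftMeasure ν) := by
  unfold ftMeasure
  refine continuous_of_dominated (bound := fun _ => 1) ?_ ?_ (integrable_const _) ?_
  · intro ξ; exact (expChar_continuous ξ).aestronglyMeasurable
  · intro ξ; exact Filter.Eventually.of_forall fun x => (expChar_norm ξ x).le
  · exact Filter.Eventually.of_forall fun x => expChar_continuous_left x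

lemma ft_zero (ν : Measure (Fin 2 → ℝ)) [IsProbabilityMeasure ν] : ftMeasure ν 0 = 1 := by
  simp [ftMeasure, expChar_zero]

lemma ft_norm_le (ν : Measure (Fin 2 → ℝ)) [IsProbabilityMeasure ν] (ξ : Fin 2 → ℝ) :
    ‖ftMeasure ν ξ‖ ≤ 1 := by
  unfold ftMeasure
  calc ‖∫ x, expChar ξ x ∂ν‖ ≤ ∫ x, ‖expChar ξ x‖ ∂ν := norm_integral_le_integral_norm _
    _ = 1 := by simp [expChar_norm]

lemma expChar_memLp (ν : Measure (Fin 2 → ℝ)) [IsProbabilityMeasure ν] (ξ : Fin 2 → ℝ) :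
    MemLp (expChar ξ) 2 ν :=
  MemLp.of_bound (expChar_continuous ξ).aestronglyMeasurable 1
    (Filter.Eventually.of_forall fun x => (expChar_norm ξ x).le)

/-- the exponential as an element of `L²`. -/
def eL (ν : Measure (Fin 2 → ℝ)) [IsProbabilityMeasure ν] (ξ : Fin 2 → ℝ) : Lp ℂ 2 ν :=
  (expChar_memLp ν ξ).toLp _

lemma eL_inner (ν : Measure (Fin 2 → ℝ)) [IsProbabilityMeasure ν] (ξ η : Fin 2 → ℝ) :
    inner ℂ (eL ν ξ) (eL ν η) = ftMeasure ν (η - ξ) := by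
  rw [L2.inner_def, ftMeasure]
  refine integral_congr_ae ?_
  filter_upwards [(expChar_memLp ν ξ).coeFn_toLp, (expChar_memLp ν η).coeFn_toLp] with x h1 h2
  simp only [eL]
  rw [h1, h2, RCLike.inner_apply, expChar_conj, ← expChar_add_left, sub_eq_add_neg]

lemma eL_norm (ν : Measure (Fin 2 → ℝ)) [IsProbabilityMeasure ν] (ξ : Fin 2 → ℝ) :
    ‖eL ν ξ‖ = 1 := by
  have h := eL_inner ν ξ ξ
  rw [sub_self, ft_zero, inner_self_eq_norm_sq_to_K] at h
  have h2 : (‖eL ν ξ‖ : ℝ) ^ 2 = 1 := by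
    have h3 := congrArg Complex.re h
    simpa [← Complex.ofReal_pow] using h3
  nlinarith [norm_nonneg (eL ν ξ)]

/-- characteristic functions of probability measures -/
def IsCF (G : (Fin 2 → ℝ) → ℂ) : Prop :=
  ∃ ν : Measure (Fin 2 → ℝ), IsProbabilityMeasure ν ∧ ∀ ξ, G ξ = ftMeasure ν ξ

lemma IsCF.zero {G : (Fin 2 → ℝ) → ℂ} (h : IsCF G) : G 0 = 1 := by
  obtain ⟨ν, hν, h⟩ := h; rw [h, ft_zero]

lemma IsCF.norm_le {G : (Fin 2 → ℝ) → ℂ} (h : IsCF G) (ξ) : ‖G ξ‖ ≤ 1 := by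
  obtain ⟨ν, hν, h⟩ := h; rw [h]; exact ft_norm_le ν ξ

lemma IsCF.continuous {G : (Fin 2 → ℝ) → ℂ} (h : IsCF G) : Continuous G := by
  obtain ⟨ν, hν, h⟩ := h; rw [funext h]; exact ft_continuous ν

lemma IsCF.mul {G H : (Fin 2 → ℝ) → ℂ} (h : IsCF G) (h' : IsCF H) :
    IsCF (fun ξ => G ξ * H ξ) := by
  obtain ⟨ν, hν, h⟩ := h
  obtain ⟨ν', hν', h'⟩ := h'
  refine ⟨(ν.prod ν').map (fun q => q.1 + q.2), ?_, ?_⟩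
  · exact Measure.isProbabilityMeasure_map (by fun_prop)
  · intro ξ
    show G ξ * H ξ = _
    rw [h, h', ftMeasure, ftMeasure, ftMeasure, integral_map (by fun_prop)
      (expChar_continuous ξ).aestronglyMeasurable]
    simp only [expChar_add_right]
    rw [integral_prod_mul]

lemma IsCF.comp {G : (Fin 2 → ℝ) → ℂ} (h : IsCF G) (T : Module.End ℝ (Fin 2 → ℝ)) :
    IsCF (fun ξ => G (T ξ)) := by
  obtain ⟨ν, hν, h⟩ := h
  set B := LinearMap.toMatrix' T with hB
  have hc : Continuous (fun x : Fin 2 → ℝ => Bᵀ.mulVec x) := by fun_prop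
  refine ⟨ν.map (fun x => Bᵀ.mulVec x), ?_, ?_⟩
  · exact Measure.isProbabilityMeasure_map hc.aemeasurable
  · intro ξ
    show G (T ξ) = _
    rw [h, ftMeasure, ftMeasure, integral_map hc.aemeasurable
      (expChar_continuous ξ).aestronglyMeasurable]
    congr 1; ext x
    have hT : T ξ = B.mulVec ξ := by
      rw [hB, ← Matrix.toLin'_apply, Matrix.toLin'_toMatrix']
    unfold expChar
    rw [hT]
    congr 2
    norm_cast
    simp [Matrix.mulVec, dotProduct, Fin.sum_univ_two, Matrix.transpose_apply]
    ring

lemma IsCF.one : IsCF (fun _ => 1) := by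
  refine ⟨Measure.dirac 0, inferInstance, fun ξ => ?_⟩
  rw [ftMeasure, integral_dirac, expChar_zero_right]

lemma IsCF.mask {p : ℕ} (hp : 0 < p) (D : Fin p → (Fin 2 → ℝ)) : IsCF (mask D) := by
  refine ⟨(p : ℝ≥0∞)⁻¹ • ∑ i : Fin p, Measure.dirac (D i), ⟨?_⟩, fun ξ => ?_⟩
  · simp
    exact ENNReal.inv_mul_cancel (by simpa using hp.ne') (by simp)
  · rw [ftMeasure, integral_smul_measure, integral_finsetSum_measure]
    · simp [_root_.mask, integral_dirac]
    · intro i _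
      exact expChar_integrable _ _

/-- orthogonality of a finite family for a CF -/
def Orth (G : (Fin 2 → ℝ) → ℂ) (Λ : Set (Fin 2 → ℝ)) : Prop :=
  ∀ l ∈ Λ, ∀ l' ∈ Λ, l ≠ l' → G (l - l') = 0

lemma orthonormal_eL (ν : Measure (Fin 2 → ℝ)) [IsProbabilityMeasure ν]
    {Λ : Set (Fin 2 → ℝ)} (h : Orth (ftMeasure ν) Λ) :
    Orthonormal ℂ (fun l : Λ => eL ν l) := by
  refine ⟨fun l => eL_norm ν l, fun l l' hll => ?_⟩
  change inner ℂ (eL ν l) (eL ν l') = 0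
  rw [eL_inner]
  exact h _ l'.2 _ l.2 (fun e => hll (Subtype.ext e.symm))

lemma Orth.mono {G : (Fin 2 → ℝ) → ℂ} {A B : Set (Fin 2 → ℝ)} (h : Orth G B) (hAB : A ⊆ B) :
    Orth G A := fun l hl l' hl' hne => h l (hAB hl) l' (hAB hl') hne

lemma bessel_L2 (ν : Measure (Fin 2 → ℝ)) [IsProbabilityMeasure ν]
    {S : Finset (Fin 2 → ℝ)} (h : Orth (ftMeasure ν) S) (f : Lp ℂ 2 ν) :
    ∑ l ∈ S, ‖inner ℂ (eL ν l) f‖ ^ 2 ≤ ‖f‖ ^ 2 := by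
  have := (orthonormal_eL ν h).sum_inner_products_le (x := f) (s := Finset.univ)
  rw [← Finset.sum_coe_sort S]
  exact this

lemma IsCF.bessel {G : (Fin 2 → ℝ) → ℂ} (hG : IsCF G) {S : Finset (Fin 2 → ℝ)}
    (h : Orth G S) (ξ : Fin 2 → ℝ) : ∑ l ∈ S, ‖G (ξ - l)‖ ^ 2 ≤ 1 := by
  obtain ⟨ν, hν, hG⟩ := hG
  obtain rfl : G = ftMeasure ν := funext hG
  have := bessel_L2 ν h (eL ν ξ)
  simpa only [eL_inner, eL_norm, one_pow] using this

lemma IsCF.bessel2 {G : (Fin 2 → ℝ) → ℂ} (hG : IsCF G) {S : Finset (Fin 2 → ℝ)}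
    (h : Orth G S) (ξ η : Fin 2 → ℝ) :
    ∑ l ∈ S, ‖G (ξ - l) - G (η - l)‖ ^ 2 ≤ 2 - 2 * (G (ξ - η)).re := by
  obtain ⟨ν, hν, hG⟩ := hG
  obtain rfl : G = ftMeasure ν := funext hG
  have := bessel_L2 ν h (eL ν ξ - eL ν η)
  simp only [inner_sub_right, eL_inner] at this
  refine this.trans (le_of_eq ?_)
  have h2 := norm_sub_sq (𝕜 := ℂ) (eL ν η) (eL ν ξ)
  rw [eL_inner, eL_norm, eL_norm] at h2
  rw [norm_sub_rev, h2]; simp; ring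

/-- `Λ` is a spectrum, in terms of a CF. -/
def Spec (F : (Fin 2 → ℝ) → ℂ) (Λ : Set (Fin 2 → ℝ)) : Prop :=
  Orth F Λ ∧ ∀ ξ, ∀ ε > 0, ∃ S : Finset (Fin 2 → ℝ), ↑S ⊆ Λ ∧ 1 - ε < ∑ l ∈ S, ‖F (ξ - l)‖ ^ 2

lemma spec_of_dense {F : (Fin 2 → ℝ) → ℂ} (hF : IsCF F) {Λ : Set (Fin 2 → ℝ)} (ho : Orth F Λ)
    {U : Set (Fin 2 → ℝ)} (hU : Dense U)
    (h : ∀ ξ ∈ U, ∀ ε > 0, ∃ S : Finset (Fin 2 → ℝ), ↑S ⊆ Λ ∧ 1 - ε < ∑ l ∈ S, ‖F (ξ - l)‖ ^ 2) :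
    Spec F Λ := by
  refine ⟨ho, fun ξ ε hε => ?_⟩
  -- choose η ∈ U close to ξ
  set t := min (ε / 4) (1/2) with ht
  have ht0 : 0 < t := by positivity
  have ht1 : t ≤ ε / 4 := min_le_left _ _
  have ht2 : t ≤ 1/2 := min_le_right _ _
  have hcont : Continuous (fun η => 2 - 2 * (F (ξ - η)).re) := by
    have := hF.continuous
    fun_prop
  have hopen : IsOpen {η | 2 - 2 * (F (ξ - η)).re < t * t} :=
    isOpen_lt hcont continuous_const
  obtain ⟨η, hη, hηU⟩ := hU.inter_open_nonempty _ hopen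
    ⟨ξ, by simp [hF.zero]; positivity⟩
  obtain ⟨S, hS, hsum⟩ := h η hηU t ht0
  refine ⟨S, hS, ?_⟩
  have hb := hF.bessel2 (ho.mono hS) ξ η
  have hη : 2 - 2 * (F (ξ - η)).re < t * t := hη
  have hb2 := hF.bessel (ho.mono hS) η
  have key : ∀ l ∈ S, (1 - t) * ‖F (η - l)‖ ^ 2 - (1 / t) * ‖F (ξ - l) - F (η - l)‖ ^ 2
      ≤ ‖F (ξ - l)‖ ^ 2 := by
    intro l _
    have h3 : ‖F (η - l)‖ ≤ ‖F (ξ - l)‖ + ‖F (ξ - l) - F (η - l)‖ := by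
      have := norm_sub_le (F (ξ - l)) (F (ξ - l) - F (η - l))
      simpa using this
    set A := ‖F (η - l)‖
    set B := ‖F (ξ - l)‖
    set d := ‖F (ξ - l) - F (η - l)‖
    have hA : 0 ≤ A := norm_nonneg _
    have hB : 0 ≤ B := norm_nonneg _
    have hd : 0 ≤ d := norm_nonneg _
    have h4 : A ^ 2 ≤ (B + d) ^ 2 := by gcongr
    -- (1-t)(B+d)^2 ≤ B^2 + d^2/t
    have h5 : (1 - t) * (B + d) ^ 2 ≤ B ^ 2 + (1 / t) * d ^ 2 := by
      have : B ^ 2 + (1 / t) * d ^ 2 - (1 - t) * (B + d) ^ 2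
          = (1 / t) * ((t * B - (1 - t) * d) ^ 2) + d ^ 2 := by
        field_simp; ring
      have h6 : 0 ≤ (1 / t) * ((t * B - (1 - t) * d) ^ 2) + d ^ 2 := by positivity
      linarith
    have h7 : (1 - t) * A ^ 2 ≤ (1 - t) * (B + d) ^ 2 :=
      mul_le_mul_of_nonneg_left h4 (by linarith)
    linarith
  have hs := Finset.sum_le_sum key
  rw [Finset.sum_sub_distrib, ← Finset.mul_sum, ← Finset.mul_sum] at hs
  have h8 : (1 / t) * ∑ l ∈ S, ‖F (ξ - l) - F (η - l)‖ ^ 2 ≤ t := by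
    calc (1 / t) * ∑ l ∈ S, ‖F (ξ - l) - F (η - l)‖ ^ 2 ≤ (1 / t) * (t * t) := by
          gcongr; linarith
      _ = t := by field_simp
  have h9 : (1 - t) * (1 - t) ≤ (1 - t) * ∑ l ∈ S, ‖F (η - l)‖ ^ 2 :=
    mul_le_mul_of_nonneg_left hsum.le (by linarith)
  nlinarith

lemma Spec.translate {F : (Fin 2 → ℝ) → ℂ} {Λ : Set (Fin 2 → ℝ)} (h : Spec F Λ) (γ : Fin 2 → ℝ) :
    Spec F {l | l + γ ∈ Λ} := by
  classical
  refine ⟨fun l hl l' hl' hne => ?_, fun ξ ε hε => ?_⟩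
  · have := h.1 _ hl _ hl' (by simpa using hne)
    simpa using this
  · obtain ⟨S, hS, hs⟩ := h.2 (ξ + γ) ε hε
    refine ⟨S.image (fun l => l - γ), ?_, ?_⟩
    · intro l hl
      simp only [Finset.coe_image, Set.mem_image] at hl
      obtain ⟨l', hl', rfl⟩ := hl
      simpa using hS hl'
    · rw [Finset.sum_image (by intro a _ b _ hab; simpa using hab)]
      convert hs using 5
      abel

lemma Spec.nonempty {F : (Fin 2 → ℝ) → ℂ} {Λ : Set (Fin 2 → ℝ)} (h : Spec F Λ) : Λ.Nonempty := by
  obtain ⟨S, hS, hs⟩ := h.2 0 1 one_pos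
  by_contra hne
  rw [Set.not_nonempty_iff_eq_empty] at hne
  subst hne
  have : S = ∅ := by simpa using hS
  subst this
  simp at hs

/-- spectral measures have a `Spec` set. -/
lemma exists_spec_of_isSpectral {μ : Measure (Fin 2 → ℝ)} [IsProbabilityMeasure μ]
    (h : IsSpectral μ) : ∃ Λ, Spec (ftMeasure μ) Λ := by
  classical
  obtain ⟨Λ, -, b, hb⟩ := h
  have hb' : ∀ l : Λ, b l = eL μ l := by
    intro l
    apply Lp.ext
    refine (hb l).trans ?_
    exact ((expChar_memLp μ l).coeFn_toLp).symm
  refine ⟨Λ, ?_, ?_⟩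
  · intro l hl l' hl' hne
    have := b.orthonormal.2 (i := ⟨l', hl'⟩) (j := ⟨l, hl⟩) (fun e => hne (by
      simpa using (congrArg Subtype.val e).symm))
    change inner ℂ _ _ = 0 at this
    rw [hb', hb', eL_inner] at this
    exact this
  · intro ξ ε hε
    have hs := b.hasSum_inner_mul_inner (eL μ ξ) (eL μ ξ)
    have hs2 : HasSum (fun l : Λ => ‖ftMeasure μ (ξ - l)‖ ^ 2) 1 := by
      rw [eL_inner, sub_self, ft_zero] at hs
      have h3 := (Complex.hasSum_re hs)
      simp only [Complex.one_re] at h3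
      convert h3 using 2 with l
      rw [hb', ← inner_conj_symm, eL_inner, mul_comm, Complex.mul_conj, Complex.normSq_eq_norm_sq]
      simp [← Complex.ofReal_pow]
    have := hs2.eventually (lt_mem_nhds (show 1 - ε < 1 by linarith))
    obtain ⟨S, hS⟩ := this.exists
    refine ⟨S.map (Function.Embedding.subtype _), ?_, ?_⟩
    · intro l hl
      simp at hl
      exact hl.1
    · simpa using hS

/-- integer vectors -/
def intLat : AddSubgroup (Fin 2 → ℝ) where
  carrier := {x | ∃ k : Fin 2 → ℤ, ∀ i, x i = k i}
  zero_mem' := ⟨0, by simp⟩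
  add_mem' := by
    rintro x y ⟨k, hk⟩ ⟨l, hl⟩
    exact ⟨k + l, fun i => by simp [hk, hl]⟩
  neg_mem' := by
    rintro x ⟨k, hk⟩
    exact ⟨-k, fun i => by simp [hk]⟩

lemma mem_intLat {x : Fin 2 → ℝ} : x ∈ intLat ↔ ∃ k : Fin 2 → ℤ, ∀ i, x i = k i := Iff.rfl

/-- integer vector as a real vector -/
def aR (a : Fin 2 → ℤ) : Fin 2 → ℝ := fun i => (a i : ℝ)

/-- abstract data of the problem -/
structure Sys (p : ℕ) (a : Fin 2 → ℤ) (R T : Module.End ℝ (Fin 2 → ℝ))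
    (m F : (Fin 2 → ℝ) → ℂ) : Prop where
  prime : p.Prime
  RT : ∀ x, R (T x) = x
  TR : ∀ x, T (R x) = x
  cfm : IsCF m
  cfF : IsCF F
  feq : ∀ ξ, F ξ = m (T ξ) * F (T ξ)
  contr : ∃ r C : ℝ, 0 ≤ r ∧ r < 1 ∧ 0 ≤ C ∧ ∀ (k : ℕ) (ξ : Fin 2 → ℝ), ‖(T ^ k) ξ‖ ≤ C * r ^ k * ‖ξ‖
  a_range : ∀ i, 1 ≤ a i ∧ a i ≤ (p : ℤ) - 1
  zero : ∀ ξ, m ξ = 0 ↔ ∃ j : ℤ, ¬ (p : ℤ) ∣ j ∧ ξ - ((j : ℝ) / p) • aR a ∈ intLat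
  per : ∀ ξ, ∀ k ∈ intLat, m (ξ + k) = m ξ
  near : ∃ C : ℤ, C ≠ 0 ∧ ∀ ε > 0, ∃ η : ℝ, η < 1 ∧ ∀ x, η < ‖m x‖ →
    ∀ i, ∃ z : ℤ, |(C : ℝ) * x i - z| < ε

/-- the transpose of the matrix -/
def Rm (n1 n2 c : ℝ) : Module.End ℝ (Fin 2 → ℝ) where
  toFun ξ := ![n1 * ξ 0, c * ξ 0 + n2 * ξ 1]
  map_add' x y := by
    ext i; fin_cases i <;> simp <;> ring
  map_smul' r x := by
    ext i; fin_cases i <;> simp <;> ring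

/-- the inverse transpose -/
def Tm (n1 n2 c : ℝ) : Module.End ℝ (Fin 2 → ℝ) where
  toFun ξ := ![n1⁻¹ * ξ 0, n2⁻¹ * ξ 1 - c * n1⁻¹ * n2⁻¹ * ξ 0]
  map_add' x y := by
    ext i; fin_cases i <;> simp <;> ring
  map_smul' r x := by
    ext i; fin_cases i <;> simp <;> ring

@[simp] lemma Rm_0 (n1 n2 c : ℝ) (x) : Rm n1 n2 c x 0 = n1 * x 0 := rfl
@[simp] lemma Rm_1 (n1 n2 c : ℝ) (x) : Rm n1 n2 c x 1 = c * x 0 + n2 * x 1 := rfl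
@[simp] lemma Tm_0 (n1 n2 c : ℝ) (x) : Tm n1 n2 c x 0 = n1⁻¹ * x 0 := rfl
@[simp] lemma Tm_1 (n1 n2 c : ℝ) (x) :
    Tm n1 n2 c x 1 = n2⁻¹ * x 1 - c * n1⁻¹ * n2⁻¹ * x 0 := rfl

lemma Rm_Tm (n1 n2 c : ℝ) (h1 : n1 ≠ 0) (h2 : n2 ≠ 0) (x) :
    Rm n1 n2 c (Tm n1 n2 c x) = x := by
  ext i; fin_cases i
  · simp; field_simp
  · simp; field_simp; ring

lemma Tm_Rm (n1 n2 c : ℝ) (h1 : n1 ≠ 0) (h2 : n2 ≠ 0) (x) :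
    Tm n1 n2 c (Rm n1 n2 c x) = x := by
  ext i; fin_cases i
  · simp; field_simp
  · simp; field_simp; ring

lemma Tm_contr (n1 n2 c : ℝ) (h1 : 1 < n1) (h2 : 1 < n2) :
    ∃ r C : ℝ, 0 ≤ r ∧ r < 1 ∧ 0 ≤ C ∧
      ∀ (k : ℕ) (ξ : Fin 2 → ℝ), ‖(Tm n1 n2 c ^ k) ξ‖ ≤ C * r ^ k * ‖ξ‖ := by
  set ρ1 := n1⁻¹ with hρ1
  set ρ2 := n2⁻¹ with hρ2
  have a1 : 0 < ρ1 := by positivity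
  have a2 : 0 < ρ2 := by positivity
  have b1 : ρ1 < 1 := inv_lt_one_of_one_lt₀ h1
  have b2 : ρ2 < 1 := inv_lt_one_of_one_lt₀ h2
  set B := 2 * |c| / (1 - ρ1) + 1 with hB
  have hB1 : 1 ≤ B := by
    have : 0 ≤ 2 * |c| / (1 - ρ1) := div_nonneg (by positivity) (by linarith)
    linarith
  have hB2 : 2 * |c| ≤ B * (1 - ρ1) := by
    have : 2 * |c| / (1 - ρ1) * (1 - ρ1) = 2 * |c| := by
      have : (1 - ρ1) ≠ 0 := by linarith
      field_simp
    rw [hB]; nlinarith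
  set r := max ((1 + ρ1) / 2) ρ2 with hr
  have r1 : (1 + ρ1) / 2 ≤ r := le_max_left _ _
  have r2 : ρ2 ≤ r := le_max_right _ _
  have r3 : r < 1 := max_lt (by linarith) b2
  have step : ∀ ξ : Fin 2 → ℝ, B * |Tm n1 n2 c ξ 0| + |Tm n1 n2 c ξ 1| ≤ r * (B * |ξ 0| + |ξ 1|) := by
    intro ξ
    rw [Tm_0, Tm_1, ← hρ1, ← hρ2]
    have e1 : |ρ1 * ξ 0| = ρ1 * |ξ 0| := by rw [abs_mul, abs_of_pos a1]
    have e2 : |ρ2 * ξ 1 - c * ρ1 * ρ2 * ξ 0| ≤ ρ2 * |ξ 1| + |c| * |ξ 0| := by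
      refine (abs_sub _ _).trans ?_
      rw [abs_mul, abs_of_pos a2, abs_mul, abs_mul, abs_mul, abs_of_pos a1, abs_of_pos a2]
      have : |c| * ρ1 * ρ2 ≤ |c| := by
        have : ρ1 * ρ2 ≤ 1 := by nlinarith
        nlinarith [abs_nonneg c]
      have := mul_le_mul_of_nonneg_right this (abs_nonneg (ξ 0))
      linarith
    rw [e1]
    have h0 := abs_nonneg (ξ 0)
    have h1 := abs_nonneg (ξ 1)
    have e3 : B * ρ1 + |c| ≤ r * B := by nlinarith
    have e4 := mul_le_mul_of_nonneg_right e3 h0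
    have e5 := mul_le_mul_of_nonneg_right r2 h1
    nlinarith
  have r0 : 0 ≤ r := by linarith
  have iter : ∀ (k : ℕ) (ξ : Fin 2 → ℝ), B * |(Tm n1 n2 c ^ k) ξ 0| + |(Tm n1 n2 c ^ k) ξ 1|
      ≤ r ^ k * (B * |ξ 0| + |ξ 1|) := by
    intro k
    induction k with
    | zero => intro ξ; simp
    | succ k ih =>
      intro ξ
      rw [pow_succ', Module.End.mul_apply]
      refine (step _).trans ?_
      rw [pow_succ', mul_assoc]
      exact mul_le_mul_of_nonneg_left (ih ξ) r0
  refine ⟨r, B + 1, r0, r3, by linarith, fun k ξ => ?_⟩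
  have hh := iter k ξ
  have n0 : |ξ 0| ≤ ‖ξ‖ := norm_le_pi_norm ξ 0
  have n1' : |ξ 1| ≤ ‖ξ‖ := norm_le_pi_norm ξ 1
  have hb : r ^ k * (B * |ξ 0| + |ξ 1|) ≤ (B + 1) * r ^ k * ‖ξ‖ := by
    have : B * |ξ 0| + |ξ 1| ≤ (B + 1) * ‖ξ‖ := by nlinarith
    calc _ ≤ r ^ k * ((B + 1) * ‖ξ‖) := mul_le_mul_of_nonneg_left this (by positivity)
      _ = _ := by ring
  refine le_trans ?_ (hh.trans hb)
  rw [pi_norm_le_iff_of_nonneg (by positivity)]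
  intro i
  rw [Real.norm_eq_abs]
  have g0 := abs_nonneg ((Tm n1 n2 c ^ k) ξ 0)
  have g1 := abs_nonneg ((Tm n1 n2 c ^ k) ξ 1)
  fin_cases i
  · simp; nlinarith
  · simp; nlinarith

lemma expChar_digit_per {p : ℕ} (D : Fin p → (Fin 2 → ℤ)) (i : Fin p) {k : Fin 2 → ℝ}
    (hk : k ∈ intLat) : expChar k (digitR D i) = 1 := by
  obtain ⟨l, hl⟩ := hk
  unfold expChar digitR
  rw [hl, hl, Complex.exp_eq_one_iff]
  refine ⟨-(l 0 * D i 0 + l 1 * D i 1), ?_⟩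
  push_cast; ring

lemma mask_per {p : ℕ} (D : Fin p → (Fin 2 → ℤ)) (ξ k : Fin 2 → ℝ) (hk : k ∈ intLat) :
    mask (digitR D) (ξ + k) = mask (digitR D) ξ := by
  unfold mask
  simp only [expChar_add_left, expChar_digit_per D _ hk, mul_one]

lemma one_add_expChar (x d : Fin 2 → ℝ) :
    ‖1 + expChar x d‖ = 2 * |Real.cos (Real.pi * (x 0 * d 0 + x 1 * d 1))| := by
  set t := x 0 * d 0 + x 1 * d 1
  have : 1 + expChar x d = 2 * ((Real.cos (Real.pi * t) : ℝ) : ℂ) *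
      Complex.exp (((-Real.pi * t : ℝ) : ℂ) * Complex.I) := by
    unfold expChar
    rw [Complex.ofReal_cos, Complex.two_cos, add_mul, ← Complex.exp_add, ← Complex.exp_add]
    rw [show ((Real.pi * t : ℝ) : ℂ) * I + ((-Real.pi * t : ℝ) : ℂ) * I = 0 by push_cast; ring]
    rw [Complex.exp_zero]
    congr 2
    simp only [t]; push_cast; ring
  rw [this, norm_mul, norm_mul, Complex.norm_exp_ofReal_mul_I, Complex.norm_real]
  simp

lemma abs_cos_pi_le (t ε : ℝ) (hε : 0 < ε) (hε2 : ε ≤ 1 / 2)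
    (h : ∀ z : ℤ, ε ≤ |t - z|) : |Real.cos (Real.pi * t)| ≤ Real.cos (Real.pi * ε) := by
  set u := t - round t
  have hu : |u| ≤ 1 / 2 := abs_sub_round t
  have hu2 : ε ≤ |u| := h _
  have e1 : |Real.cos (Real.pi * t)| = |Real.cos (Real.pi * u)| := by
    have : Real.pi * t = Real.pi * u + (round t : ℤ) * Real.pi := by simp [u]; ring
    rw [this, Real.cos_add_int_mul_pi, abs_mul]
    rw [abs_zpow, abs_neg, abs_one, _root_.one_zpow, one_mul]
  have e2 : |Real.cos (Real.pi * u)| = Real.cos (Real.pi * |u|) := by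
    rw [← Real.cos_abs, abs_mul, abs_of_pos Real.pi_pos, abs_of_nonneg]
    apply Real.cos_nonneg_of_mem_Icc
    constructor <;> nlinarith [Real.pi_pos, abs_nonneg u]
  rw [e1, e2]
  apply Real.cos_le_cos_of_nonneg_of_le_pi
  · have := Real.pi_pos; positivity
  · nlinarith [Real.pi_pos]
  · exact mul_le_mul_of_nonneg_left hu2 Real.pi_pos.le

lemma mask_near {p : ℕ} (D : Fin p → (Fin 2 → ℤ)) (i0 i : Fin p) (h0 : D i0 = 0) (hi : D i ≠ 0)
    (ε : ℝ) (hε : 0 < ε) : ∃ η : ℝ, η < 1 ∧ ∀ x, η < ‖mask (digitR D) x‖ →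
      ∃ z : ℤ, |x 0 * D i 0 + x 1 * D i 1 - z| < ε := by
  have hne : i0 ≠ i := by rintro rfl; exact hi h0
  set e := min ε (1 / 2)
  have he0 : 0 < e := by positivity
  have he1 : e ≤ ε := min_le_left _ _
  have he2 : e ≤ 1 / 2 := min_le_right _ _
  have hcos : Real.cos (Real.pi * e) < 1 := by
    have := Real.cos_lt_cos_of_nonneg_of_le_pi (x := 0) (y := Real.pi * e) le_rfl
      (by nlinarith [Real.pi_pos]) (by have := Real.pi_pos; positivity)
    simpa using this
  have hp : 0 < (p : ℝ) := by
    have : 0 < p := i.pos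
    exact_mod_cast this
  refine ⟨(p - 2 + 2 * Real.cos (Real.pi * e)) / p, ?_, ?_⟩
  · rw [div_lt_one hp]; linarith
  · intro x hx
    by_contra hcon
    push Not at hcon
    have hc := abs_cos_pi_le (x 0 * D i 0 + x 1 * D i 1) e he0 he2 (fun z => he1.trans (hcon z))
    have h1 := one_add_expChar x (digitR D i)
    have hle : ‖∑ j : Fin p, expChar x (digitR D j)‖ ≤ p - 2 + 2 * Real.cos (Real.pi * e) := by
      rw [← Finset.add_sum_erase _ _ (Finset.mem_univ i0),
        ← Finset.add_sum_erase (Finset.univ.erase i0) _ (Finset.mem_erase.2 ⟨hne.symm, Finset.mem_univ i⟩),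
        ← add_assoc]
      have h2 : expChar x (digitR D i0) = 1 := by
        have : digitR D i0 = 0 := by
          ext j; simp [digitR, h0]
        rw [this, expChar_zero_right]
      rw [h2]
      refine (norm_add_le _ _).trans ?_
      have h3 : ‖∑ j ∈ (Finset.univ.erase i0).erase i, expChar x (digitR D j)‖ ≤ p - 2 := by
        refine (norm_sum_le _ _).trans ?_
        simp only [expChar_norm, Finset.sum_const, nsmul_eq_mul, mul_one]
        rw [Finset.card_erase_of_mem (Finset.mem_erase.2 ⟨hne.symm, Finset.mem_univ i⟩),
          Finset.card_erase_of_mem (Finset.mem_univ i0), Finset.card_univ, Fintype.card_fin]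
        have : 2 ≤ p := by
          have h1 := i.2
          have h2 := i0.2
          have h3 : (i0 : ℕ) ≠ i := fun h => hne (Fin.ext h)
          omega
        rw [Nat.sub_sub]
        push_cast [Nat.cast_sub this]; norm_num
      have h4 : ‖1 + expChar x (digitR D i)‖ ≤ 2 * Real.cos (Real.pi * e) := by
        rw [h1]; simp only [digitR]; linarith
      linarith
    unfold mask at hx
    rw [norm_mul, norm_inv, Complex.norm_natCast, div_lt_iff₀ hp] at hx
    have : (p : ℝ)⁻¹ * ‖∑ j : Fin p, expChar x (digitR D j)‖ * p
        = ‖∑ j : Fin p, expChar x (digitR D j)‖ := by field_simp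
    linarith

lemma exists_second (p : ℕ) (hp : p.Prime) (D : Fin p → (Fin 2 → ℤ)) (a : Fin 2 → ℤ)
    (hZ : ZeroSetCond p D a) : ∃ i, D i 1 ≠ 0 := by
  by_contra hcon
  push Not at hcon
  have hp0 : (p : ℝ) ≠ 0 := by exact_mod_cast hp.ne_zero
  have h1 : mask (digitR D) (fun i => (1 : ℕ) * (a i : ℝ) / p) = 0 := by
    rw [hZ.2]
    exact ⟨1, le_rfl, by have := hp.two_le; omega, 0, by simp⟩
  have h2 : mask (digitR D) ![(1 : ℕ) * (a 0 : ℝ) / p, 1 / (2 * p)] = 0 := by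
    rw [← h1]
    unfold mask
    congr 1
    refine Finset.sum_congr rfl fun i _ => ?_
    unfold expChar
    simp [digitR, hcon]
  rw [hZ.2] at h2
  obtain ⟨j, -, -, k, hk⟩ := h2
  have h3 := hk 1
  simp at h3
  field_simp at h3
  have : (1 : ℤ) = 2 * (j * a 1 + p * k 1) := by
    exact_mod_cast (by push_cast; linarith : (1 : ℝ) = ((2 * (j * a 1 + p * k 1) : ℤ) : ℝ))
  omega

lemma sys_of (p : ℕ) (hp : p.Prime) (ρ₁ ρ₂ c : ℝ)
    (hρ10 : 0 < ρ₁) (hρ11 : ρ₁ < 1) (hρ20 : 0 < ρ₂) (hρ21 : ρ₂ < 1)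
    (D : Fin p → (Fin 2 → ℤ)) 
    (a : Fin 2 → ℤ) (hZ : ZeroSetCond p D a)
    (hD0 : D ⟨0, hp.pos⟩ = 0)
    (hD11 : D ⟨1, hp.one_lt⟩ 1 = 0) (hD10 : D ⟨1, hp.one_lt⟩ 0 ≠ 0)
    (μ : Measure (Fin 2 → ℝ)) (hμ : IsSelfAffine μ (Mupper ρ₁ ρ₂ c) (digitR D)) :
    Sys p a (Rm ρ₁⁻¹ ρ₂⁻¹ c) (Tm ρ₁⁻¹ ρ₂⁻¹ c) (mask (digitR D)) (ftMeasure μ) := by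
  have hpr := hμ.1
  have hp0 : (p : ℝ) ≠ 0 := by exact_mod_cast hp.ne_zero
  refine ⟨hp, Rm_Tm _ _ _ (by positivity) (by positivity), Tm_Rm _ _ _ (by positivity) (by positivity),
    IsCF.mask hp.pos _, ⟨μ, hμ.1, fun _ => rfl⟩, ?_,
    Tm_contr _ _ _ ((one_lt_inv₀ hρ10).2 hρ11) ((one_lt_inv₀ hρ20).2 hρ21), hZ.1, ?_,
    fun ξ k hk => mask_per D ξ k hk, ?_⟩
  · intro ξ
    have hM : (Mupper ρ₁ ρ₂ c)⁻¹ = !![ρ₁, -c * ρ₁ * ρ₂; 0, ρ₂] := by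
      apply Matrix.inv_eq_right_inv
      unfold Mupper
      rw [Matrix.mul_fin_two, Matrix.one_fin_two]
      congr 1
      ext i j
      fin_cases i <;> fin_cases j <;> simp <;> field_simp <;> ring
    have hc : ∀ i, Continuous (fun x => (Mupper ρ₁ ρ₂ c)⁻¹.mulVec (x + digitR D i)) := by
      intro i; fun_prop
    have key : ∀ i x, expChar ξ ((Mupper ρ₁ ρ₂ c)⁻¹.mulVec (x + digitR D i))
        = expChar (Tm ρ₁⁻¹ ρ₂⁻¹ c ξ) x * expChar (Tm ρ₁⁻¹ ρ₂⁻¹ c ξ) (digitR D i) := by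
      intro i x
      rw [← expChar_add_right]
      unfold expChar
      rw [Tm_0, Tm_1, hM, inv_inv, inv_inv]
      congr 3
      simp [Matrix.mulVec, dotProduct, Fin.sum_univ_two]
      ring
    conv_lhs => rw [hμ.2.2]
    rw [ftMeasure, integral_smul_measure, integral_finsetSum_measure]
    · have : ∀ i : Fin p, ∫ x, expChar ξ x ∂(μ.map (fun x => (Mupper ρ₁ ρ₂ c)⁻¹.mulVec (x + digitR D i)))
          = ftMeasure μ (Tm ρ₁⁻¹ ρ₂⁻¹ c ξ) * expChar (Tm ρ₁⁻¹ ρ₂⁻¹ c ξ) (digitR D i) := by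
        intro i
        rw [integral_map (hc i).aemeasurable (expChar_continuous ξ).aestronglyMeasurable]
        simp only [key]
        rw [integral_mul_const]; rfl
      simp only [this]
      rw [← Finset.mul_sum]
      simp [mask]
      ring
    · intro i _
      have : IsProbabilityMeasure (μ.map (fun x => (Mupper ρ₁ ρ₂ c)⁻¹.mulVec (x + digitR D i))) :=
        Measure.isProbabilityMeasure_map (hc i).aemeasurable
      exact expChar_integrable _ _
  · intro ξ
    rw [hZ.2]
    constructor
    · rintro ⟨j, hj1, hj2, k, hk⟩
      refine ⟨j, ?_, k, ?_⟩
      · intro hd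
        have := Nat.le_of_dvd (by omega) (Int.natCast_dvd_natCast.1 hd)
        have := hp.two_le
        omega
      · intro i
        simp [hk i, aR]; ring
    · rintro ⟨j, hj, k, hk⟩
      have hmod : 0 ≤ j % p := Int.emod_nonneg _ (by exact_mod_cast hp.ne_zero)
      have hmod2 : j % p < p := Int.emod_lt_of_pos _ (by exact_mod_cast hp.pos)
      have hmod3 : j % p ≠ 0 := fun h => hj (Int.dvd_of_emod_eq_zero h)
      refine ⟨(j % p).toNat, by omega, by omega, fun i => (j / p) * a i + k i, fun i => ?_⟩
      have h1 := hk i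
      simp [aR] at h1
      have h2 : (((j % p).toNat : ℕ) : ℝ) = ((j % p : ℤ) : ℝ) := by
        have : (((j % p).toNat : ℕ) : ℤ) = j % p := Int.toNat_of_nonneg hmod
        exact_mod_cast this
      have h3 : (j : ℝ) = (p : ℝ) * ((j / p : ℤ) : ℝ) + ((j % p : ℤ) : ℝ) := by
        exact_mod_cast (Int.mul_ediv_add_emod j p).symm
      rw [h2]
      have h4 : ((j % p : ℤ) : ℝ) = j - p * ((j / p : ℤ) : ℝ) := by linarith
      rw [h4]
      push_cast
      have h5 : ξ i = (j : ℝ) / p * a i + k i := by linarith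
      rw [h5]
      field_simp
      ring
  · obtain ⟨i2, hi2⟩ := exists_second p hp D a hZ
    set d11 := D ⟨1, hp.one_lt⟩ 0
    set u := D i2 0
    set w := D i2 1
    refine ⟨d11 * w, mul_ne_zero hD10 hi2, fun ε hε => ?_⟩
    set K : ℝ := |(d11 : ℝ)| + |(u : ℝ)| + |(w : ℝ)| + 1
    have hK : 0 < K := by positivity
    obtain ⟨η1, hη1, H1⟩ := mask_near D ⟨0, hp.pos⟩ ⟨1, hp.one_lt⟩ hD0
      (fun h => hD10 (by simp [d11, h])) (ε / K) (by positivity)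
    obtain ⟨η2, hη2, H2⟩ := mask_near D ⟨0, hp.pos⟩ i2 hD0
      (fun h => hi2 (by simp [w, h])) (ε / K) (by positivity)
    refine ⟨max η1 η2, max_lt hη1 hη2, fun x hx i => ?_⟩
    obtain ⟨z1, hz1⟩ := H1 x ((le_max_left _ _).trans_lt hx)
    obtain ⟨z2, hz2⟩ := H2 x ((le_max_right _ _).trans_lt hx)
    change |x 0 * d11 + x 1 * (D ⟨1, hp.one_lt⟩ 1 : ℤ) - z1| < _ at hz1
    change |x 0 * u + x 1 * w - z2| < _ at hz2
    rw [hD11] at hz1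
    simp only [Int.cast_zero, mul_zero, add_zero] at hz1
    have hεK : ε / K * K = ε := by field_simp
    have hk0 : 0 < ε / K := by positivity
    fin_cases i
    · refine ⟨w * z1, ?_⟩
      have : ((d11 * w : ℤ) : ℝ) * x 0 - ((w * z1 : ℤ) : ℝ) = w * (x 0 * d11 - z1) := by
        push_cast; ring
      change |((d11 * w : ℤ) : ℝ) * x 0 - ((w * z1 : ℤ) : ℝ)| < ε
      rw [this, abs_mul]
      have h1 := mul_le_mul_of_nonneg_left hz1.le (abs_nonneg (w : ℝ))
      have h2 : |(w : ℝ)| * (ε / K) < K * (ε / K) := by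
        apply mul_lt_mul_of_pos_right _ hk0
        have := abs_nonneg (d11 : ℝ)
        have := abs_nonneg (u : ℝ)
        simp only [K]; linarith
      linarith
    · refine ⟨d11 * z2 - u * z1, ?_⟩
      have : ((d11 * w : ℤ) : ℝ) * x 1 - ((d11 * z2 - u * z1 : ℤ) : ℝ)
          = d11 * (x 0 * u + x 1 * w - z2) - u * (x 0 * d11 - z1) := by
        push_cast; ring
      change |((d11 * w : ℤ) : ℝ) * x 1 - ((d11 * z2 - u * z1 : ℤ) : ℝ)| < ε
      rw [this]
      refine (abs_sub _ _).trans_lt ?_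
      rw [abs_mul, abs_mul]
      have h1 := mul_le_mul_of_nonneg_left hz1.le (abs_nonneg (u : ℝ))
      have h1' := mul_le_mul_of_nonneg_left hz2.le (abs_nonneg (d11 : ℝ))
      have h2 : (|(d11 : ℝ)| + |(u : ℝ)|) * (ε / K) < K * (ε / K) := by
        apply mul_lt_mul_of_pos_right _ hk0
        have := abs_nonneg (w : ℝ)
        simp only [K]; linarith
      linarith

/-- partial products -/
def Fk (m : (Fin 2 → ℝ) → ℂ) (T : Module.End ℝ (Fin 2 → ℝ)) (k : ℕ) (ξ : Fin 2 → ℝ) : ℂ :=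
  ∏ i ∈ Finset.range k, m ((T ^ (i + 1)) ξ)

lemma Fk_succ (m : (Fin 2 → ℝ) → ℂ) (T : Module.End ℝ (Fin 2 → ℝ)) (k : ℕ) (ξ : Fin 2 → ℝ) :
    Fk m T (k + 1) ξ = Fk m T k ξ * m ((T ^ (k + 1)) ξ) := by
  unfold Fk; rw [Finset.prod_range_succ]

lemma Fk_add (m : (Fin 2 → ℝ) → ℂ) (T : Module.End ℝ (Fin 2 → ℝ)) (k l : ℕ) (ξ : Fin 2 → ℝ) :
    Fk m T (k + l) ξ = Fk m T k ξ * Fk m T l ((T ^ k) ξ) := by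
  unfold Fk; rw [Finset.prod_range_add]
  congr 1
  refine Finset.prod_congr rfl fun i _ => ?_
  rw [← Module.End.mul_apply, ← pow_add]
  congr 3; ring

namespace Sys
variable {p : ℕ} {a : Fin 2 → ℤ} {R T : Module.End ℝ (Fin 2 → ℝ)} {m F : (Fin 2 → ℝ) → ℂ}

lemma RTk (hs : Sys p a R T m F) (k : ℕ) (x) : (R ^ k) ((T ^ k) x) = x := by
  have h : R * T = 1 := LinearMap.ext hs.RT
  have h' : T * R = 1 := LinearMap.ext hs.TR
  have hc : Commute R T := by rw [Commute, SemiconjBy, h, h']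
  rw [← Module.End.mul_apply, ← hc.mul_pow, h, one_pow]; rfl

lemma TRk (hs : Sys p a R T m F) (k : ℕ) (x) : (T ^ k) ((R ^ k) x) = x := by
  have h : R * T = 1 := LinearMap.ext hs.RT
  have h' : T * R = 1 := LinearMap.ext hs.TR
  have hc : Commute T R := by rw [Commute, SemiconjBy, h, h']
  rw [← Module.End.mul_apply, ← hc.mul_pow, h', one_pow]; rfl

lemma Tk_R (hs : Sys p a R T m F) (k : ℕ) (x) : (T ^ (k + 1)) (R x) = (T ^ k) x := by
  rw [pow_succ, Module.End.mul_apply, hs.TR]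

lemma tend (hs : Sys p a R T m F) (ξ) :
    Filter.Tendsto (fun k : ℕ => (T ^ k) ξ) Filter.atTop (nhds 0) := by
  obtain ⟨r, C, h0, h1, hC, h⟩ := hs.contr
  refine squeeze_zero_norm (fun k => h k ξ) ?_
  have := (tendsto_pow_atTop_nhds_zero_of_lt_one h0 h1).const_mul C |>.mul_const ‖ξ‖
  simpa using this

lemma cfFk (hs : Sys p a R T m F) (k : ℕ) : IsCF (Fk m T k) := by
  induction k with
  | zero => exact IsCF.one
  | succ k ih =>
    have := ih.mul (hs.cfm.comp (T ^ (k + 1)))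
    rw [show Fk m T (k + 1) = _ from funext (Fk_succ m T k)]
    exact this

lemma F_eq (hs : Sys p a R T m F) (k : ℕ) (ξ) : F ξ = Fk m T k ξ * F ((T ^ k) ξ) := by
  induction k with
  | zero => simp [Fk]
  | succ k ih =>
    rw [ih, Fk_succ, hs.feq ((T ^ k) ξ), mul_assoc]
    rw [← Module.End.mul_apply, ← pow_succ']

lemma F_zero_of (hs : Sys p a R T m F) {k : ℕ} (hk : 1 ≤ k) {ξ} (h : m ((T ^ k) ξ) = 0) :
    F ξ = 0 := by
  obtain ⟨k, rfl⟩ : ∃ l, k = l + 1 := ⟨k - 1, by omega⟩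
  rw [hs.F_eq (k + 1), Fk_succ, h]; simp

lemma Fk_zero_of {k K : ℕ} (hk : 1 ≤ k) (hK : k ≤ K) {ξ} (h : m ((T ^ k) ξ) = 0) :
    Fk m T K ξ = 0 := by
  unfold Fk
  apply Finset.prod_eq_zero (i := k - 1) (by simp; omega)
  rw [Nat.sub_add_cancel hk, h]

lemma F_zero_iff (hs : Sys p a R T m F) {ξ} : F ξ = 0 ↔ ∃ k, 1 ≤ k ∧ m ((T ^ k) ξ) = 0 := by
  constructor
  · intro h
    have ht : Filter.Tendsto (fun k : ℕ => F ((T ^ k) ξ)) Filter.atTop (nhds 1) := by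
      have := (hs.cfF.continuous.tendsto 0).comp (hs.tend ξ)
      rwa [hs.cfF.zero] at this
    obtain ⟨k, hk⟩ := (ht.eventually_ne one_ne_zero).exists
    rw [hs.F_eq k] at h
    rcases mul_eq_zero.1 h with h | h
    · unfold Fk at h
      rw [Finset.prod_eq_zero_iff] at h
      obtain ⟨i, _, hi⟩ := h
      exact ⟨i + 1, by omega, hi⟩
    · exact absurd h hk
  · rintro ⟨k, hk, h⟩
    exact hs.F_zero_of hk h

lemma m_lat (hs : Sys p a R T m F) {k} (hk : k ∈ intLat) : m k = 1 := by
  have := hs.per 0 k hk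
  rwa [zero_add, hs.cfm.zero] at this

lemma m_neg (hs : Sys p a R T m F) {x} (h : m x = 0) : m (-x) = 0 := by
  rw [hs.zero] at h ⊢
  obtain ⟨j, hj, h⟩ := h
  refine ⟨-j, by simpa using hj, ?_⟩
  have := intLat.neg_mem h
  convert this using 1
  push_cast
  module

lemma m_per_sub (hs : Sys p a R T m F) (x) {k} (hk : k ∈ intLat) : m (x - k) = m x := by
  rw [sub_eq_add_neg]; exact hs.per x _ (intLat.neg_mem hk)

lemma lev_symm (hs : Sys p a R T m F) {k : ℕ} {x y} (h : m ((T ^ k) (x - y)) = 0) :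
    m ((T ^ k) (y - x)) = 0 := by
  have := hs.m_neg h
  rwa [← map_neg, neg_sub] at this

lemma exists_small (hs : Sys p a R T m F) {U : Set (Fin 2 → ℝ)} (hU : U ∈ nhds (0 : Fin 2 → ℝ)) :
    ∃ x ∈ U, ‖m x‖ < 1 := by
  obtain ⟨C, hC, h⟩ := hs.near
  have hcont : Filter.Tendsto (fun n : ℕ => (![Real.sqrt 2 / (n + 1), 0] : Fin 2 → ℝ))
      Filter.atTop (nhds 0) := by
    rw [tendsto_pi_nhds]
    intro i
    fin_cases i
    · simpa [Function.comp_def] using tendsto_const_div_atTop_nhds_zero_nat (Real.sqrt 2) |>.comp (Filter.tendsto_add_atTop_nat 1)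
    · simp
  obtain ⟨n, hn⟩ := (hcont.eventually hU).exists
  refine ⟨_, hn, lt_of_le_of_ne (hs.cfm.norm_le _) fun h1 => ?_⟩
  have hirr : Irrational ((C : ℝ) * (Real.sqrt 2 / (n + 1))) := by
    have h2 : Irrational (((C : ℚ) / (n + 1) : ℚ) * Real.sqrt 2) :=
      irrational_sqrt_two.ratCast_mul (by
        have : (C : ℚ) ≠ 0 := by exact_mod_cast hC
        positivity)
    convert h2 using 1
    push_cast; ring
  set y := (C : ℝ) * (Real.sqrt 2 / (n + 1))
  have hpos : 0 < |y - round y| := abs_pos.2 (sub_ne_zero.2 (hirr.ne_int _))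
  obtain ⟨η, hη, hh⟩ := h _ hpos
  obtain ⟨z, hz⟩ := hh _ (by rw [h1]; exact hη) 0
  have := round_le y z
  simp at hz
  exact absurd hz (not_lt.2 this)

/-- Step A -/
lemma stepA (hs : Sys p a R T m F) {Λ : Set (Fin 2 → ℝ)} (hΛ : Spec F Λ) {k0 : ℕ} (hk0 : 1 ≤ k0) :
    ∃ l ∈ Λ, ∃ l' ∈ Λ, l ≠ l' ∧ m ((T ^ k0) (l - l')) = 0 ∧
      ∀ h, 1 ≤ h → m ((T ^ h) (l - l')) = 0 → h = k0 := by
  classical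
  by_contra hcon
  push Not at hcon
  obtain ⟨k, rfl⟩ : ∃ l, k0 = l + 1 := ⟨k0 - 1, by omega⟩
  set G : (Fin 2 → ℝ) → ℂ := fun ξ => Fk m T k ξ * F ((T ^ (k + 1)) ξ) with hG
  have hGcf : IsCF G := (hs.cfFk k).mul (hs.cfF.comp (T ^ (k + 1)))
  have hFG : ∀ ξ, F ξ = G ξ * m ((T ^ (k + 1)) ξ) := by
    intro ξ
    rw [hs.F_eq (k + 1), Fk_succ, hG]; ring
  have hGo : Orth G Λ := by
    intro l hl l' hl' hne
    obtain ⟨h, hh, hm⟩ := hs.F_zero_iff.1 (hΛ.1 l hl l' hl' hne)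
    have : ∃ h, 1 ≤ h ∧ m ((T ^ h) (l - l')) = 0 ∧ h ≠ k + 1 := by
      by_cases he : h = k + 1
      · subst he
        obtain ⟨h', a1, a2, a3⟩ := hcon l hl l' hl' hne hm
        exact ⟨h', a1, a2, a3⟩
      · exact ⟨h, hh, hm, he⟩
    obtain ⟨h, h1, hm, hne'⟩ := this
    rcases lt_or_gt_of_ne hne' with hlt | hgt
    · simp only [hG, Fk_zero_of h1 (show h ≤ k by omega) hm, zero_mul]
    · have : F ((T ^ (k + 1)) (l - l')) = 0 := by
        apply hs.F_zero_of (k := h - (k + 1)) (by omega)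
        rw [← Module.End.mul_apply, ← pow_add, Nat.sub_add_cancel (by omega)]
        exact hm
      simp only [hG, this, mul_zero]
  obtain ⟨l0, hl0⟩ := hΛ.nonempty
  have hcont : Continuous (fun x => G ((R ^ (k + 1)) x)) :=
    hGcf.continuous.comp (LinearMap.continuous_of_finiteDimensional _)
  have hU : {x | G ((R ^ (k + 1)) x) ≠ 0} ∈ nhds (0 : Fin 2 → ℝ) := by
    have : (fun x => G ((R ^ (k + 1)) x)) 0 ≠ 0 := by simp [hGcf.zero]
    exact hcont.continuousAt.eventually_ne this
  obtain ⟨x, hx, hmx⟩ := hs.exists_small hU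
  set ε := (1 - ‖m x‖ ^ 2) * ‖G ((R ^ (k + 1)) x)‖ ^ 2 with hε
  have hε0 : 0 < ε := by
    have h1 : 0 < ‖G ((R ^ (k + 1)) x)‖ := norm_pos_iff.2 hx
    have : 0 < 1 - ‖m x‖ ^ 2 := by nlinarith [norm_nonneg (m x)]
    positivity
  set ξ := l0 + (R ^ (k + 1)) x with hξ
  obtain ⟨S, hS, hsum⟩ := hΛ.2 ξ ε hε0
  set S' := insert l0 S with hS'
  have hS'Λ : ↑S' ⊆ Λ := by
    rw [hS', Finset.coe_insert]; exact Set.insert_subset hl0 hS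
  have hle : ∑ l ∈ S, ‖F (ξ - l)‖ ^ 2 ≤ ∑ l ∈ S', ‖F (ξ - l)‖ ^ 2 :=
    Finset.sum_le_sum_of_subset_of_nonneg (Finset.subset_insert _ _) (fun _ _ _ => by positivity)
  have hb := hGcf.bessel (hGo.mono hS'Λ) ξ
  have hl0S : l0 ∈ S' := Finset.mem_insert_self _ _
  have h1 : ∑ l ∈ S', ‖F (ξ - l)‖ ^ 2 ≤ ∑ l ∈ S', ‖G (ξ - l)‖ ^ 2 - ε := by
    rw [← Finset.add_sum_erase _ _ hl0S, ← Finset.add_sum_erase _ (fun l => ‖G (ξ - l)‖ ^ 2) hl0S]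
    have e1 : ξ - l0 = (R ^ (k + 1)) x := by rw [hξ]; abel
    have e2 : ∑ l ∈ S'.erase l0, ‖F (ξ - l)‖ ^ 2 ≤ ∑ l ∈ S'.erase l0, ‖G (ξ - l)‖ ^ 2 := by
      refine Finset.sum_le_sum fun l _ => ?_
      have : ‖F (ξ - l)‖ ≤ ‖G (ξ - l)‖ := by
        rw [hFG, norm_mul]
        exact mul_le_of_le_one_right (norm_nonneg _) (hs.cfm.norm_le _)
      gcongr
    rw [e1, hFG, hs.TRk, norm_mul, hε]
    nlinarith
  linarith

end Sys

lemma exists_valuationSubring (p : ℕ) (hp : p.Prime) :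
    ∃ A : ValuationSubring ℝ, ∀ i : ℤ, (A.valuation (i : ℝ) ≤ 1) ∧
      (¬ (p : ℤ) ∣ i → A.valuation (i : ℝ) = 1) ∧ ((p : ℤ) ∣ i → A.valuation (i : ℝ) < 1) := by
  set B : Subring ℝ := (Int.castRingHom ℝ).range with hB
  set P : B := ⟨((p : ℤ) : ℝ), ⟨p, rfl⟩⟩ with hP
  have hI : Ideal.span {P} ≠ ⊤ := by
    rw [Ne, Ideal.span_singleton_eq_top]
    intro hu
    obtain ⟨b, hb⟩ := hu.exists_right_inv
    obtain ⟨k, hk⟩ := b.2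
    have h1 : (P : ℝ) * (b : ℝ) = 1 := by exact_mod_cast congrArg Subtype.val hb
    rw [← hk] at h1
    simp only [hP, eq_intCast] at h1
    have h2 : (p : ℤ) * k = 1 := by exact_mod_cast h1
    have := Int.eq_one_or_neg_one_of_mul_eq_one h2
    have := hp.two_le
    omega
  obtain ⟨A, hA1, hA2⟩ := Ideal.image_subset_nonunits_valuationSubring _ hI
  refine ⟨A, ?_⟩
  have hle : ∀ i : ℤ, A.valuation (i : ℝ) ≤ 1 := by
    intro i
    rw [A.valuation_le_one_iff]
    exact hA1 ⟨i, rfl⟩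
  have hpv : A.valuation ((p : ℤ) : ℝ) < 1 := by
    have : ((p : ℤ) : ℝ) ∈ A.nonunits := hA2 ⟨P, Ideal.mem_span_singleton_self P, rfl⟩
    exact this
  have hdvd : ∀ i : ℤ, (p : ℤ) ∣ i → A.valuation (i : ℝ) < 1 := by
    rintro i ⟨k, rfl⟩
    push_cast
    rw [map_mul]
    exact mul_lt_one_of_lt_of_le (by simpa using hpv) (hle k)
  refine fun i => ⟨hle i, fun hi => ?_, hdvd i⟩
  by_contra hne
  have hlt : A.valuation (i : ℝ) < 1 := lt_of_le_of_ne (hle i) hne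
  have hco : IsCoprime (p : ℤ) i := (Prime.coprime_iff_not_dvd (Nat.prime_iff_prime_int.1 hp)).2 hi
  obtain ⟨s, t, hst⟩ := hco
  have h1 : (s : ℝ) * ((p : ℤ) : ℝ) + t * i = 1 := by exact_mod_cast hst
  have h2 : A.valuation ((s : ℝ) * ((p : ℤ) : ℝ) + t * i) < 1 := by
    refine Valuation.map_add_lt _ ?_ ?_
    · rw [map_mul, mul_comm]; exact mul_lt_one_of_lt_of_le hpv (hle s)
    · rw [map_mul, mul_comm]; exact mul_lt_one_of_lt_of_le hlt (hle t)
  rw [h1, map_one] at h2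
  exact lt_irrefl _ h2

/-- Abstract level structure. -/
structure LevSys (p : ℕ) (x : ℝ) {ι : Type*} (u : ι → ℝ) (L : ℕ → ι → ι → Prop) : Prop where
  prime : p.Prime
  hx : 1 < x
  sym : ∀ k s t, L k s t → L k t s
  ex : ∀ s t, s ≠ t → ∃ k, 1 ≤ k ∧ L k s t
  eq : ∀ k s t, L k s t → ∃ i : ℤ, ¬ (p : ℤ) ∣ i ∧ u s - u t = x ^ k * i
  A : ∀ k, 1 ≤ k → ∃ s t, s ≠ t ∧ L k s t ∧ ∀ h, 1 ≤ h → L h s t → h = k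

namespace LevSys
variable {p : ℕ} {x : ℝ} {ι : Type*} {u : ι → ℝ} {L : ℕ → ι → ι → Prop}

lemma infinite (H : LevSys p x u L) : Infinite ι := by
  by_contra hfin
  rw [not_infinite_iff_finite] at hfin
  obtain ⟨s1, -⟩ := H.A 1 le_rfl
  have : Nonempty ι := ⟨s1⟩
  choose! f g hne hL hu using H.A
  have : Function.Injective (fun k : ℕ => (f (k + 1), g (k + 1))) := by
    intro k l hkl
    simp only [Prod.mk.injEq] at hkl
    have := hu (k + 1) (by omega) (l + 1) (by omega) (by rw [hkl.1, hkl.2]; exact hL (l + 1) (by omega))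
    omega
  exact not_injective_infinite_finite _ this

lemma no_const (H : LevSys p x u L)
    (h : ∀ s t t' k l, s ≠ t → s ≠ t' → t ≠ t' → L k s t → L l s t' → k = l) : False := by
  obtain ⟨s, t, hst, hL, hu⟩ := H.A 1 le_rfl
  obtain ⟨s', t', hst', hL', hu'⟩ := H.A 2 (by norm_num)
  have key : ∀ q r, q ≠ r → ∀ k, 1 ≤ k → L k q r → k = 1 := by
    have k1 : ∀ r, r ≠ s → r ≠ t → ∀ k, L k s r → k = 1 := fun r h1 h2 k hk =>
      (h s t r 1 k hst h1.symm h2.symm hL hk).symm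
    have k1' : ∀ r, r ≠ s → ∀ k, 1 ≤ k → L k s r → k = 1 := by
      intro r h1 k hk1 hk
      by_cases h2 : r = t
      · subst h2; exact hu k hk1 hk
      · exact k1 r h1 h2 k hk
    intro q r hqr k hk1 hk
    by_cases hq : q = s
    · subst hq; exact k1' r hqr.symm k hk1 hk
    by_cases hr : r = s
    · subst hr; exact k1' q hqr k hk1 (H.sym _ _ _ hk)
    obtain ⟨l, hl1, hl⟩ := H.ex s q (Ne.symm hq)
    have := k1' q hq l hl1 hl
    subst this
    exact (h q s r 1 k hq hqr (Ne.symm hr) (H.sym _ _ _ hl) hk).symm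
  have := key s' t' hst' 2 (by norm_num) hL'
  omega

lemma unit_case (H : LevSys p x u L) (A : ValuationSubring ℝ)
    (hA : ∀ i : ℤ, (A.valuation (i : ℝ) ≤ 1) ∧
      (¬ (p : ℤ) ∣ i → A.valuation (i : ℝ) = 1) ∧ ((p : ℤ) ∣ i → A.valuation (i : ℝ) < 1))
    (hv : A.valuation x = 1) : False := by
  have := Fact.mk H.prime
  have hinf := H.infinite
  obtain ⟨s0⟩ := hinf.nonempty
  have hxA : x ∈ A := by rw [← A.valuation_le_one_iff, hv]
  set κ := IsLocalRing.ResidueField A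
  let π : A →+* κ := IsLocalRing.residue A
  have hπ0 : ∀ y : A, π y = 0 ↔ A.valuation (y : ℝ) < 1 := by
    intro y
    rw [← A.valuation_lt_one_iff]
    exact IsLocalRing.residue_eq_zero_iff y
  have hπi : ∀ i : ℤ, (i : κ) = 0 ↔ (p : ℤ) ∣ i := by
    intro i
    have : (i : κ) = π (i : A) := by simp
    rw [this, hπ0]
    constructor
    · intro h
      by_contra hn
      have := (hA i).2.1 hn
      have h' : A.valuation (i : ℝ) < 1 := by simpa using h
      rw [this] at h'
      exact lt_irrefl _ h'
    · intro h
      have := (hA i).2.2 h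
      simpa using this
  have : CharP κ p := by
    constructor
    intro n
    have := hπi n
    rw [Int.cast_natCast, Int.natCast_dvd_natCast] at this
    exact this
  let : Algebra (ZMod p) κ := ZMod.algebra κ p
  set X : κ := π ⟨x, hxA⟩
  have hX : X ≠ 0 := by
    intro h
    have := (hπ0 _).1 h
    simp only [hv] at this
    exact lt_irrefl _ this
  have hintg : ∀ i : ℤ, algebraMap (ZMod p) κ (i : ZMod p) = (i : κ) := fun i => by simp
  have hmem : ∀ s, u s - u s0 ∈ A := by
    intro s
    by_cases h : s = s0
    · subst h; simp
    · obtain ⟨k, _, hk⟩ := H.ex s s0 h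
      obtain ⟨i, _, hi⟩ := H.eq _ _ _ hk
      rw [hi]
      exact A.mul_mem _ _ (pow_mem hxA k) (by rw [← A.valuation_le_one_iff]; exact (hA i).1)
  let r : ι → κ := fun s => π ⟨u s - u s0, hmem s⟩
  have hr : ∀ k s t, L k s t → ∃ i : ℤ, ¬ (p : ℤ) ∣ i ∧ r s - r t = X ^ k * i := by
    intro k s t hk
    obtain ⟨i, hi, he⟩ := H.eq _ _ _ hk
    refine ⟨i, hi, ?_⟩
    simp only [r, X]
    rw [← map_sub, ← map_pow, ← map_intCast π, ← map_mul]
    congr 1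
    apply Subtype.ext
    push_cast
    linarith
  have hr0 : r s0 = 0 := by
    simp only [r]
    rw [hπ0]; simp
  have hinj : Function.Injective r := by
    intro s t hst
    by_contra hne
    obtain ⟨k, _, hk⟩ := H.ex s t hne
    obtain ⟨i, hi, he⟩ := hr _ _ _ hk
    rw [hst, sub_self] at he
    rcases mul_eq_zero.1 he.symm with h | h
    · exact hX (eq_zero_of_pow_eq_zero h)
    · exact hi ((hπi i).1 h)
  by_cases halg : IsIntegral (ZMod p) X
  · have hfg := halg.fg_adjoin_singleton
    have : Module.Finite (ZMod p) (Algebra.adjoin (ZMod p) {X}) := Module.Finite.of_fg hfg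
    have : Finite (Algebra.adjoin (ZMod p) {X}) := Module.finite_of_finite (ZMod p)
    have hm : ∀ s, r s ∈ Algebra.adjoin (ZMod p) {X} := by
      intro s
      by_cases h : s = s0
      · subst h; rw [hr0]; exact zero_mem _
      · obtain ⟨k, _, hk⟩ := H.ex s s0 h
        obtain ⟨i, _, hi⟩ := hr _ _ _ hk
        rw [hr0, sub_zero] at hi
        rw [hi]
        exact mul_mem (pow_mem (Algebra.self_mem_adjoin_singleton _ _) k) (intCast_mem _ i)
    have : Function.Injective (fun s => (⟨r s, hm s⟩ : Algebra.adjoin (ZMod p) {X})) := by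
      intro s t hst
      exact hinj (congrArg Subtype.val hst)
    exact not_injective_infinite_finite _ this
  · have htr : ∀ f : Polynomial (ZMod p), Polynomial.aeval X f = 0 → f = 0 := by
      intro f hf
      by_contra hne
      exact halg (isAlgebraic_iff_isIntegral.1 ⟨f, hne, hf⟩)
    apply H.no_const
    intro s t t' k l h1 h2 h3 hk hl
    obtain ⟨g, _, hg⟩ := H.ex t t' h3
    obtain ⟨i, hi, ei⟩ := hr _ _ _ hk
    obtain ⟨i', hi', ei'⟩ := hr _ _ _ hl
    obtain ⟨j, hj, ej⟩ := hr _ _ _ hg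
    have hf := htr (Polynomial.monomial k (i : ZMod p) + Polynomial.monomial g (j : ZMod p)
      - Polynomial.monomial l (i' : ZMod p)) (by
        simp only [map_add, map_sub, Polynomial.aeval_monomial, hintg]
        linear_combination -ei - ej + ei')
    have hz : ∀ i : ℤ, (i : ZMod p) = 0 ↔ (p : ℤ) ∣ i := fun i => ZMod.intCast_zmod_eq_zero_iff_dvd i p
    by_contra hkl
    have c1 := congrArg (fun f => Polynomial.coeff f k) hf
    have c2 := congrArg (fun f => Polynomial.coeff f l) hf
    simp only [Polynomial.coeff_add, Polynomial.coeff_sub, Polynomial.coeff_monomial,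
      Polynomial.coeff_zero, if_true, if_neg hkl, if_neg (Ne.symm hkl)] at c1 c2
    by_cases hgk : g = k
    · subst hgk
      rw [if_neg hkl] at c2
      simp at c2
      exact hi' ((hz _).1 c2)
    · rw [if_neg hgk] at c1
      simp at c1
      exact hi ((hz _).1 c1)

lemma big_case (H : LevSys p x u L) (A : ValuationSubring ℝ)
    (hA : ∀ i : ℤ, (A.valuation (i : ℝ) ≤ 1) ∧
      (¬ (p : ℤ) ∣ i → A.valuation (i : ℝ) = 1) ∧ ((p : ℤ) ∣ i → A.valuation (i : ℝ) < 1))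
    (hv : 1 < A.valuation x) : False := by
  have hval : ∀ k s t, L k s t → A.valuation (u s - u t) = A.valuation x ^ k := by
    intro k s t hk
    obtain ⟨i, hi, e⟩ := H.eq _ _ _ hk
    rw [e, map_mul, map_pow, (hA i).2.1 hi, mul_one]
  -- triangle
  have tri : ∀ s t r k l g, L k s t → L l t r → L g s r → g ≤ max k l := by
    intro s t r k l g hk hl hg
    have h1 := Valuation.map_add A.valuation (u s - u t) (u t - u r)
    rw [show u s - u t + (u t - u r) = u s - u r by ring, hval _ _ _ hk, hval _ _ _ hl,
      hval _ _ _ hg] at h1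
    by_contra hlt
    push Not at hlt
    have h2 : A.valuation x ^ k < A.valuation x ^ g := pow_lt_pow_right₀ hv (by omega)
    have h3 : A.valuation x ^ l < A.valuation x ^ g := pow_lt_pow_right₀ hv (by omega)
    exact absurd h1 (not_le.2 (max_lt h2 h3))
  obtain ⟨s0, t0, hst0, hL0, _⟩ := H.A 1 le_rfl
  obtain ⟨i0, hi0, e0⟩ := H.eq _ _ _ hL0
  obtain ⟨n, hn⟩ := pow_unbounded_of_one_lt (|(i0 : ℝ)|) H.hx
  have hfar : ∃ r k, n + 2 ≤ k ∧ r ≠ s0 ∧ L k s0 r := by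
    obtain ⟨s, t, hst, hL, -⟩ := H.A (n + 2) (by omega)
    by_cases h1 : s = s0
    · subst h1; exact ⟨t, n + 2, le_rfl, hst.symm, hL⟩
    by_cases h2 : t = s0
    · subst h2; exact ⟨s, n + 2, le_rfl, hst, H.sym _ _ _ hL⟩
    obtain ⟨k, _, hk⟩ := H.ex s0 s (Ne.symm h1)
    obtain ⟨l, _, hl⟩ := H.ex s0 t (Ne.symm h2)
    have := tri s s0 t k l (n + 2) (H.sym _ _ _ hk) hl hL
    rcases le_max_iff.1 this with h | h
    · exact ⟨s, k, h, h1, hk⟩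
    · exact ⟨t, l, h, h2, hl⟩
  obtain ⟨r, k, hk, hr, hLr⟩ := hfar
  have hrt : r ≠ t0 := by
    rintro rfl
    have := hval _ _ _ hLr
    rw [hval _ _ _ hL0] at this
    have h2 : A.valuation x ^ 1 < A.valuation x ^ k := pow_lt_pow_right₀ hv (by omega)
    rw [this] at h2
    exact lt_irrefl _ h2
  obtain ⟨l, _, hl⟩ := H.ex t0 r hrt.symm
  have a1 := tri s0 t0 r 1 l k hL0 hl hLr
  have a2 := tri t0 s0 r 1 k l (H.sym _ _ _ hL0) hLr hl
  have hlk : l = k := by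
    rcases le_max_iff.1 a1 with h | h <;> rcases le_max_iff.1 a2 with h' | h' <;> omega
  subst hlk
  obtain ⟨i, _, ei⟩ := H.eq _ _ _ hLr
  obtain ⟨j, _, ej⟩ := H.eq _ _ _ hl
  have hx0 : 0 < x := by linarith [H.hx]
  have h3 : (i0 : ℝ) = x ^ (l - 1) * ((i - j : ℤ) : ℝ) := by
    have : x * i0 = x * (x ^ (l - 1) * ((i - j : ℤ) : ℝ)) := by
      rw [← mul_assoc, ← pow_succ', Nat.sub_add_cancel (by omega)]
      push_cast
      rw [pow_one] at e0
      linear_combination -e0 + ei - ej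
    exact mul_left_cancel₀ hx0.ne' this
  have hij : i - j ≠ 0 := by
    intro h
    rw [h] at h3
    simp at h3
    exact hi0 (by simp [h3])
  have h4 : (1 : ℝ) ≤ |((i - j : ℤ) : ℝ)| := by exact_mod_cast Int.one_le_abs hij
  have h5 : x ^ n ≤ x ^ (l - 1) := pow_le_pow_right₀ H.hx.le (by omega)
  have h6 : |(i0 : ℝ)| = x ^ (l - 1) * |((i - j : ℤ) : ℝ)| := by
    rw [h3, abs_mul, abs_of_pos (by positivity)]
  have h7 : 0 < x ^ (l - 1) := by positivity
  nlinarith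

lemma small_case (H : LevSys p x u L) (A : ValuationSubring ℝ)
    (hA : ∀ i : ℤ, (A.valuation (i : ℝ) ≤ 1) ∧
      (¬ (p : ℤ) ∣ i → A.valuation (i : ℝ) = 1) ∧ ((p : ℤ) ∣ i → A.valuation (i : ℝ) < 1))
    (hv : A.valuation x < 1) : ∃ q : ℚ, x = q ∧ (p : ℤ) ∣ q.num := by
  have hx0 : 0 < x := by linarith [H.hx]
  have hval : ∀ k s t, L k s t → A.valuation (u s - u t) = A.valuation x ^ k := by
    intro k s t hk
    obtain ⟨i, hi, e⟩ := H.eq _ _ _ hk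
    rw [e, map_mul, map_pow, (hA i).2.1 hi, mul_one]
  have hvpos : 0 < A.valuation x := (Valuation.pos_iff _).2 hx0.ne'
  have tri : ∀ s t r k l g, L k s t → L l t r → L g s r → min k l ≤ g := by
    intro s t r k l g hk hl hg
    have h1 := Valuation.map_add A.valuation (u s - u t) (u t - u r)
    rw [show u s - u t + (u t - u r) = u s - u r by ring, hval _ _ _ hk, hval _ _ _ hl,
      hval _ _ _ hg] at h1
    by_contra hlt
    push Not at hlt
    have h2 : A.valuation x ^ k < A.valuation x ^ g := pow_lt_pow_right_of_lt_one₀ hvpos hv (by omega)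
    have h3 : A.valuation x ^ l < A.valuation x ^ g := pow_lt_pow_right_of_lt_one₀ hvpos hv (by omega)
    exact absurd h1 (not_le.2 (max_lt h2 h3))
  obtain ⟨s0, t0, hst0, hL0, _⟩ := H.A 1 le_rfl
  obtain ⟨i0, hi0, e0⟩ := H.eq _ _ _ hL0
  have hnz : ∀ i : ℤ, ¬ (p : ℤ) ∣ i → (i : ℝ) ≠ 0 := by
    intro i hi h
    apply hi
    have : i = 0 := by exact_mod_cast h
    simp [this]
  -- rationality in terms of x
  have claim : ∀ r, ∃ q : ℚ, u s0 - u r = q * x := by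
    intro r
    by_cases h1 : r = s0
    · subst h1; exact ⟨0, by simp⟩
    by_cases h2 : r = t0
    · subst h2; exact ⟨i0, by rw [e0]; push_cast; ring⟩
    obtain ⟨k, hk1, hk⟩ := H.ex s0 r (Ne.symm h1)
    obtain ⟨l, hl1, hl⟩ := H.ex t0 r (Ne.symm h2)
    obtain ⟨i, hi, ei⟩ := H.eq _ _ _ hk
    obtain ⟨j, hj, ej⟩ := H.eq _ _ _ hl
    rw [pow_one] at e0
    have a1 := tri s0 r t0 k l 1 hk (H.sym _ _ _ hl) hL0
    rcases min_le_iff.1 a1 with h | h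
    · have : k = 1 := by omega
      subst this
      exact ⟨i, by rw [ei]; push_cast; ring⟩
    · have : l = 1 := by omega
      subst this
      refine ⟨i0 + j, ?_⟩
      push_cast
      linear_combination e0 + ej
  obtain ⟨s, t, hst, hL, -⟩ := H.A 2 (by norm_num)
  obtain ⟨i, hi, ei⟩ := H.eq _ _ _ hL
  obtain ⟨q1, h1⟩ := claim s
  obtain ⟨q2, h2⟩ := claim t
  have hxq : x = (((q2 - q1) / i : ℚ) : ℝ) := by
    have : x * (x * i) = x * (q2 - q1) := by linear_combination h2 - h1 - ei
    have h3 := mul_left_cancel₀ hx0.ne' this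
    have := hnz i hi
    push_cast
    rw [eq_div_iff this, h3]
  set q := (q2 - q1) / (i : ℚ)
  refine ⟨q, hxq, ?_⟩
  by_contra hnd
  have h3 := (hA q.num).2.1 hnd
  have h4 : (q.num : ℝ) = x * ((q.den : ℤ) : ℝ) := by
    rw [hxq]
    have := Rat.mul_den_eq_num q
    exact_mod_cast this.symm
  rw [h4, map_mul] at h3
  have := mul_lt_one_of_lt_of_le hv (hA q.den).1
  rw [h3] at this
  exact lt_irrefl _ this

theorem main (H : LevSys p x u L) : ∃ q : ℚ, x = q ∧ (p : ℤ) ∣ q.num := by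
  obtain ⟨A, hA⟩ := exists_valuationSubring p H.prime
  rcases lt_trichotomy (A.valuation x) 1 with h | h | h
  · exact H.small_case A hA h
  · exact (H.unit_case A hA h).elim
  · exact (H.big_case A hA h).elim

end LevSys

/-- integer functional -/
def lf (l : Fin 2 → ℤ) (ξ : Fin 2 → ℝ) : ℝ := l 0 * ξ 0 + l 1 * ξ 1

lemma lf_sub (l : Fin 2 → ℤ) (x y : Fin 2 → ℝ) : lf l (x - y) = lf l x - lf l y := by
  simp [lf]; ring
lemma lf_add (l : Fin 2 → ℤ) (x y : Fin 2 → ℝ) : lf l (x + y) = lf l x + lf l y := by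
  simp [lf]; ring
lemma lf_smul (l : Fin 2 → ℤ) (r : ℝ) (y : Fin 2 → ℝ) : lf l (r • y) = r * lf l y := by
  simp [lf]; ring
lemma lf_int (l : Fin 2 → ℤ) {x : Fin 2 → ℝ} (h : x ∈ intLat) : ∃ z : ℤ, lf l x = z := by
  obtain ⟨k, hk⟩ := h
  exact ⟨l 0 * k 0 + l 1 * k 1, by simp [lf, hk]⟩

/-- eigenfunctional -/
structure Eig (p : ℕ) (a : Fin 2 → ℤ) (R T : Module.End ℝ (Fin 2 → ℝ)) (l : Fin 2 → ℤ) (x : ℝ) : Prop where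
  hx : 1 < x
  eig : ∀ ξ, lf l (R ξ) = x * lf l ξ
  nd : ¬ (p : ℤ) ∣ (l 0 * a 0 + l 1 * a 1)

namespace Sys
variable {p : ℕ} {a : Fin 2 → ℤ} {R T : Module.End ℝ (Fin 2 → ℝ)} {m F : (Fin 2 → ℝ) → ℂ}
  {l : Fin 2 → ℤ} {x : ℝ}

lemma eig_pow (he : Eig p a R T l x) (k : ℕ) (ξ) : lf l ((R ^ k) ξ) = x ^ k * lf l ξ := by
  induction k with
  | zero => simp
  | succ k ih => rw [pow_succ', Module.End.mul_apply, he.eig, ih]; ring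

lemma eig_Tpow (hs : Sys p a R T m F) (he : Eig p a R T l x) (k : ℕ) (ξ) :
    lf l ξ = x ^ k * lf l ((T ^ k) ξ) := by
  rw [← eig_pow he k, hs.RTk]

lemma lev_lf (hs : Sys p a R T m F) (he : Eig p a R T l x) {k : ℕ} {δ} (h : m ((T ^ k) δ) = 0) :
    ∃ i : ℤ, ¬ (p : ℤ) ∣ i ∧ p * lf l δ = x ^ k * i := by
  have hp0 : (p : ℝ) ≠ 0 := by exact_mod_cast hs.prime.ne_zero
  obtain ⟨j, hj, hz⟩ := (hs.zero _).1 h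
  obtain ⟨z, hz⟩ := lf_int l hz
  rw [lf_sub, lf_smul] at hz
  refine ⟨j * (l 0 * a 0 + l 1 * a 1) + p * z, ?_, ?_⟩
  · intro hd
    have := (Int.dvd_add_left (dvd_mul_right _ _)).1 hd
    rcases (Nat.prime_iff_prime_int.1 hs.prime).dvd_or_dvd this with h | h
    · exact hj h
    · exact he.nd h
  · rw [hs.eig_Tpow he k δ]
    have h1 : lf l (aR a) = l 0 * a 0 + l 1 * a 1 := by simp [lf, aR]
    rw [h1] at hz
    have h2 : lf l ((T ^ k) δ) = j / p * (l 0 * a 0 + l 1 * a 1) + z := by linarith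
    rw [h2]
    push_cast
    field_simp

theorem N1 (hs : Sys p a R T m F) (he : Eig p a R T l x) {Λ} (hΛ : Spec F Λ) :
    ∃ q : ℚ, x = q ∧ (p : ℤ) ∣ q.num := by
  refine LevSys.main (p := p) (ι := Λ) (u := fun s => p * lf l s)
    (L := fun k s t => m ((T ^ k) ((s : Fin 2 → ℝ) - t)) = 0)
    ⟨hs.prime, he.hx, fun k s t h => hs.lev_symm h, ?_, ?_, ?_⟩
  · intro s t hst
    exact hs.F_zero_iff.1 (hΛ.1 s s.2 t t.2 (fun h => hst (Subtype.ext h)))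
  · intro k s t h
    obtain ⟨i, hi, e⟩ := hs.lev_lf he h
    refine ⟨i, hi, ?_⟩
    rw [← e, lf_sub]; ring
  · intro k hk
    obtain ⟨s, hs1, t, ht1, hne, h1, h2⟩ := hs.stepA hΛ hk
    exact ⟨⟨s, hs1⟩, ⟨t, ht1⟩, fun h => hne (congrArg Subtype.val h), h1, h2⟩

end Sys

namespace Sys
variable {p : ℕ} {a : Fin 2 → ℤ} {R T : Module.End ℝ (Fin 2 → ℝ)} {m F : (Fin 2 → ℝ) → ℂ}
  {l : Fin 2 → ℤ} {q : ℚ}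

lemma pow_num_den {q : ℚ} {k : ℕ} {b c : ℤ} (h : (b : ℝ) = (q : ℝ) ^ k * c) :
    b * (q.den : ℤ) ^ k = q.num ^ k * c := by
  have h1 : (q : ℝ) * (q.den : ℝ) = q.num := by exact_mod_cast Rat.mul_den_eq_num q
  have : (b : ℝ) * (q.den : ℝ) ^ k = (q.num : ℝ) ^ k * c := by
    rw [h, ← h1, mul_pow]; ring
  exact_mod_cast this

lemma not_dvd_den (hp : p.Prime) (hq : (p : ℤ) ∣ q.num) : ¬ (p : ℤ) ∣ (q.den : ℤ) := by
  intro h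
  have h1 : (p : ℕ) ∣ q.num.natAbs := Int.natCast_dvd.1 hq
  have h2 : p ∣ q.den := Int.natCast_dvd_natCast.1 h
  have := Nat.dvd_gcd h1 h2
  rw [q.reduced.gcd_eq_one] at this
  exact hp.one_lt.ne' (Nat.dvd_one.1 this)

lemma lev_lt_absurd (hp : p.Prime) (hq : (p : ℤ) ∣ q.num) (hq0 : (q : ℝ) ≠ 0) {k h : ℕ} (hkh : k < h) {i j : ℤ}
    (hi : ¬ (p : ℤ) ∣ i) (e : (q : ℝ) ^ k * i = (q : ℝ) ^ h * j) : False := by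
  have h1 : (i : ℝ) = (q : ℝ) ^ (h - k) * j := by
    have : (q : ℝ) ^ k * i = (q : ℝ) ^ k * ((q : ℝ) ^ (h - k) * j) := by
      rw [e, ← mul_assoc, ← pow_add]; congr 2; omega
    exact mul_left_cancel₀ (pow_ne_zero _ hq0) this
  have h2 := pow_num_den h1
  have h3 : (p : ℤ) ∣ i * (q.den : ℤ) ^ (h - k) := by
    rw [h2]
    exact Dvd.dvd.mul_right (dvd_pow hq (by omega)) _
  have hpp := Nat.prime_iff_prime_int.1 hp
  rcases hpp.dvd_or_dvd h3 with h4 | h4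
  · exact hi h4
  · exact not_dvd_den hp hq (hpp.dvd_of_dvd_pow h4)

lemma lev_unique (hs : Sys p a R T m F) (he : Eig p a R T l q) (hq : (p : ℤ) ∣ q.num)
    {k h : ℕ} {δ} (h1 : m ((T ^ k) δ) = 0) (h2 : m ((T ^ h) δ) = 0) : k = h := by
  have hq0 : (q : ℝ) ≠ 0 := by linarith [he.hx]
  obtain ⟨i, hi, e⟩ := hs.lev_lf he h1
  obtain ⟨j, hj, e'⟩ := hs.lev_lf he h2
  rw [e] at e'
  rcases lt_trichotomy k h with h | h | h
  · exact (lev_lt_absurd hs.prime hq hq0 h hi e').elim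
  · exact h
  · exact (lev_lt_absurd hs.prime hq hq0 h hj e'.symm).elim

/-- min level is attained twice -/
lemma lev_tri (hs : Sys p a R T m F) (he : Eig p a R T l q) (hq : (p : ℤ) ∣ q.num)
    {k h g : ℕ} {δ δ'} (h1 : m ((T ^ k) δ) = 0) (h2 : m ((T ^ h) δ') = 0)
    (h3 : m ((T ^ g) (δ + δ')) = 0) : min k h ≤ g := by
  by_contra hlt
  push Not at hlt
  have hq0 : (q : ℝ) ≠ 0 := by linarith [he.hx]
  obtain ⟨i, hi, e⟩ := hs.lev_lf he h1
  obtain ⟨j, hj, e'⟩ := hs.lev_lf he h2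
  obtain ⟨n, hn, e''⟩ := hs.lev_lf he h3
  have hgk : g < k := lt_of_lt_of_le hlt (min_le_left _ _)
  have hgh : g < h := lt_of_lt_of_le hlt (min_le_right _ _)
  obtain ⟨k', rfl⟩ := Nat.exists_eq_add_of_lt hgk
  obtain ⟨h', rfl⟩ := Nat.exists_eq_add_of_lt hgh
  -- n = q^(k'+1) i + q^(h'+1) j ; multiply by powers of den
  have h4 : (n : ℝ) = (q : ℝ) ^ (k' + 1) * i + (q : ℝ) ^ (h' + 1) * j := by
    have : (q : ℝ) ^ g * n = (q : ℝ) ^ g * ((q : ℝ) ^ (k' + 1) * i + (q : ℝ) ^ (h' + 1) * j) := by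
      rw [← e'', lf_add, mul_add, e, e']; ring
    exact mul_left_cancel₀ (pow_ne_zero _ hq0) this
  have hd : (q : ℝ) * (q.den : ℝ) = q.num := by exact_mod_cast Rat.mul_den_eq_num q
  have h5 : n * (q.den : ℤ) ^ (k' + 1 + (h' + 1))
      = q.num ^ (k' + 1) * i * (q.den : ℤ) ^ (h' + 1) + q.num ^ (h' + 1) * j * (q.den : ℤ) ^ (k' + 1) := by
    have : (n : ℝ) * (q.den : ℝ) ^ (k' + 1 + (h' + 1))
      = (q.num : ℝ) ^ (k' + 1) * i * (q.den : ℝ) ^ (h' + 1)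
        + (q.num : ℝ) ^ (h' + 1) * j * (q.den : ℝ) ^ (k' + 1) := by
      rw [h4, ← hd, mul_pow, mul_pow]; ring
    exact_mod_cast this
  have h6 : (p : ℤ) ∣ n * (q.den : ℤ) ^ (k' + 1 + (h' + 1)) := by
    rw [h5]
    refine dvd_add ?_ ?_
    · exact Dvd.dvd.mul_right (Dvd.dvd.mul_right (dvd_pow hq (by omega)) _) _
    · exact Dvd.dvd.mul_right (Dvd.dvd.mul_right (dvd_pow hq (by omega)) _) _
  have hpp := Nat.prime_iff_prime_int.1 hs.prime
  rcases hpp.dvd_or_dvd h6 with h4 | h4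
  · exact hn h4
  · exact not_dvd_den hs.prime hq (hpp.dvd_of_dvd_pow h4)

lemma exists_lev1 (hs : Sys p a R T m F) (he : Eig p a R T l q) (hq : (p : ℤ) ∣ q.num)
    {Λ} (hΛ : Spec F Λ) (h0 : 0 ∈ Λ) : ∃ γ ∈ Λ, γ ≠ 0 ∧ m (T γ) = 0 := by
  obtain ⟨s, hs1, t, ht1, hne, h1, -⟩ := hs.stepA hΛ le_rfl
  by_cases e1 : s = 0
  · subst e1
    exact ⟨t, ht1, hne.symm, by simpa using hs.lev_symm h1⟩
  by_cases e2 : t = 0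
  · subst e2
    exact ⟨s, hs1, hne, by simpa using h1⟩
  obtain ⟨k, hk, hk'⟩ := hs.F_zero_iff.1 (hΛ.1 s hs1 0 h0 e1)
  obtain ⟨h, hh, hh'⟩ := hs.F_zero_iff.1 (hΛ.1 0 h0 t ht1 (Ne.symm e2))
  have := hs.lev_tri he hq hk' hh' (g := 1)
    (by have e : s - 0 + (0 - t) = s - t := by abel
        rw [e]; exact h1)
  rcases min_le_iff.1 this with h3 | h3
  · have : k = 1 := by omega
    subst this
    exact ⟨s, hs1, e1, by simpa using hk'⟩
  · have : h = 1 := by omega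
    subst this
    refine ⟨t, ht1, e2, ?_⟩
    have := hs.lev_symm hh'
    simpa using this

lemma tree0 (hs : Sys p a R T m F) (he : Eig p a R T l q) (hq : (p : ℤ) ∣ q.num)
    {Λ} (hΛ : Spec F Λ) (h0 : 0 ∈ Λ) {δ} (hδ : δ ∈ Λ) {k : ℕ} (hk : 2 ≤ k)
    (hL : m ((T ^ k) δ) = 0) : T δ ∈ intLat := by
  obtain ⟨γ, hγ, hγ0, h1⟩ := hs.exists_lev1 he hq hΛ h0
  have hne : γ ≠ δ := by
    rintro rfl
    have := hs.lev_unique he hq hL (h := 1) (by simpa using h1)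
    omega
  obtain ⟨g, hg, hg'⟩ := hs.F_zero_iff.1 (hΛ.1 γ hγ δ hδ hne)
  have := hs.lev_tri he hq hg' hL (g := 1) (by simpa using h1)
  have hg1 : g = 1 := by
    rcases min_le_iff.1 this with h | h <;> omega
  subst hg1
  obtain ⟨j, hj, hz⟩ := (hs.zero _).1 h1
  obtain ⟨j', hj', hz'⟩ := (hs.zero _).1 hg'
  have h3 : T δ - (((j - j' : ℤ) : ℝ) / p) • aR a ∈ intLat := by
    have := intLat.sub_mem hz hz'
    convert this using 1
    rw [pow_one, map_sub]
    push_cast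
    module
  by_cases hd : (p : ℤ) ∣ j - j'
  · obtain ⟨w, hw⟩ := hd
    have h4 : (((j - j' : ℤ) : ℝ) / p) • aR a ∈ intLat := by
      refine ⟨fun i => w * a i, fun i => ?_⟩
      have hp0 : (p : ℝ) ≠ 0 := by exact_mod_cast hs.prime.ne_zero
      rw [hw]; simp only [Pi.smul_apply, smul_eq_mul, aR]; push_cast; field_simp
    have := intLat.add_mem h3 h4
    simpa using this
  · have h5 : m (T δ) = 0 := (hs.zero _).2 ⟨_, hd, h3⟩
    have := hs.lev_unique he hq hL (h := 1) (by simpa using h5)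
    omega

lemma class_ex (hs : Sys p a R T m F) (he : Eig p a R T l q) (hq : (p : ℤ) ∣ q.num)
    {Λ} (hΛ : Spec F Λ) (h0 : 0 ∈ Λ) {δ} (hδ : δ ∈ Λ) :
    ∃ j : ℕ, j < p ∧ T δ - ((j : ℝ) / p) • aR a ∈ intLat := by
  have hp0 : (p : ℝ) ≠ 0 := by exact_mod_cast hs.prime.ne_zero
  have h : ∃ j : ℤ, T δ - ((j : ℝ) / p) • aR a ∈ intLat := by
    by_cases hd : δ = 0
    · subst hd; exact ⟨0, by simp [intLat.zero_mem]⟩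
    obtain ⟨k, hk, hk'⟩ := hs.F_zero_iff.1 (hΛ.1 δ hδ 0 h0 hd)
    rw [sub_zero] at hk'
    rcases Nat.lt_or_ge k 2 with h | h
    · have : k = 1 := by omega
      subst this
      obtain ⟨j, _, hz⟩ := (hs.zero _).1 hk'
      exact ⟨j, by simpa using hz⟩
    · exact ⟨0, by simpa using hs.tree0 he hq hΛ h0 hδ h hk'⟩
  obtain ⟨j, hj⟩ := h
  have hmod : 0 ≤ j % p := Int.emod_nonneg _ (by exact_mod_cast hs.prime.ne_zero)
  have hmod2 : j % p < p := Int.emod_lt_of_pos _ (by exact_mod_cast hs.prime.pos)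
  refine ⟨(j % p).toNat, by omega, ?_⟩
  have h2 : (((j % p).toNat : ℕ) : ℝ) = ((j % p : ℤ) : ℝ) := by
    have : (((j % p).toNat : ℕ) : ℤ) = j % p := Int.toNat_of_nonneg hmod
    exact_mod_cast this
  have h3 : (j : ℝ) = (p : ℝ) * ((j / p : ℤ) : ℝ) + ((j % p : ℤ) : ℝ) := by
    exact_mod_cast (Int.mul_ediv_add_emod j p).symm
  rw [h2]
  have h4 : (((j / p : ℤ) : ℝ)) • aR a ∈ intLat := ⟨fun i => (j / p) * a i, fun i => by simp [aR]⟩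
  have := intLat.add_mem hj h4
  convert this using 1
  have h5 : (j : ℝ) / p = ((j / p : ℤ) : ℝ) + ((j % p : ℤ) : ℝ) / p := by
    rw [h3]; field_simp
  rw [h5]
  module

lemma m_zero_countable (hs : Sys p a R T m F) : {ξ | m ξ = 0}.Countable := by
  have : {ξ | m ξ = 0} ⊆ Set.range (fun q : ℤ × (Fin 2 → ℤ) => ((q.1 : ℝ) / p) • aR a + aR q.2) := by
    intro ξ hξ
    obtain ⟨j, _, k, hk⟩ := (hs.zero ξ).1 hξ
    refine ⟨(j, k), ?_⟩
    ext i
    have := hk i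
    simp only [Pi.sub_apply, Pi.add_apply] at this ⊢
    simp only [aR] at this ⊢
    linarith
  exact (Set.countable_range _).mono this

lemma m_dense (hs : Sys p a R T m F) : Dense {ξ | m ξ ≠ 0} :=
  hs.m_zero_countable.dense_compl ℝ

lemma m_bessel (hs : Sys p a R T m F) (y : Fin 2 → ℝ) :
    ∑ j ∈ Finset.range p, ‖m (y - ((j : ℝ) / p) • aR a)‖ ^ 2 ≤ 1 := by
  classical
  have hp0 : (p : ℝ) ≠ 0 := by exact_mod_cast hs.prime.ne_zero
  have hz : ∀ i j : ℕ, i < p → j < p → i ≠ j → m (((i : ℝ) / p) • aR a - ((j : ℝ) / p) • aR a) = 0 := by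
    intro i j hi hj hij
    rw [hs.zero]
    refine ⟨(i : ℤ) - j, ?_, ?_⟩
    · intro hd
      have := Int.eq_zero_of_abs_lt_dvd hd (by rw [abs_lt]; omega)
      omega
    · have : ((i : ℝ) / p) • aR a - ((j : ℝ) / p) • aR a - ((((i : ℤ) - j : ℤ) : ℝ) / p) • aR a = 0 := by
        push_cast; module
      rw [this]; exact intLat.zero_mem
  have hinj : Set.InjOn (fun j : ℕ => ((j : ℝ) / p) • aR a) (Finset.range p) := by
    intro i hi j hj hij
    by_contra hne
    have := hz i j (by simpa using hi) (by simpa using hj) hne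
    simp only at hij
    rw [hij, sub_self, hs.cfm.zero] at this
    exact one_ne_zero this
  have hO : Orth m ((Finset.range p).image (fun j : ℕ => ((j : ℝ) / p) • aR a)) := by
    intro x hx x' hx' hne
    simp only [Finset.coe_image, Set.mem_image, Finset.mem_coe, Finset.mem_range] at hx hx'
    obtain ⟨i, hi, rfl⟩ := hx
    obtain ⟨j, hj, rfl⟩ := hx'
    exact hz i j hi hj (fun h => hne (by rw [h]))
  have := hs.cfm.bessel hO y
  rwa [Finset.sum_image hinj] at this

lemma F_R (hs : Sys p a R T m F) (y) : F (R y) = m y * F y := by rw [hs.feq, hs.TR]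

lemma tree1 (hs : Sys p a R T m F) (he : Eig p a R T l q) (hq : (p : ℤ) ∣ q.num)
    {Λ} (hΛ : Spec F Λ) (h0 : 0 ∈ Λ) : Spec F {γ | γ ∈ intLat ∧ R γ ∈ Λ} := by
  classical
  have hO : ∀ s t, R s ∈ Λ → R t ∈ Λ → s ≠ t → s - t ∈ intLat → F (s - t) = 0 := by
    intro s t hs1 ht1 hne hst
    have h1 := hΛ.1 _ hs1 _ ht1 (fun h => hne (by rw [← hs.TR s, h, hs.TR]))
    rw [← map_sub, hs.F_R, hs.m_lat hst, one_mul] at h1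
    exact h1
  apply spec_of_dense hs.cfF ?_ hs.m_dense
  · intro y hy ε hε
    have hmy : 0 < ‖m y‖ := norm_pos_iff.2 hy
    obtain ⟨S, hS, hsum⟩ := hΛ.2 (R y) (ε * ‖m y‖ ^ 2) (by positivity)
    choose! cl hcl hcl2 using fun δ (hδ : δ ∈ Λ) => hs.class_ex he hq hΛ h0 hδ
    have hterm : ∀ δ ∈ S, ‖F (R y - δ)‖ ^ 2
        = ‖m (y - ((cl δ : ℝ) / p) • aR a)‖ ^ 2 * ‖F (y - T δ)‖ ^ 2 := by
      intro δ hδ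
      have e1 : R y - δ = R (y - T δ) := by rw [map_sub, hs.RT]
      have e2 := hs.m_per_sub (y - ((cl δ : ℝ) / p) • aR a) (hcl2 δ (hS hδ))
      rw [e1, hs.F_R, norm_mul, mul_pow, ← e2]
      congr 4
      abel
    have hTinj : Function.Injective T := fun u v huv => by rw [← hs.RT u, huv, hs.RT]
    have hQ : ∀ j, ∑ δ ∈ S with cl δ = j, ‖F (y - T δ)‖ ^ 2 ≤ 1 := by
      intro j
      have hOj : Orth F ((S.filter (fun δ => cl δ = j)).image T) := by
        intro s hs1 t ht1 hne
        simp only [Finset.coe_image, Set.mem_image, Finset.mem_coe, Finset.mem_filter] at hs1 ht1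
        obtain ⟨s, ⟨hsS, hsj⟩, rfl⟩ := hs1
        obtain ⟨t, ⟨htS, htj⟩, rfl⟩ := ht1
        apply hO _ _ (by rw [hs.RT]; exact hS hsS) (by rw [hs.RT]; exact hS htS) hne
        have := intLat.sub_mem (hcl2 s (hS hsS)) (hcl2 t (hS htS))
        rw [hsj, htj] at this
        simpa using this
      have := hs.cfF.bessel hOj y
      rwa [Finset.sum_image (fun _ _ _ _ h => hTinj h)] at this
    refine ⟨(S.filter (fun δ => cl δ = 0)).image T, ?_, ?_⟩
    · intro γ hγ
      simp only [Finset.coe_image, Set.mem_image, Finset.mem_coe, Finset.mem_filter] at hγ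
      obtain ⟨s, ⟨hsS, hsj⟩, rfl⟩ := hγ
      refine ⟨?_, by rw [hs.RT]; exact hS hsS⟩
      have := hcl2 s (hS hsS)
      rw [hsj] at this
      simpa using this
    · rw [Finset.sum_image (fun _ _ _ _ h => hTinj h)]
      set Q := ∑ δ ∈ S with cl δ = 0, ‖F (y - T δ)‖ ^ 2 with hQdef
      have hb := hs.m_bessel y
      have h1 : ∑ δ ∈ S, ‖F (R y - δ)‖ ^ 2 ≤ ‖m y‖ ^ 2 * Q + (1 - ‖m y‖ ^ 2) := by
        rw [← Finset.sum_fiberwise_of_maps_to (t := Finset.range p) (g := cl)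
          (fun δ hδ => Finset.mem_range.2 (hcl δ (hS hδ)))]
        have h2 : ∀ j ∈ Finset.range p, ∑ δ ∈ S with cl δ = j, ‖F (R y - δ)‖ ^ 2
            = ‖m (y - ((j : ℝ) / p) • aR a)‖ ^ 2 * ∑ δ ∈ S with cl δ = j, ‖F (y - T δ)‖ ^ 2 := by
          intro j _
          rw [Finset.mul_sum]
          refine Finset.sum_congr rfl fun δ hδ => ?_
          rw [Finset.mem_filter] at hδ
          rw [hterm δ hδ.1, hδ.2]
        rw [Finset.sum_congr rfl h2]
        have h0p : 0 ∈ Finset.range p := Finset.mem_range.2 hs.prime.pos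
        rw [← Finset.add_sum_erase _ _ h0p] at hb ⊢
        have e0 : m (y - (((0 : ℕ) : ℝ) / p) • aR a) = m y := by simp
        rw [e0] at hb ⊢
        have h3 : ∑ j ∈ (Finset.range p).erase 0, ‖m (y - ((j : ℝ) / p) • aR a)‖ ^ 2 *
            ∑ δ ∈ S with cl δ = j, ‖F (y - T δ)‖ ^ 2
            ≤ ∑ j ∈ (Finset.range p).erase 0, ‖m (y - ((j : ℝ) / p) • aR a)‖ ^ 2 :=
          Finset.sum_le_sum fun j _ => mul_le_of_le_one_right (by positivity) (hQ j)
        linarith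
      have h2 : ‖m y‖ ^ 2 * (1 - ε) < ‖m y‖ ^ 2 * Q := by nlinarith
      exact lt_of_mul_lt_mul_left h2 (by positivity)
  · rintro s ⟨hs1, hs2⟩ t ⟨ht1, ht2⟩ hne
    exact hO s t hs2 ht2 hne (intLat.sub_mem hs1 ht1)

lemma integrality (hs : Sys p a R T m F) (he : Eig p a R T l q) (hq : (p : ℤ) ∣ q.num) (k : ℕ) :
    ∀ {Λ}, Spec F Λ → 0 ∈ Λ → ∀ δ ∈ Λ, m ((T ^ k) δ) = 0 → ∀ i, 1 ≤ i → i < k → (T ^ i) δ ∈ intLat := by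
  induction k with
  | zero => intro Λ _ _ δ _ _ i _ hi; omega
  | succ k ih =>
    intro Λ hΛ h0 δ hδ hL i hi1 hi2
    have h1 : T δ ∈ intLat := hs.tree0 he hq hΛ h0 hδ (by omega) hL
    rcases Nat.lt_or_ge i 2 with h | h
    · have : i = 1 := by omega
      subst this; simpa using h1
    · obtain ⟨i, rfl⟩ : ∃ j, i = j + 1 := ⟨i - 1, by omega⟩
      have := ih (hs.tree1 he hq hΛ h0) ⟨intLat.zero_mem, by simpa using h0⟩ (T δ)
        ⟨h1, by rwa [hs.RT]⟩ (by rwa [← Module.End.mul_apply, ← pow_succ]) i (by omega) (by omega)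
      rwa [← Module.End.mul_apply, ← pow_succ] at this

lemma integrality' (hs : Sys p a R T m F) (he : Eig p a R T l q) (hq : (p : ℤ) ∣ q.num) {k : ℕ}
    {Λ} (hΛ : Spec F Λ) {s t} (hs1 : s ∈ Λ) (ht1 : t ∈ Λ) (hL : m ((T ^ k) (s - t)) = 0)
    {i : ℕ} (hi1 : 1 ≤ i) (hi2 : i < k) : (T ^ i) (s - t) ∈ intLat :=
  hs.integrality he hq k (hΛ.translate t) (by simpa using ht1) (s - t) (by simpa using hs1) hL i hi1 hi2

lemma exists_deep (hs : Sys p a R T m F) (he : Eig p a R T l q) (hq : (p : ℤ) ∣ q.num)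
    {Λ} (hΛ : Spec F Λ) (N : ℕ) :
    ∃ Λ', Spec F Λ' ∧ 0 ∈ Λ' ∧ ∀ γ ∈ Λ', ∀ i < N, (R ^ i) γ ∈ intLat := by
  induction N with
  | zero =>
    obtain ⟨γ, hγ⟩ := hΛ.nonempty
    exact ⟨_, hΛ.translate γ, by simpa using hγ, fun _ _ i hi => by omega⟩
  | succ N ih =>
    obtain ⟨Λ', h1, h2, h3⟩ := ih
    refine ⟨_, hs.tree1 he hq h1 h2, ⟨intLat.zero_mem, by simpa using h2⟩, ?_⟩
    rintro γ ⟨hγ1, hγ2⟩ i hi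
    cases i with
    | zero => simpa using hγ1
    | succ i =>
      rw [pow_succ, Module.End.mul_apply]
      exact h3 _ hγ2 i (by omega)

end Sys

namespace Sys
variable {p : ℕ} {a : Fin 2 → ℤ} {R T : Module.End ℝ (Fin 2 → ℝ)} {m F : (Fin 2 → ℝ) → ℂ}
  {l : Fin 2 → ℤ} {q : ℚ}

lemma num_pos' (he : Eig p a R T l (q : ℝ)) : 0 < q.num := by
  have h : (0 : ℝ) < q := by linarith [he.hx]
  exact Rat.num_pos.2 (by exact_mod_cast h)

lemma run (hs : Sys p a R T m F) (he : Eig p a R T l (q : ℝ)) :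
    ∃ η B : ℝ, 0 < η ∧ η < 1 ∧ ∀ (y : Fin 2 → ℝ) (K : ℕ), 1 ≤ K → lf l y ≠ 0 →
      K * Real.log q ≤ Real.log |lf l y| →
      Real.log |lf l y| + B ≤ K * (Real.log q + Real.log q.den) →
      ‖F y‖ ≤ η * ‖F ((T ^ K) y)‖ := by
  obtain ⟨C, hC, hn⟩ := hs.near
  have hP := num_pos' he
  have hd : 0 < (q.den : ℝ) := by exact_mod_cast q.den_pos
  have hPr : (0 : ℝ) < q.num := by exact_mod_cast hP
  have hqd : (q : ℝ) * (q.den : ℝ) = q.num := by exact_mod_cast Rat.mul_den_eq_num q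
  have hq1 : (1 : ℝ) < q := he.hx
  have hq0 : (0 : ℝ) < q := by linarith
  set L1 : ℝ := |(l 0 : ℝ)| + |(l 1 : ℝ)| + 1 with hL1
  have hL1p : 0 < L1 := by positivity
  have hPd : 0 < (q.num : ℝ) + q.den := by positivity
  obtain ⟨η', hη', hnear⟩ := hn (1 / (2 * ((q.num : ℝ) + q.den) * L1)) (by positivity)
  have hCr : 1 ≤ |(C : ℝ)| := by exact_mod_cast Int.one_le_abs hC
  refine ⟨max η' (1 / 2), Real.log (2 * |(C : ℝ)|) + Real.log q.den, by positivity,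
    max_lt hη' (by norm_num), ?_⟩
  intro y K hK hy hu1 hu2
  by_contra hlt
  push Not at hlt
  have hyp : 0 < |lf l y| := abs_pos.2 hy
  rw [hs.F_eq K y, norm_mul] at hlt
  have hFK : η' < ‖Fk m T K y‖ := by
    have : max η' (1 / 2) < ‖Fk m T K y‖ := lt_of_mul_lt_mul_right hlt (norm_nonneg _)
    exact lt_of_le_of_lt (le_max_left _ _) this
  have hk : ∀ i < K, η' < ‖m ((T ^ (i + 1)) y)‖ := by
    intro i hi
    refine lt_of_lt_of_le hFK ?_
    unfold Fk
    rw [norm_prod, ← Finset.mul_prod_erase _ _ (Finset.mem_range.2 hi)]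
    exact mul_le_of_le_one_right (norm_nonneg _)
      (Finset.prod_le_one (fun _ _ => norm_nonneg _) (fun _ _ => hs.cfm.norm_le _))
  have hz : ∀ i < K, ∃ z : ℤ, ((q.num : ℝ) + q.den) * |C * lf l ((T ^ (i + 1)) y) - z| < 1 / 2 := by
    intro i hi
    obtain ⟨z0, hz0⟩ := hnear _ (hk i hi) 0
    obtain ⟨z1, hz1⟩ := hnear _ (hk i hi) 1
    refine ⟨l 0 * z0 + l 1 * z1, ?_⟩
    set w := (T ^ (i + 1)) y
    set ε := 1 / (2 * ((q.num : ℝ) + q.den) * L1) with hε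
    have hεp : 0 < ε := by positivity
    have e : C * lf l w - ((l 0 * z0 + l 1 * z1 : ℤ) : ℝ)
        = l 0 * (C * w 0 - z0) + l 1 * (C * w 1 - z1) := by
      unfold lf; push_cast; ring
    rw [e]
    have h1 : |(l 0 : ℝ) * (C * w 0 - z0) + l 1 * (C * w 1 - z1)| < L1 * ε := by
      refine lt_of_le_of_lt (abs_add_le _ _) ?_
      rw [abs_mul, abs_mul]
      have := mul_le_mul_of_nonneg_left hz0.le (abs_nonneg (l 0 : ℝ))
      have := mul_le_mul_of_nonneg_left hz1.le (abs_nonneg (l 1 : ℝ))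
      rw [hL1]; nlinarith
    calc _ < ((q.num : ℝ) + q.den) * (L1 * ε) := mul_lt_mul_of_pos_left h1 hPd
      _ = 1 / 2 := by rw [hε]; field_simp
  choose! z hz using hz
  have hrec : ∀ i, i + 1 < K → (q.den : ℤ) * z i = q.num * z (i + 1) := by
    intro i hi
    have h1 := hz i (by omega)
    have h2 := hz (i + 1) hi
    have e : lf l ((T ^ (i + 1)) y) * q.den = q.num * lf l ((T ^ (i + 1 + 1)) y) := by
      have := hs.eig_Tpow he 1 ((T ^ (i + 1)) y)
      rw [← Module.End.mul_apply, ← pow_add, add_comm 1 (i + 1), pow_one] at this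
      rw [this, ← hqd]; ring
    set A := C * lf l ((T ^ (i + 1)) y)
    set A' := C * lf l ((T ^ (i + 1 + 1)) y)
    have e2 : A * q.den = q.num * A' := by
      simp only [A, A']; rw [mul_assoc, e]; ring
    have h3 : |((q.den : ℝ) * z i - q.num * z (i + 1))| < 1 := by
      have e3 : (q.den : ℝ) * z i - q.num * z (i + 1)
        = q.num * (A' - z (i + 1)) - q.den * (A - z i) := by linarith
      rw [e3]
      refine lt_of_le_of_lt (abs_sub _ _) ?_
      rw [abs_mul, abs_mul, abs_of_pos hPr, abs_of_pos hd]
      have g1 := abs_nonneg (A' - z (i + 1))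
      have g2 := abs_nonneg (A - z i)
      nlinarith
    have h4 : |(q.den : ℤ) * z i - q.num * z (i + 1)| < 1 := by exact_mod_cast h3
    have := Int.abs_lt_one_iff.1 h4
    omega
  have hrec2 : ∀ j < K, (q.den : ℤ) ^ j * z 0 = q.num ^ j * z j := by
    intro j
    induction j with
    | zero => intro _; simp
    | succ j ih =>
      intro hj
      rw [pow_succ, mul_comm ((q.den : ℤ) ^ j), mul_assoc, ih (by omega), pow_succ, mul_assoc,
        ← hrec j hj]; ring
  have hdv : (q.den : ℤ) ^ (K - 1) ∣ z (K - 1) := by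
    have h1 : (q.den : ℤ) ^ (K - 1) ∣ q.num ^ (K - 1) * z (K - 1) :=
      ⟨z 0, (hrec2 (K - 1) (by omega)).symm⟩
    refine IsCoprime.dvd_of_dvd_mul_left ?_ h1
    exact (Rat.isCoprime_num_den q).symm.pow
  have hKK : K - 1 + 1 = K := by omega
  have hlast := hz (K - 1) (by omega)
  rw [hKK] at hlast
  have hTK := hs.eig_Tpow he K y
  set w := lf l ((T ^ K) y) with hw
  have hqK : 0 < (q : ℝ) ^ K := by positivity
  have hw1 : 1 ≤ |w| := by
    have h1 : (q : ℝ) ^ K ≤ |lf l y| := by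
      rw [← Real.log_le_log_iff hqK hyp, Real.log_pow]; exact hu1
    rw [hTK, abs_mul, abs_of_pos hqK] at h1
    nlinarith
  have hCw : 1 ≤ |C * w| := by rw [abs_mul]; nlinarith
  have hPd1 : 1 ≤ (q.num : ℝ) + q.den := by
    have : (1 : ℝ) ≤ q.num := by exact_mod_cast hP
    linarith
  have hlast2 : |C * w - z (K - 1)| < 1 / 2 := by
    have := abs_nonneg (C * w - z (K - 1))
    nlinarith
  have hz0 : z (K - 1) ≠ 0 := by
    intro h0
    rw [h0] at hlast2
    simp only [Int.cast_zero, sub_zero] at hlast2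
    linarith
  have hle : (q.den : ℤ) ^ (K - 1) ≤ |z (K - 1)| := by
    have := Int.le_of_dvd (abs_pos.2 hz0) ((dvd_abs _ _).2 hdv)
    exact this
  have hle2 : (q.den : ℝ) ^ (K - 1) ≤ |(z (K - 1) : ℝ)| := by exact_mod_cast hle
  have hle3 : (q.den : ℝ) ^ (K - 1) < 2 * |C * w| := by
    have : |(z (K - 1) : ℝ)| ≤ |C * w| + |C * w - z (K - 1)| := by
      have := abs_sub (C * w) (C * w - z (K - 1))
      simpa using this
    linarith
  have hle4 : (q : ℝ) ^ K * (q.den : ℝ) ^ (K - 1) < 2 * |(C : ℝ)| * |lf l y| := by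
    rw [hTK, abs_mul ((q : ℝ) ^ K), abs_of_pos hqK]
    rw [abs_mul] at hle3
    nlinarith
  have hlog := Real.log_lt_log (by positivity) hle4
  rw [Real.log_mul (by positivity) (by positivity), Real.log_mul (by positivity) (by positivity),
    Real.log_pow, Real.log_pow] at hlog
  have : ((K - 1 : ℕ) : ℝ) = K - 1 := by push_cast [hK]; ring
  rw [this] at hlog
  linarith

lemma log_T (hs : Sys p a R T m F) (he : Eig p a R T l (q : ℝ)) (K : ℕ) {y} (hly : lf l y ≠ 0) :
    Real.log |lf l ((T ^ K) y)| = Real.log |lf l y| - K * Real.log q := by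
  have e := hs.eig_Tpow he K y
  have hq0 : (0 : ℝ) < q := by linarith [he.hx]
  have hne : lf l ((T ^ K) y) ≠ 0 := by
    intro h0; rw [h0, mul_zero] at e; exact hly e
  rw [Real.log_abs, Real.log_abs, e, Real.log_mul (by positivity) hne, Real.log_pow]; ring

lemma decay (hs : Sys p a R T m F) (he : Eig p a R T l (q : ℝ)) (hd2 : 2 ≤ q.den) :
    ∃ C κ : ℝ, 0 < C ∧ 0 < κ ∧ ∀ y, 0 < Real.log |lf l y| →
      ‖F y‖ ≤ C * (Real.log |lf l y|) ^ (-κ) := by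
  obtain ⟨η, B, hη0, hη1, hrun⟩ := hs.run he
  set X := Real.log q with hX
  set E := Real.log q.den with hE
  have hXp : 0 < X := Real.log_pos he.hx
  have hEp : 0 < E := Real.log_pos (by exact_mod_cast hd2)
  set W := 2 * (X + E) / E with hW
  have hW1 : 1 < W := by rw [hW, lt_div_iff₀ hEp]; linarith
  set κ := Real.log (1 / η) / Real.log W with hκ
  have hlW : 0 < Real.log W := Real.log_pos hW1
  have hκp : 0 < κ := div_pos (Real.log_pos (by rw [lt_div_iff₀ hη0]; linarith)) hlW
  have hWκ : η * W ^ κ = 1 := by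
    rw [Real.rpow_def_of_pos (by linarith), hκ, mul_div_cancel₀ _ hlW.ne', Real.exp_log (by positivity)]
    field_simp
  set u0 := max (max 1 (-B + 1)) ((|B| + X + E) * X * 2 / E) with hu0
  have hu01 : 1 ≤ u0 := (le_max_left _ _).trans (le_max_left _ _)
  refine ⟨u0 ^ κ, κ, by positivity, hκp, ?_⟩
  have main : ∀ n : ℕ, ∀ y, 0 < Real.log |lf l y| → Real.log |lf l y| < n * X →
      ‖F y‖ ≤ u0 ^ κ * (Real.log |lf l y|) ^ (-κ) := by
    intro n
    induction n with
    | zero => intro y h1 h2; rw [Nat.cast_zero, zero_mul] at h2; linarith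
    | succ n ih =>
      intro y h1 h2
      set u := Real.log |lf l y| with hu
      rcases le_or_gt u u0 with h | h
      · refine (hs.cfF.norm_le _).trans ?_
        rw [Real.rpow_neg h1.le, ← div_eq_mul_inv, le_div_iff₀ (by positivity), one_mul]
        exact Real.rpow_le_rpow h1.le h hκp.le
      · set K := ⌈(u + B) / (X + E)⌉₊ with hK
        have hXE : 0 < X + E := by linarith
        have huB : 0 < u + B := by
          have : -B + 1 ≤ u0 := (le_max_right _ _).trans (le_max_left _ _)
          linarith
        have hK1 : 1 ≤ K := Nat.ceil_pos.2 (by positivity)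
        have hKge : (u + B) / (X + E) ≤ K := Nat.le_ceil _
        have hKlt : (K : ℝ) < (u + B) / (X + E) + 1 := Nat.ceil_lt_add_one (by positivity)
        rw [div_le_iff₀ hXE] at hKge
        have hKlt2 : (K : ℝ) * (X + E) < u + B + (X + E) := by
          have := mul_lt_mul_of_pos_right hKlt hXE
          rw [add_mul, div_mul_cancel₀ _ hXE.ne', one_mul] at this
          linarith
        have hub : (|B| + X + E) * X * 2 ≤ u * E := by
          have : (|B| + X + E) * X * 2 / E ≤ u := (le_max_right _ _).trans h.le
          rwa [div_le_iff₀ hEp] at this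
        have hWu : u / W ≤ u - K * X := by
          rw [hW]
          rw [div_div_eq_mul_div, div_le_iff₀ (by linarith)]
          have := le_abs_self B
          have h5 : (K : ℝ) * (X + E) * X ≤ (u + B + (X + E)) * X := by nlinarith
          nlinarith
        have hly : lf l y ≠ 0 := by
          intro h0; rw [hu, h0] at h1; simp at h1
        have hu' : Real.log |lf l ((T ^ K) y)| = u - K * X := by
          exact hs.log_T he K hly
        have huWp : 0 < u / W := by positivity
        have h3 := hrun y K hK1 hly (by linarith) (by linarith)
        have h4 := ih ((T ^ K) y) (by rw [hu']; linarith) (by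
          rw [hu']
          have : (1 : ℝ) ≤ K := by exact_mod_cast hK1
          push_cast at h2
          nlinarith)
        rw [hu'] at h4
        have h5 : (u - K * X) ^ (-κ) ≤ (u / W) ^ (-κ) :=
          Real.rpow_le_rpow_of_nonpos huWp hWu (by linarith)
        calc ‖F y‖ ≤ η * (u0 ^ κ * (u / W) ^ (-κ)) := by
              refine h3.trans (mul_le_mul_of_nonneg_left (h4.trans ?_) hη0.le)
              exact mul_le_mul_of_nonneg_left h5 (by positivity)
          _ = u0 ^ κ * u ^ (-κ) := by
              rw [Real.div_rpow h1.le (by linarith), Real.rpow_neg (by linarith : (0 : ℝ) ≤ W),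
                div_inv_eq_mul]
              linear_combination (u0 ^ κ * u ^ (-κ)) * hWκ
  intro y hy
  obtain ⟨n, hn⟩ := exists_nat_gt (Real.log |lf l y| / X)
  exact main n y hy (by rwa [div_lt_iff₀ hXp] at hn)


lemma block (hs : Sys p a R T m F) (he : Eig p a R T l (q : ℝ)) (hq : (p : ℤ) ∣ q.num)
    (hd2 : 2 ≤ q.den) {C κ : ℝ} (hC : 0 < C) (hκ : 0 < κ)
    (hdec : ∀ y, 0 < Real.log |lf l y| → ‖F y‖ ≤ C * (Real.log |lf l y|) ^ (-κ)) (ξ : Fin 2 → ℝ) :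
    ∃ e1 r C' : ℝ, 0 < e1 ∧ 1 < r ∧ 0 < C' ∧ ∀ e, e1 ≤ e → ∀ Λ, Spec F Λ → (∀ γ ∈ Λ, γ ∈ intLat) →
      ∀ S : Finset (Fin 2 → ℝ), (S : Set (Fin 2 → ℝ)) ⊆ Λ →
        (∀ γ ∈ S, lf l γ ≠ 0 ∧ e ≤ Real.log |lf l γ| ∧ Real.log |lf l γ| < r * e) →
        ∑ γ ∈ S, ‖F (ξ - γ)‖ ^ 2 ≤ C' * (e ^ (-κ)) ^ 2 := by
  set X := Real.log q with hX
  set E := Real.log q.den with hE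
  have hXp : 0 < X := Real.log_pos he.hx
  have hEp : 0 < E := Real.log_pos (by exact_mod_cast hd2)
  have hXE : 0 < X + E := by linarith
  have hq0 : (0 : ℝ) < q := by linarith [he.hx]
  have hl2 : 0 < Real.log 2 := Real.log_pos (by norm_num)
  set W := 4 * (X + E) / E with hW
  have hWp : 0 < W := by positivity
  have hP := num_pos' he
  have hqd : (q : ℝ) * (q.den : ℝ) = q.num := by exact_mod_cast Rat.mul_den_eq_num q
  have hlogP : Real.log q.num = X + E := by
    rw [← hqd, Real.log_mul hq0.ne' (by exact_mod_cast q.den_ne_zero)]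
  set e1 := max (max 1 (Real.log (2 * |lf l ξ| + 1))) ((2 * Real.log 2 + X) * (X + E) * 4 / E) with he1
  refine ⟨e1, 1 + E / (2 * X), (C * W ^ κ) ^ 2, ?_, ?_, by positivity, ?_⟩
  · exact lt_of_lt_of_le one_pos ((le_max_left _ _).trans (le_max_left _ _))
  · have : 0 < E / (2 * X) := by positivity
    linarith
  intro e hee Λ hΛ hintg S hS hblk
  have he1' : 1 ≤ e := ((le_max_left _ _).trans (le_max_left _ _)).trans hee
  have he2 : Real.log (2 * |lf l ξ| + 1) ≤ e := ((le_max_right _ _).trans (le_max_left _ _)).trans hee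
  have he3 : (2 * Real.log 2 + X) * (X + E) * 4 ≤ e * E := by
    have : (2 * Real.log 2 + X) * (X + E) * 4 / E ≤ e := (le_max_right _ _).trans hee
    rwa [div_le_iff₀ hEp] at this
  set r := 1 + E / (2 * X) with hr
  have hrX : r * X = X + E / 2 := by rw [hr]; field_simp
  set K := ⌊(Real.log 2 + r * e) / (X + E)⌋₊ + 1 with hK
  have hrp : 0 < r := by positivity
  have hKgt : (Real.log 2 + r * e) < K * (X + E) := by
    rw [← div_lt_iff₀ hXE, hK]; push_cast; exact Nat.lt_floor_add_one _
  have hKle : (K : ℝ) * (X + E) ≤ Real.log 2 + r * e + (X + E) := by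
    have : ((⌊(Real.log 2 + r * e) / (X + E)⌋₊ : ℕ) : ℝ) ≤ (Real.log 2 + r * e) / (X + E) :=
      Nat.floor_le (by positivity)
    rw [le_div_iff₀ hXE] at this
    rw [hK]; push_cast; linarith
  -- orthogonality for the partial product
  have hO : Orth (Fk m T K) S := by
    intro γ hγ γ' hγ' hne
    obtain ⟨k, hk1, hk⟩ := hs.F_zero_iff.1 (hΛ.1 γ (hS hγ) γ' (hS hγ') hne)
    rcases le_or_gt k K with h | h
    · exact Fk_zero_of hk1 h hk
    exfalso
    have hk2 : 1 ≤ k - 1 := by omega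
    have h1 := hs.integrality' he hq hΛ (hS hγ) (hS hγ') hk hk2 (by omega)
    obtain ⟨z, hz⟩ := lf_int l h1
    obtain ⟨b, hb⟩ := lf_int l (intLat.sub_mem (hintg γ (hS hγ)) (hintg γ' (hS hγ')))
    have h2 := hs.eig_Tpow he (k - 1) (γ - γ')
    rw [hz, hb] at h2
    have h3 := pow_num_den h2
    have h4 : q.num ^ (k - 1) ∣ b := by
      have : q.num ^ (k - 1) ∣ b * (q.den : ℤ) ^ (k - 1) := ⟨z, h3⟩
      exact IsCoprime.dvd_of_dvd_mul_right (Rat.isCoprime_num_den q).pow this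
    have hb0 : b ≠ 0 := by
      rintro rfl
      obtain ⟨i, hi, e⟩ := hs.lev_lf he hk
      rw [hb] at e
      simp only [Int.cast_zero, mul_zero] at e
      have : (i : ℝ) = 0 := by
        rcases mul_eq_zero.1 e.symm with h | h
        · exact absurd h (pow_ne_zero _ hq0.ne')
        · exact h
      apply hi
      have : i = 0 := by exact_mod_cast this
      rw [this]; exact dvd_zero _
    have h5 : q.num ^ (k - 1) ≤ |b| := Int.le_of_dvd (abs_pos.2 hb0) ((dvd_abs _ _).2 h4)
    have h6 : q.num ^ K ≤ |b| := (pow_le_pow_right₀ (by omega) (by omega)).trans h5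
    have h7 : (q.num : ℝ) ^ K ≤ |lf l (γ - γ')| := by rw [hb]; exact_mod_cast h6
    have hlt : ∀ γ ∈ S, |lf l γ| < Real.exp (r * e) := fun γ hγ => by
      obtain ⟨g1, g2, g3⟩ := hblk γ hγ
      rwa [Real.log_lt_iff_lt_exp (abs_pos.2 g1)] at g3
    have h8 : |lf l (γ - γ')| ≤ 2 * Real.exp (r * e) := by
      rw [lf_sub]
      have := abs_sub (lf l γ) (lf l γ')
      have := hlt γ hγ
      have := hlt γ' hγ'
      linarith
    have h9 := Real.log_le_log (by positivity) (h7.trans h8)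
    rw [Real.log_pow, Real.log_mul (by norm_num) (Real.exp_ne_zero _), Real.log_exp, hlogP] at h9
    linarith
  have hKX : e / W ≤ e - Real.log 2 - K * X := by
    rw [hW, div_div_eq_mul_div, div_le_iff₀ (by linarith)]
    have h5 : (K : ℝ) * (X + E) * X ≤ (Real.log 2 + r * e + (X + E)) * X := by nlinarith
    have h6 : r * e * X = e * (X + E / 2) := by rw [← hrX]; ring
    nlinarith
  have heW : 0 < e / W := by positivity
  have hterm : ∀ γ ∈ S, ‖F ((T ^ K) (ξ - γ))‖ ≤ C * (e / W) ^ (-κ) := by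
    intro γ hγ
    obtain ⟨g1, g2, g3⟩ := hblk γ hγ
    have hgp : 0 < |lf l γ| := abs_pos.2 g1
    have h1 : 2 * |lf l ξ| + 1 ≤ |lf l γ| := by
      rw [← Real.log_le_log_iff (by positivity) hgp]; linarith
    have h2 : |lf l γ| / 2 ≤ |lf l (ξ - γ)| := by
      rw [lf_sub]
      have := abs_sub_abs_le_abs_sub (lf l γ) (lf l ξ)
      rw [abs_sub_comm] at this
      linarith
    have h3 : lf l (ξ - γ) ≠ 0 := by rw [← abs_pos]; linarith
    have h4 : e - Real.log 2 ≤ Real.log |lf l (ξ - γ)| := by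
      have := Real.log_le_log (by positivity) h2
      rw [Real.log_div hgp.ne' (by norm_num)] at this
      linarith
    have h5 := hs.log_T he K h3
    rw [← hX] at h5
    have h6 : e / W ≤ Real.log |lf l ((T ^ K) (ξ - γ))| := by linarith
    refine (hdec _ (by linarith)).trans (mul_le_mul_of_nonneg_left ?_ hC.le)
    exact Real.rpow_le_rpow_of_nonpos heW h6 (by linarith)
  have hb := (hs.cfFk K).bessel hO ξ
  have hcal : (C * (e / W) ^ (-κ)) ^ 2 = (C * W ^ κ) ^ 2 * (e ^ (-κ)) ^ 2 := by
    rw [Real.div_rpow (by linarith) hWp.le, Real.rpow_neg hWp.le, div_inv_eq_mul]; ring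
  rw [← hcal]
  calc ∑ γ ∈ S, ‖F (ξ - γ)‖ ^ 2
      ≤ ∑ γ ∈ S, (C * (e / W) ^ (-κ)) ^ 2 * ‖Fk m T K (ξ - γ)‖ ^ 2 := by
        refine Finset.sum_le_sum fun γ hγ => ?_
        rw [hs.F_eq K, norm_mul, mul_pow, mul_comm]
        exact mul_le_mul_of_nonneg_right
          (pow_le_pow_left₀ (norm_nonneg _) (hterm γ hγ) 2) (by positivity)
    _ ≤ _ := by
        rw [← Finset.mul_sum]
        exact mul_le_of_le_one_right (by positivity) hb

lemma den_one (hs : Sys p a R T m F) (he : Eig p a R T l (q : ℝ)) (hq : (p : ℤ) ∣ q.num)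
    {Λ} (hΛ : Spec F Λ) : q.den = 1 := by
  classical
  by_contra hne
  have hd2 : 2 ≤ q.den := by have := q.den_pos; omega
  obtain ⟨C, κ, hC, hκ, hdec⟩ := hs.decay he hd2
  have hp0 : (p : ℝ) ≠ 0 := by exact_mod_cast hs.prime.ne_zero
  set ξ := R ((1 / (p : ℝ)) • aR a) with hξ
  have hFξ : F ξ = 0 := by
    rw [hs.feq, hξ, hs.TR, (hs.zero _).2 ⟨1, ?_, ?_⟩, zero_mul]
    · intro h
      have := Int.eq_one_of_dvd_one (by positivity) h
      have h2 := hs.prime.one_lt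
      omega
    · simp
  obtain ⟨e1, r, C', he1, hr, hC', hblk⟩ := hs.block he hq hd2 hC hκ hdec ξ
  have hq0 : (0 : ℝ) < q := by linarith [he.hx]
  have hEp : 0 < Real.log q.den := Real.log_pos (by exact_mod_cast hd2)
  set θ := (r ^ (-κ)) ^ 2 with hθ
  have hr0 : 0 < r := by linarith
  have hθ1 : θ < 1 := by
    have : r ^ (-κ) < 1 := Real.rpow_lt_one_of_one_lt_of_neg hr (by linarith)
    have h2 : 0 < r ^ (-κ) := by positivity
    rw [hθ]; nlinarith
  have hθ0 : 0 ≤ θ := by positivity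
  -- choose the starting scale
  have htend : Filter.Tendsto (fun e : ℝ => C' * (e ^ (-κ)) ^ 2 * (1 - θ)⁻¹) Filter.atTop (nhds 0) := by
    have := tendsto_rpow_neg_atTop hκ
    have := ((this.pow 2).const_mul C').mul_const (1 - θ)⁻¹
    simpa using this
  obtain ⟨e0, he0, he01⟩ := ((htend.eventually_lt_const (show (0 : ℝ) < 1 / 2 by norm_num)).and
    (Filter.eventually_ge_atTop (max e1 1))).exists
  have he0e1 : e1 ≤ e0 := (le_max_left _ _).trans he01
  have he0p : 0 < e0 := lt_of_lt_of_le he1 he0e1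
  obtain ⟨N, hN⟩ := exists_nat_gt (e0 / Real.log q.den)
  rw [div_lt_iff₀ hEp] at hN
  obtain ⟨Λ', hΛ', h0, hdeep⟩ := hs.exists_deep he hq hΛ (N + 1)
  have hintg : ∀ γ ∈ Λ', γ ∈ intLat := fun γ hγ => by simpa using hdeep γ hγ 0 (by omega)
  obtain ⟨S, hS, hsum⟩ := hΛ'.2 ξ (1 / 2) (by norm_num)
  have hne0 : ∀ γ ∈ Λ', γ ≠ 0 → lf l γ ≠ 0 ∧ e0 ≤ Real.log |lf l γ| := by
    intro γ hγ hγ0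
    obtain ⟨k, hk1, hk⟩ := hs.F_zero_iff.1 (hΛ'.1 γ hγ 0 h0 hγ0)
    rw [sub_zero] at hk
    obtain ⟨b, hb⟩ := lf_int l (hintg γ hγ)
    have hb0 : lf l γ ≠ 0 := by
      intro h0
      obtain ⟨i, hi, e⟩ := hs.lev_lf he hk
      rw [h0, mul_zero] at e
      have : (i : ℝ) = 0 := by
        rcases mul_eq_zero.1 e.symm with h | h
        · exact absurd h (pow_ne_zero _ hq0.ne')
        · exact h
      apply hi
      have : i = 0 := by exact_mod_cast this
      rw [this]; exact dvd_zero _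
    refine ⟨hb0, ?_⟩
    obtain ⟨z, hz⟩ := lf_int l (hdeep γ hγ N (by omega))
    rw [eig_pow he N, hb] at hz
    have h3 := pow_num_den hz.symm
    have h4 : (q.den : ℤ) ^ N ∣ b := by
      have : (q.den : ℤ) ^ N ∣ q.num ^ N * b := ⟨z, by rw [← h3]; ring⟩
      exact IsCoprime.dvd_of_dvd_mul_left (Rat.isCoprime_num_den q).symm.pow this
    have hb1 : b ≠ 0 := by rintro rfl; exact hb0 (by simpa using hb)
    have h5 : (q.den : ℤ) ^ N ≤ |b| := Int.le_of_dvd (abs_pos.2 hb1) ((dvd_abs _ _).2 h4)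
    have h6 : (q.den : ℝ) ^ N ≤ |lf l γ| := by rw [hb]; exact_mod_cast h5
    have hdp : 0 < (q.den : ℝ) := by exact_mod_cast q.den_pos
    have h7 := Real.log_le_log (by positivity) h6
    rw [Real.log_pow] at h7
    linarith
  -- block index
  have hidx : ∀ γ ∈ Λ', γ ≠ 0 → ∃ i : ℕ, e0 * r ^ i ≤ Real.log |lf l γ| ∧
      Real.log |lf l γ| < e0 * r ^ (i + 1) := by
    intro γ hγ hγ0
    have h1 := (hne0 γ hγ hγ0).2
    obtain ⟨n, hn⟩ := exists_nat_pow_near (x := Real.log |lf l γ| / e0) (y := r)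
      (by rwa [le_div_iff₀ he0p, one_mul]) hr
    refine ⟨n, ?_, ?_⟩
    · have := hn.1; rw [le_div_iff₀ he0p] at this; linarith
    · have := hn.2; rw [div_lt_iff₀ he0p] at this; linarith
  choose! idx hidx1 hidx2 using hidx
  set S' := S.erase 0 with hS'
  have hS'Λ : ∀ γ ∈ S', γ ∈ Λ' ∧ γ ≠ 0 := fun γ hγ =>
    ⟨hS (Finset.mem_of_mem_erase hγ), Finset.ne_of_mem_erase hγ⟩
  have hle : ∑ γ ∈ S, ‖F (ξ - γ)‖ ^ 2 ≤ ∑ γ ∈ S', ‖F (ξ - γ)‖ ^ 2 := by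
    by_cases h : (0 : Fin 2 → ℝ) ∈ S
    · rw [← Finset.add_sum_erase _ _ h]; simp [hFξ, hS']
    · rw [hS', Finset.erase_eq_of_notMem h]
  obtain ⟨n, hn⟩ : ∃ n, ∀ γ ∈ S', idx γ < n := by
    refine ⟨S'.sup idx + 1, fun γ hγ => Nat.lt_succ_of_le (Finset.le_sup hγ)⟩
  have hbd : ∑ γ ∈ S', ‖F (ξ - γ)‖ ^ 2 ≤ C' * (e0 ^ (-κ)) ^ 2 * (1 - θ)⁻¹ := by
    rw [← Finset.sum_fiberwise_of_maps_to (t := Finset.range n) (g := idx)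
          (fun γ hγ => Finset.mem_range.2 (hn γ hγ))]
    have h1 : ∀ i ∈ Finset.range n, ∑ γ ∈ S' with idx γ = i, ‖F (ξ - γ)‖ ^ 2
        ≤ C' * (e0 ^ (-κ)) ^ 2 * θ ^ i := by
      intro i _
      have hri : 1 ≤ r ^ i := one_le_pow₀ hr.le
      have h2 := hblk (e0 * r ^ i) (by nlinarith) Λ' hΛ' hintg (S'.filter (fun γ => idx γ = i))
        (fun γ hγ => (hS'Λ γ (Finset.mem_filter.1 hγ).1).1) ?_
      · refine h2.trans (le_of_eq ?_)
        rw [Real.mul_rpow he0p.le (by positivity), ← Real.rpow_natCast r i, ← Real.rpow_mul hr0.le,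
          mul_comm (i : ℝ), Real.rpow_mul hr0.le, Real.rpow_natCast, hθ]
        ring
      · intro γ hγ
        obtain ⟨g1, g2⟩ := Finset.mem_filter.1 hγ
        obtain ⟨g3, g4⟩ := hS'Λ γ g1
        refine ⟨(hne0 γ g3 g4).1, ?_, ?_⟩
        · rw [← g2]; exact hidx1 γ g3 g4
        · have := hidx2 γ g3 g4
          rw [g2, pow_succ] at this
          linarith
    refine (Finset.sum_le_sum h1).trans ?_
    rw [← Finset.mul_sum]
    refine mul_le_mul_of_nonneg_left ?_ (by positivity)
    rw [← tsum_geometric_of_lt_one hθ0 hθ1]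
    exact (summable_geometric_of_lt_one hθ0 hθ1).sum_le_tsum _ (fun _ _ => by positivity)
  linarith

end Sys

lemma notEa_of {p : ℕ} {a : Fin 2 → ℤ} {s t : ℤ} (hg : IsCoprime s t)
    (ht : t ≠ 0) (hs0 : s ≠ 0) (hd : (p : ℤ) ∣ t * a 1 - s * a 0) : (s : ℝ) / t ∉ Ea p a := by
  have htr : (t : ℝ) ≠ 0 := by exact_mod_cast ht
  have hsr : (s : ℝ) ≠ 0 := by exact_mod_cast hs0
  rintro (⟨h, l, hgl, hnd, e⟩ | h0)
  · apply hnd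
    have hl : (l : ℝ) ≠ 0 := by
      intro h0; rw [h0, div_zero] at e; exact (div_ne_zero hsr htr) e
    rw [div_eq_div_iff htr hl] at e
    have e' : s * l = h * t := by exact_mod_cast e
    have h1 : (p : ℤ) ∣ t * (l * a 1 - h * a 0) := by
      have : t * (l * a 1 - h * a 0) = l * (t * a 1 - s * a 0) := by linear_combination (a 0) * e'
      rw [this]; exact hd.mul_left _
    have h2 : (p : ℤ) ∣ s * (l * a 1 - h * a 0) := by
      have : s * (l * a 1 - h * a 0) = h * (t * a 1 - s * a 0) := by linear_combination (a 1) * e'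
      rw [this]; exact hd.mul_left _
    obtain ⟨u, v, huv⟩ := hg
    have : l * a 1 - h * a 0 = u * (s * (l * a 1 - h * a 0)) + v * (t * (l * a 1 - h * a 0)) := by
      linear_combination (-(l * a 1 - h * a 0)) * huv
    rw [this]
    exact dvd_add (h2.mul_left _) (h1.mul_left _)
  · exact (div_ne_zero hsr htr) h0

namespace Sys
variable {p : ℕ} {a : Fin 2 → ℤ} {R T : Module.End ℝ (Fin 2 → ℝ)} {m F : (Fin 2 → ℝ) → ℂ}
  {l : Fin 2 → ℤ} {x : ℝ}

lemma a_nd (hs : Sys p a R T m F) (i) : ¬ (p : ℤ) ∣ a i := by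
  intro h
  have := Int.le_of_dvd (by have := hs.a_range i; omega) h
  have := hs.a_range i
  omega

lemma eig_int (hs : Sys p a R T m F) (he : Eig p a R T l x) {Λ} (hΛ : Spec F Λ) :
    ∃ n : ℤ, (p : ℤ) ∣ n ∧ x = n := by
  obtain ⟨q, hx, hq⟩ := hs.N1 he hΛ
  subst hx
  have := hs.den_one he hq hΛ
  refine ⟨q.num, hq, ?_⟩
  have h2 : (q : ℚ) = q.num := by
    conv_lhs => rw [← Rat.num_div_den q]
    rw [this]; simp
  exact_mod_cast congrArg (fun r : ℚ => (r : ℝ)) h2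

lemma deep_w (hs : Sys p a R T m F) (he : Eig p a R T l x) {Λ} (hΛ : Spec F Λ) :
    ∃ (j α β : ℤ) (w : Fin 2 → ℝ), ¬ (p : ℤ) ∣ j ∧ (p : ℤ) ∣ α - j * a 0 ∧ (p : ℤ) ∣ β - j * a 1 ∧
      w 0 = α / p ∧ w 1 = β / p ∧ ∀ i < 3, (R ^ (i + 1)) w ∈ intLat := by
  have hp0 : (p : ℝ) ≠ 0 := by exact_mod_cast hs.prime.ne_zero
  obtain ⟨q, hx, hq⟩ := hs.N1 he hΛ
  subst hx
  obtain ⟨Λ', hΛ', h0, hdeep⟩ := hs.exists_deep he hq hΛ 3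
  obtain ⟨γ, hγ, hγ0, h1⟩ := hs.exists_lev1 he hq hΛ' h0
  obtain ⟨j, hj, k, hk⟩ := (hs.zero _).1 h1
  refine ⟨j, j * a 0 + p * k 0, j * a 1 + p * k 1, T γ, hj, by simp, by simp, ?_, ?_, ?_⟩
  · have := hk 0
    simp only [Pi.sub_apply, Pi.smul_apply, smul_eq_mul, aR] at this
    push_cast; field_simp; field_simp at this; linarith
  · have := hk 1
    simp only [Pi.sub_apply, Pi.smul_apply, smul_eq_mul, aR] at this
    push_cast; field_simp; field_simp at this; linarith
  · intro i hi
    rw [pow_succ, Module.End.mul_apply, hs.RT]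
    exact hdeep γ hγ i hi
end Sys

lemma rat_reduce {c : ℝ} {u v : ℤ} (hv : v ≠ 0) (h : c = (u : ℝ) / v) :
    ∃ s t : ℤ, IsCoprime s t ∧ t ≠ 0 ∧ c = (s : ℝ) / t ∧ s * v = u * t := by
  have hvr : (v : ℝ) ≠ 0 := by exact_mod_cast hv
  set q : ℚ := (u : ℚ) / v with hq
  have hd : (q.den : ℤ) ≠ 0 := by exact_mod_cast q.den_ne_zero
  have hdr : ((q.den : ℤ) : ℝ) ≠ 0 := by exact_mod_cast hd
  have e1 : c = (q.num : ℝ) / (q.den : ℤ) := by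
    have h1 : (q : ℝ) = c := by rw [h, hq]; push_cast; rfl
    rw [← h1]; exact_mod_cast (congrArg (fun r : ℚ => (r : ℝ)) (Rat.num_div_den q)).symm
  refine ⟨q.num, q.den, Rat.isCoprime_num_den q, hd, e1, ?_⟩
  rw [e1, div_eq_div_iff hdr hvr] at h
  exact_mod_cast h

lemma necessity {p : ℕ} {a : Fin 2 → ℤ} {n1 n2 c : ℝ} {m F : (Fin 2 → ℝ) → ℂ} (h1 : 1 < n1) (h2 : 1 < n2)
    (hs : Sys p a (Rm n1 n2 c) (Tm n1 n2 c) m F) {Λ} (hΛ : Spec F Λ) :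
    ((n1 ≠ n2 ∧ (∃ n : ℤ, (p : ℤ) ∣ n ∧ n1 = (n : ℝ)) ∧
          (∃ q : ℚ, c / (n1 - n2) = (q : ℝ)) ∧ c / (n1 - n2) ∉ Ea p a) ∨
        (n1 ≠ n2 ∧ (∃ n₁ n₂ : ℤ, (p : ℤ) ∣ n₁ ∧ (p : ℤ) ∣ n₂ ∧
            n1 = (n₁ : ℝ) ∧ n2 = (n₂ : ℝ) ∧
            ∃ s t : ℤ, ∃ ℓ : ℕ, ∃ m : ℤ, Int.gcd s t = 1 ∧ t = (p : ℤ) ^ ℓ * m ∧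
              ¬ (p : ℤ) ∣ m ∧ c / (n1 - n2) = (s : ℝ) / (t : ℝ) ∧
              c / (n1 - n2) ∈ Ea p a ∧ (p : ℤ) ^ (ℓ + 1) ∣ (n₁ - n₂))) ∨
        (n1 = n2 ∧ (∃ n : ℤ, (p : ℤ) ∣ n ∧ n1 = (n : ℝ)) ∧
          (c = 0 ∨ ∃ t s : ℤ, (p : ℤ) ∣ t ∧ Int.gcd s t = 1 ∧ c = (t : ℝ) / (s : ℝ)))) := by
  have hp := hs.prime
  have hpp := Nat.prime_iff_prime_int.1 hp
  have hp0 : (p : ℝ) ≠ 0 := by exact_mod_cast hp.ne_zero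
  have he0 : Eig p a (Rm n1 n2 c) (Tm n1 n2 c) ![1, 0] n1 := by
    refine ⟨h1, fun ξ => by simp [lf], ?_⟩
    have := hs.a_nd 0
    simpa using this
  obtain ⟨n, hpn, hn⟩ := hs.eig_int he0 hΛ
  obtain ⟨j, α, β, w, hj, hα, hβ, hw0, hw1, hw⟩ := hs.deep_w he0 hΛ
  have hαn : ¬ (p : ℤ) ∣ α := by
    intro h
    have : (p : ℤ) ∣ j * a 0 := by have := dvd_sub h hα; simpa using this
    rcases hpp.dvd_or_dvd this with h | h
    · exact hj h
    · exact hs.a_nd 0 h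
  have hα0 : α ≠ 0 := by rintro rfl; simp at hαn
  have hαr : (α : ℝ) ≠ 0 := by exact_mod_cast hα0
  -- first coordinates
  have hR0 : ∀ i, ((Rm n1 n2 c) ^ i) w 0 = n1 ^ i * (α / p) := by
    intro i
    induction i with
    | zero => simpa using hw0
    | succ i ih => rw [pow_succ', Module.End.mul_apply, Rm_0, ih]; ring
  -- if n2 is an integer multiple of p then c α / p is an integer
  have hcz : ∀ n' : ℤ, (p : ℤ) ∣ n' → n2 = n' → ∃ z : ℤ, c * α = p * z := by
    rintro _ ⟨k, rfl⟩ e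
    obtain ⟨v, hv⟩ := hw 0 (by norm_num)
    have := hv 1
    rw [zero_add, pow_one, Rm_1, hw0, hw1, e] at this
    refine ⟨v 1 - k * β, ?_⟩
    push_cast at this ⊢
    field_simp at this
    linarith
  by_cases h12 : n1 = n2
  · right; right
    refine ⟨h12, ⟨n, hpn, hn⟩, Or.inr ?_⟩
    obtain ⟨z, hz⟩ := hcz n hpn (h12 ▸ hn)
    have hc : c = ((p * z : ℤ) : ℝ) / α := by
      rw [eq_div_iff hαr]; push_cast; exact hz
    obtain ⟨s, t, hst, ht0, e, e2⟩ := rat_reduce hα0 hc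
    refine ⟨s, t, ?_, Int.isCoprime_iff_gcd_eq_one.1 hst.symm, e⟩
    have : (p : ℤ) ∣ s * α := ⟨z * t, by rw [e2]; ring⟩
    exact (hpp.dvd_or_dvd this).resolve_right hαn
  -- n1 ≠ n2
  have hsub : n1 - n2 ≠ 0 := sub_ne_zero.2 h12
  set c2 := c / (n1 - n2) with hc2
  have hcc : c = c2 * (n1 - n2) := by rw [hc2]; field_simp
  have hinv : ∀ i, ((Rm n1 n2 c) ^ i) w 1 - c2 * ((Rm n1 n2 c) ^ i) w 0 = n2 ^ i * ((β - c2 * α) / p) := by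
    intro i
    induction i with
    | zero => rw [pow_zero, Module.End.one_apply, hw0, hw1]; ring
    | succ i ih =>
      rw [pow_succ', Module.End.mul_apply, Rm_0, Rm_1, pow_succ', mul_assoc, ← ih]
      rw [hcc]; ring
  -- rationality of c2
  have hrat : ∃ u v : ℤ, v ≠ 0 ∧ c2 = (u : ℝ) / v ∧ ((β : ℝ) - c2 * α = 0 ∨ ∃ q : ℚ, n2 = q) := by
    by_cases hκ : (β : ℝ) - c2 * α = 0
    · exact ⟨β, α, hα0, by field_simp; linarith, Or.inl hκ⟩
    obtain ⟨v1, hv1⟩ := hw 0 (by norm_num)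
    obtain ⟨v2, hv2⟩ := hw 1 (by norm_num)
    obtain ⟨v3, hv3⟩ := hw 2 (by norm_num)
    have e1 := hinv 1
    have e2 := hinv 2
    have e3 := hinv 3
    rw [hR0] at e1 e2 e3
    have g1 := hv1 1
    have g2 := hv2 1
    have g3 := hv3 1
    norm_num only at g1 g2 g3
    rw [g1] at e1
    rw [g2] at e2
    rw [g3] at e3
    set κ := ((β : ℝ) - c2 * α) / p with hκd
    have hκ0 : κ ≠ 0 := div_ne_zero hκ hp0
    have f1 : (v2 1 : ℝ) - n * v1 1 = n2 * (n2 - n1) * κ := by rw [← hn]; linear_combination e2 - n1 * e1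
    have f2 : (v3 1 : ℝ) - n * v2 1 = n2 * (n2 * (n2 - n1) * κ) := by rw [← hn]; linear_combination e3 - n1 * e2
    have f10 : (v2 1 : ℝ) - n * v1 1 ≠ 0 := by
      rw [f1]
      exact mul_ne_zero (mul_ne_zero (by linarith) (fun h => hsub (by linarith))) hκ0
    have hq : n2 = (((v3 1 : ℚ) - n * v2 1) / ((v2 1 : ℚ) - n * v1 1) : ℚ) := by
      push_cast
      rw [eq_div_iff f10, f2, ← f1]
    set q : ℚ := ((v3 1 : ℚ) - n * v2 1) / ((v2 1 : ℚ) - n * v1 1) with hqd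
    have hw11 : (v1 1 : ℝ) = c * (α / p) + n2 * (β / p) := by
      rw [← g1, pow_one, Rm_1, hw0, hw1]
    have hc2q : c2 = ((((v1 1 : ℚ) - q * (β / p)) * p / α / (n - q) : ℚ) : ℝ) := by
      push_cast
      rw [← hq, ← hn, hc2, hw11]
      field_simp
      ring
    set r : ℚ := ((v1 1 : ℚ) - q * (β / p)) * p / α / (n - q)
    refine ⟨r.num, r.den, by exact_mod_cast r.den_ne_zero, ?_, Or.inr ⟨q, hq⟩⟩
    rw [hc2q]
    exact_mod_cast (congrArg (fun r : ℚ => (r : ℝ)) (Rat.num_div_den r)).symm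
  obtain ⟨u, v, hv, huv, hor⟩ := hrat
  obtain ⟨s, t, hst, ht0, e, -⟩ := rat_reduce hv huv
  have htr : (t : ℝ) ≠ 0 := by exact_mod_cast ht0
  by_cases hd : (p : ℤ) ∣ t * a 1 - s * a 0
  · left
    refine ⟨h12, ⟨n, hpn, hn⟩, ⟨(s : ℚ) / t, by rw [e]; push_cast; rfl⟩, ?_⟩
    rw [e]
    refine notEa_of hst ht0 ?_ hd
    rintro rfl
    rw [zero_mul, sub_zero] at hd
    rcases hpp.dvd_or_dvd hd with h | h
    · have := hst.isUnit_of_dvd' (dvd_zero _) h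
      exact hpp.not_isUnit this
    · exact hs.a_nd 1 h
  · right; left
    have htc : (t : ℝ) * c = s * (n1 - n2) := by
      rw [hcc, e]; field_simp
    have he1 : Eig p a (Rm n1 n2 c) (Tm n1 n2 c) ![-s, t] n2 := by
      refine ⟨h2, fun ξ => ?_, ?_⟩
      · simp [lf]; linear_combination (ξ 0) * htc
      · intro h; apply hd; convert h using 1; simp; ring
    obtain ⟨n', hpn', hn'⟩ := hs.eig_int he1 hΛ
    obtain ⟨z, hz⟩ := hcz n' hpn' hn'
    obtain ⟨ℓ, m', hm', htm⟩ : ∃ (ℓ : ℕ) (m' : ℤ), ¬ (p : ℤ) ∣ m' ∧ t = (p : ℤ) ^ ℓ * m' := by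
      have hfm : FiniteMultiplicity (p : ℤ) t :=
        Int.finiteMultiplicity_iff.2 ⟨by simpa using hp.one_lt.ne', ht0⟩
      obtain ⟨m', h1, h2⟩ := hfm.exists_eq_pow_mul_and_not_dvd
      exact ⟨_, m', h2, h1⟩
    refine ⟨h12, n, n', hpn, hpn', hn, hn', s, t, ℓ, m', Int.isCoprime_iff_gcd_eq_one.1 hst, htm, hm', e,
      Or.inl ⟨s, t, Int.isCoprime_iff_gcd_eq_one.1 hst, hd, e⟩, ?_⟩
    rcases Nat.eq_zero_or_pos ℓ with h0 | hpos
    · subst h0; simpa using dvd_sub hpn hpn'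
    have hps : ¬ (p : ℤ) ∣ s := by
      intro h
      have hpt : (p : ℤ) ∣ t := by rw [htm]; exact Dvd.dvd.mul_right (dvd_pow_self _ hpos.ne') _
      exact hpp.not_isUnit (hst.isUnit_of_dvd' h hpt)
    have heq : (s * α) * (n - n') = p ^ (ℓ + 1) * (m' * z) := by
      have : ((s : ℝ) * α) * (n - n') = p ^ (ℓ + 1) * (m' * z) := by
        rw [hn, hn'] at htc
        have htm' : (t : ℝ) = p ^ ℓ * m' := by exact_mod_cast congrArg (fun r : ℤ => (r : ℝ)) htm
        rw [htm'] at htc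
        linear_combination (-α : ℝ) * htc + (p : ℝ) ^ ℓ * m' * hz
      exact_mod_cast this
    have hcop : IsCoprime ((p : ℤ) ^ (ℓ + 1)) (s * α) := by
      apply IsCoprime.pow_left
      rw [hpp.coprime_iff_not_dvd]
      intro h
      rcases hpp.dvd_or_dvd h with h | h
      · exact hps h
      · exact hαn h
    exact hcop.dvd_of_dvd_mul_left ⟨_, heq⟩

/-- tight families for the partial products -/
def Good (m : (Fin 2 → ℝ) → ℂ) (T : Module.End ℝ (Fin 2 → ℝ)) (N : ℕ) {ι : Type} [Fintype ι]
    (f : ι → (Fin 2 → ℝ)) : Prop :=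
  ∀ ξ, ∑ i, ‖Fk m T N (ξ - f i)‖ ^ 2 = 1

lemma Fk_zero' (m : (Fin 2 → ℝ) → ℂ) (T : Module.End ℝ (Fin 2 → ℝ)) (ξ) : Fk m T 0 ξ = 1 := by
  simp [Fk]

lemma Fk_one' (m : (Fin 2 → ℝ) → ℂ) (T : Module.End ℝ (Fin 2 → ℝ)) (ξ) : Fk m T 1 ξ = m (T ξ) := by
  simp [Fk]

/-- the data needed to build a spectrum -/
structure Build (p : ℕ) (a : Fin 2 → ℤ) (R T : Module.End ℝ (Fin 2 → ℝ)) (m F : (Fin 2 → ℝ) → ℂ)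
    (Γ : AddSubgroup (Fin 2 → ℝ)) (v : Fin 2 → ℝ) (W : Submodule ℝ (Fin 2 → ℝ)) : Prop where
  sys : Sys p a R T m F
  sub : ∀ g ∈ Γ, g ∈ intLat
  RΓ : ∀ g ∈ Γ, R g ∈ Γ
  Rv : R v ∈ Γ
  pars : ∀ y, ∑ j : Fin p, ‖m (y - ((j : ℕ) : ℝ) • v)‖ ^ 2 = 1
  vW : v ∈ W
  TW : ∀ x ∈ W, T x ∈ W
  nz : ∀ x ∈ W, ∃ g ∈ Γ, F (x + g) ≠ 0

namespace Build
variable {p : ℕ} {a : Fin 2 → ℤ} {R T : Module.End ℝ (Fin 2 → ℝ)} {m F : (Fin 2 → ℝ) → ℂ}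
  {Γ : AddSubgroup (Fin 2 → ℝ)} {v : Fin 2 → ℝ} {W : Submodule ℝ (Fin 2 → ℝ)}

lemma Rpow (hb : Build p a R T m F Γ v W) (k : ℕ) {g} (hg : g ∈ Γ) : (R ^ k) g ∈ Γ := by
  induction k with
  | zero => simpa using hg
  | succ k ih => rw [pow_succ', Module.End.mul_apply]; exact hb.RΓ _ ih

lemma Tpow (hb : Build p a R T m F Γ v W) (k : ℕ) {x} (hx : x ∈ W) : (T ^ k) x ∈ W := by
  induction k with
  | zero => simpa using hx
  | succ k ih => rw [pow_succ', Module.End.mul_apply]; exact hb.TW _ ih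

lemma Fk_per (hb : Build p a R T m F Γ v W) (N : ℕ) (y) {g} (hg : g ∈ Γ) :
    Fk m T N (y - (R ^ N) g) = Fk m T N y := by
  unfold Fk
  refine Finset.prod_congr rfl fun i hi => ?_
  rw [Finset.mem_range] at hi
  have e : (T ^ (i + 1)) ((R ^ N) g) = (R ^ (N - (i + 1))) g := by
    have e2 : (R ^ N) g = (R ^ (i + 1)) ((R ^ (N - (i + 1))) g) := by
      rw [← Module.End.mul_apply, ← pow_add]; congr 2; omega
    rw [e2, hb.sys.TRk]
  rw [map_sub, e, hb.sys.m_per_sub _ (hb.sub _ (hb.Rpow _ hg))]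

lemma comp (hb : Build p a R T m F Γ v W) {N s : ℕ} {ι κ : Type} [Fintype ι] [Fintype κ]
    {f : ι → (Fin 2 → ℝ)} {g : κ → (Fin 2 → ℝ)} (hf : Good m T N f) (hg : Good m T s g)
    (hgΓ : ∀ k, g k ∈ Γ) : Good m T (N + s) (fun q : ι × κ => f q.1 + (R ^ N) (g q.2)) := by
  intro ξ
  rw [Fintype.sum_prod_type, ← hf ξ]
  refine Finset.sum_congr rfl fun i _ => ?_
  have h1 : ∀ k, ‖Fk m T (N + s) (ξ - (f i + (R ^ N) (g k)))‖ ^ 2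
      = ‖Fk m T N (ξ - f i)‖ ^ 2 * ‖Fk m T s ((T ^ N) (ξ - f i) - g k)‖ ^ 2 := by
    intro k
    rw [← sub_sub, Fk_add, hb.Fk_per N _ (hgΓ k), map_sub, hb.sys.TRk, norm_mul, mul_pow]
  simp only [h1]
  rw [← Finset.mul_sum, hg, mul_one]

lemma good_inj (hb : Build p a R T m F Γ v W) {N : ℕ} {ι : Type} [Fintype ι]
    {f : ι → (Fin 2 → ℝ)} (hf : Good m T N f) {i j : ι} (hij : i ≠ j) : Fk m T N (f i - f j) = 0 := by
  classical
  have h := hf (f i)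
  rw [← Finset.add_sum_erase _ _ (Finset.mem_univ i), sub_self, (hb.sys.cfFk N).zero] at h
  have h2 : ∑ x ∈ Finset.univ.erase i, ‖Fk m T N (f i - f x)‖ ^ 2 = 0 := by simpa using h
  rw [Finset.sum_eq_zero_iff_of_nonneg (fun _ _ => by positivity)] at h2
  have := h2 j (Finset.mem_erase.2 ⟨hij.symm, Finset.mem_univ _⟩)
  simpa using this

lemma canon (hb : Build p a R T m F Γ v W) : ∃ B : ℝ, ∀ s : ℕ, ∃ (κ : Type) (_ : Fintype κ)
    (g : κ → (Fin 2 → ℝ)) (k0 : κ), Good m T s g ∧ (∀ k, g k ∈ Γ) ∧ g k0 = 0 ∧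
      ∀ k, (T ^ s) (g k) ∈ W ∧ ‖(T ^ s) (g k)‖ ≤ B := by
  obtain ⟨r, C, hr0, hr1, hC, hcon⟩ := hb.sys.contr
  have hppos := hb.sys.prime.pos
  refine ⟨C * p * ‖v‖ * (1 - r)⁻¹, ?_⟩
  suffices H : ∀ s : ℕ, ∃ (κ : Type) (_ : Fintype κ)
    (g : κ → (Fin 2 → ℝ)) (k0 : κ), Good m T s g ∧ (∀ k, g k ∈ Γ) ∧ g k0 = 0 ∧
      ∀ k, (T ^ s) (g k) ∈ W ∧ ‖(T ^ s) (g k)‖ ≤ C * p * ‖v‖ * ∑ i ∈ Finset.range s, r ^ i by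
    intro s
    obtain ⟨κ, hκ, g, k0, h1, h2, h3, h4⟩ := H s
    refine ⟨κ, hκ, g, k0, h1, h2, h3, fun k => ⟨(h4 k).1, (h4 k).2.trans ?_⟩⟩
    refine mul_le_mul_of_nonneg_left ?_ (by positivity)
    rw [← tsum_geometric_of_lt_one hr0 hr1]
    exact (summable_geometric_of_lt_one hr0 hr1).sum_le_tsum _ (fun _ _ => by positivity)
  intro s
  induction s with
  | zero =>
    refine ⟨Unit, inferInstance, fun _ => 0, (), ?_, fun _ => Γ.zero_mem, rfl, fun _ => ?_⟩
    · intro ξ; simp [Fk_zero']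
    · simp [W.zero_mem]
  | succ s ih =>
    obtain ⟨κ, hκ, g, k0, h1, h2, h3, h4⟩ := ih
    have hG1 : Good m T 1 (fun j : Fin p => R (((j : ℕ) : ℝ) • v)) := by
      intro ξ
      simp only [Fk_one', map_sub, hb.sys.TR]
      exact hb.pars _
    have h5 := hb.comp hG1 h1 h2
    rw [add_comm] at h5
    refine ⟨Fin p × κ, inferInstance, _, (⟨0, hppos⟩, k0), h5, ?_, ?_, ?_⟩
    · rintro ⟨j, k⟩
      refine Γ.add_mem ?_ (by rw [pow_one]; exact hb.RΓ _ (h2 k))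
      show R _ ∈ Γ
      rw [map_smul, Nat.cast_smul_eq_nsmul]
      exact Γ.nsmul_mem hb.Rv _
    · simp [h3]
    · rintro ⟨j, k⟩
      have e : (T ^ (s + 1)) (R (((j : ℕ) : ℝ) • v) + (R ^ 1) (g k))
          = ((j : ℕ) : ℝ) • (T ^ s) v + (T ^ s) (g k) := by
        rw [map_add, pow_one, hb.sys.Tk_R, hb.sys.Tk_R, map_smul]
      simp only [e]
      refine ⟨W.add_mem (W.smul_mem _ (hb.Tpow s hb.vW)) (h4 k).1, ?_⟩
      refine (norm_add_le _ _).trans ?_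
      rw [Finset.sum_range_succ, mul_add, add_comm]
      refine add_le_add (h4 k).2 ?_
      rw [norm_smul]
      have hj : ‖((j : ℕ) : ℝ)‖ ≤ p := by
        rw [Real.norm_natCast]; exact_mod_cast j.2.le
      calc _ ≤ (p : ℝ) * (C * r ^ s * ‖v‖) :=
            mul_le_mul hj (hcon s v) (norm_nonneg _) (by positivity)
        _ = _ := by ring

lemma compactness (hb : Build p a R T m F Γ v W) (B : ℝ) : ∃ ε δ : ℝ, 0 < ε ∧ 0 < δ ∧
    ∀ x ∈ W, ‖x‖ ≤ B → ∃ γ ∈ Γ, ∀ y, ‖y‖ < δ → ε ≤ ‖F (y - (x + γ))‖ := by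
  have hK : IsCompact {x | x ∈ W ∧ ‖x‖ ≤ B} := by
    have h1 : IsCompact (Metric.closedBall (0 : Fin 2 → ℝ) B) := isCompact_closedBall _ _
    have h2 : IsClosed (W : Set (Fin 2 → ℝ)) := W.closed_of_finiteDimensional
    convert h1.inter_left h2 using 1
    ext x; simp
  suffices H : ∃ ε δ : ℝ, 0 < ε ∧ 0 < δ ∧
    ∀ x ∈ {x | x ∈ W ∧ ‖x‖ ≤ B}, ∃ γ ∈ Γ, ∀ y, ‖y‖ < δ → ε ≤ ‖F (y - (x + γ))‖ by
    obtain ⟨ε, δ, h1, h2, h3⟩ := H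
    exact ⟨ε, δ, h1, h2, fun x hx hx2 => h3 x ⟨hx, hx2⟩⟩
  refine hK.induction_on (p := fun s => ∃ ε δ : ℝ, 0 < ε ∧ 0 < δ ∧
    ∀ x ∈ s, ∃ γ ∈ Γ, ∀ y, ‖y‖ < δ → ε ≤ ‖F (y - (x + γ))‖) ?_ ?_ ?_ ?_
  · exact ⟨1, 1, one_pos, one_pos, by simp⟩
  · rintro s t hst ⟨ε, δ, h1, h2, h3⟩
    exact ⟨ε, δ, h1, h2, fun x hx => h3 x (hst hx)⟩
  · rintro s t ⟨ε, δ, h1, h2, h3⟩ ⟨ε', δ', h1', h2', h3'⟩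
    refine ⟨min ε ε', min δ δ', lt_min h1 h1', lt_min h2 h2', ?_⟩
    rintro x (hx | hx)
    · obtain ⟨γ, hγ, h⟩ := h3 x hx
      exact ⟨γ, hγ, fun y hy => (min_le_left _ _).trans (h y (hy.trans_le (min_le_left _ _)))⟩
    · obtain ⟨γ, hγ, h⟩ := h3' x hx
      exact ⟨γ, hγ, fun y hy => (min_le_right _ _).trans (h y (hy.trans_le (min_le_right _ _)))⟩
  · rintro x ⟨hx, -⟩
    obtain ⟨g, hg, hne⟩ := hb.nz (-x) (W.neg_mem hx)
    have hpos : 0 < ‖F (-x + g)‖ := norm_pos_iff.2 hne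
    have hcont : ContinuousAt (fun z => ‖F z‖) (-x + g) :=
      hb.sys.cfF.continuous.norm.continuousAt
    obtain ⟨δ, hδ, hδ2⟩ := Metric.eventually_nhds_iff.1
      (hcont.eventually_const_lt (show ‖F (-x + g)‖ / 2 < ‖F (-x + g)‖ by linarith))
    refine ⟨Metric.ball x (δ / 2), mem_nhdsWithin_of_mem_nhds (Metric.ball_mem_nhds _ (by positivity)),
      ‖F (-x + g)‖ / 2, δ / 2, by positivity, by positivity, ?_⟩
    intro x' hx'
    refine ⟨-g, Γ.neg_mem hg, fun y hy => (hδ2 ?_).le⟩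
    rw [dist_eq_norm]
    have e : y - (x' + -g) - (-x + g) = y - (x' - x) := by abel
    rw [e]
    rw [Metric.mem_ball, dist_eq_norm] at hx'
    have := norm_sub_le y (x' - x)
    linarith

lemma step (hb : Build p a R T m F Γ v W) {B ε δ : ℝ} (hε : 0 < ε) (hδ : 0 < δ)
    (hcan : ∀ s : ℕ, ∃ (κ : Type) (_ : Fintype κ)
    (g : κ → (Fin 2 → ℝ)) (k0 : κ), Good m T s g ∧ (∀ k, g k ∈ Γ) ∧ g k0 = 0 ∧
      ∀ k, (T ^ s) (g k) ∈ W ∧ ‖(T ^ s) (g k)‖ ≤ B)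
    (h0 : ∀ y, ‖y‖ < δ → ε ≤ ‖F y‖)
    (hcomp : ∀ x ∈ W, ‖x‖ ≤ B → ∃ γ ∈ Γ, ∀ y, ‖y‖ < δ → ε ≤ ‖F (y - (x + γ))‖)
    {N : ℕ} {S : Finset (Fin 2 → ℝ)} (hS : ∀ ξ, ∑ x ∈ S, ‖Fk m T N (ξ - x)‖ ^ 2 = 1) :
    ∃ (N' : ℕ) (S' : Finset (Fin 2 → ℝ)), N < N' ∧ S ⊆ S' ∧
      (∀ ξ, ∑ x ∈ S', ‖Fk m T N' (ξ - x)‖ ^ 2 = 1) ∧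
      ∀ x ∈ S', ∀ y, ‖y‖ < δ / 2 → ε ≤ ‖F (y - (T ^ N') x)‖ := by
  classical
  obtain ⟨s, hs1, hsmall⟩ : ∃ s, 1 ≤ s ∧ ∀ x ∈ S, ‖(T ^ (N + s)) x‖ < δ / 2 := by
    have h1 : ∀ x ∈ S, ∀ᶠ k in Filter.atTop, ‖(T ^ k) x‖ < δ / 2 := by
      intro x _
      have := (hb.sys.tend x).norm
      rw [norm_zero] at this
      exact this.eventually_lt_const (by positivity)
    have h2 := (Filter.eventually_all_finset S).2 h1
    obtain ⟨k, hk⟩ := Filter.eventually_atTop.1 h2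
    exact ⟨k + 1, by omega, fun x hx => hk (N + (k + 1)) (by omega) x hx⟩
  obtain ⟨κ, hκ, g, k0, hg1, hg2, hg3, hg4⟩ := hcan s
  choose γ hγ hγ2 using fun k => hcomp _ (hg4 k).1 (hg4 k).2
  set γ' : κ → (Fin 2 → ℝ) := fun k => if k = k0 then 0 else γ k with hγ'
  have hγ'Γ : ∀ k, γ' k ∈ Γ := by
    intro k; simp only [hγ']; split_ifs
    · exact Γ.zero_mem
    · exact hγ k
  have hγ'2 : ∀ k y, ‖y‖ < δ → ε ≤ ‖F (y - ((T ^ s) (g k) + γ' k))‖ := by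
    intro k y hy
    simp only [hγ']; split_ifs with h
    · subst h; simp only [hg3, map_zero, add_zero, sub_zero]; exact h0 y hy
    · exact hγ2 k y hy
  set g' : κ → (Fin 2 → ℝ) := fun k => g k + (R ^ s) (γ' k) with hg'
  have hGg' : Good m T s g' := by
    intro ξ
    rw [← hg1 ξ]
    refine Finset.sum_congr rfl fun k _ => ?_
    simp only [hg']
    rw [← sub_sub, hb.Fk_per s _ (hγ'Γ k)]
  have hGS : Good m T N (fun x : S => (x : Fin 2 → ℝ)) := by
    intro ξ
    rw [← hS ξ, ← Finset.sum_coe_sort S]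
  have hG := hb.comp hGS hGg' (fun k => Γ.add_mem (hg2 k) (hb.Rpow s (hγ'Γ k)))
  set f : S × κ → (Fin 2 → ℝ) := fun q => (q.1 : Fin 2 → ℝ) + (R ^ N) (g' q.2) with hf
  have hinj : Function.Injective f := by
    intro i j hij
    by_contra hne
    have := hb.good_inj hG hne
    rw [hij, sub_self, (hb.sys.cfFk _).zero] at this
    exact one_ne_zero this
  refine ⟨N + s, Finset.univ.image f, by omega, ?_, ?_, ?_⟩
  · intro x hx
    refine Finset.mem_image.2 ⟨(⟨x, hx⟩, k0), Finset.mem_univ _, ?_⟩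
    simp [hf, hg', hγ', hg3]
  · intro ξ
    rw [Finset.sum_image (fun _ _ _ _ h => hinj h)]
    exact hG ξ
  · intro x hx y hy
    obtain ⟨⟨⟨x, hxS⟩, k⟩, -, rfl⟩ := Finset.mem_image.1 hx
    have e : y - (T ^ (N + s)) (f (⟨x, hxS⟩, k)) = (y - (T ^ (N + s)) x) - ((T ^ s) (g k) + γ' k) := by
      have e1 : (T ^ (N + s)) ((R ^ N) (g' k)) = (T ^ s) (g k) + γ' k := by
        rw [add_comm N s, pow_add, Module.End.mul_apply, hb.sys.TRk]
        simp only [hg', map_add, hb.sys.TRk]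
      simp only [hf, map_add, e1]; abel
    rw [e]
    apply hγ'2
    have := norm_sub_le y ((T ^ (N + s)) x)
    have := hsmall x hxS
    linarith

theorem exists_spec (hb : Build p a R T m F Γ v W) : ∃ Λ : Set (Fin 2 → ℝ), Λ.Countable ∧ Spec F Λ := by
  classical
  obtain ⟨B, hcan⟩ := hb.canon
  obtain ⟨ε1, δ1, hε1, hδ1, hcomp⟩ := hb.compactness B
  have hF0 : ∃ δ > 0, ∀ y, ‖y‖ < δ → 1 / 2 ≤ ‖F y‖ := by
    have hcont : ContinuousAt (fun z => ‖F z‖) 0 := hb.sys.cfF.continuous.norm.continuousAt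
    have h00 : ‖F 0‖ = 1 := by rw [hb.sys.cfF.zero, norm_one]
    obtain ⟨δ, hδ, h⟩ := Metric.eventually_nhds_iff.1
      (hcont.eventually_const_lt (show (1 / 2 : ℝ) < ‖F 0‖ by rw [h00]; norm_num))
    exact ⟨δ, hδ, fun y hy => (h (by simpa using hy)).le⟩
  obtain ⟨δ0, hδ0, h0⟩ := hF0
  set ε := min ε1 (1 / 2) with hεd
  set δ := min δ1 δ0 with hδd
  have hε : 0 < ε := lt_min hε1 (by norm_num)
  have hδ : 0 < δ := lt_min hδ1 hδ0
  have hcomp' : ∀ x ∈ W, ‖x‖ ≤ B → ∃ γ ∈ Γ, ∀ y, ‖y‖ < δ → ε ≤ ‖F (y - (x + γ))‖ := by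
    intro x hx hx2
    obtain ⟨γ, hγ, h⟩ := hcomp x hx hx2
    exact ⟨γ, hγ, fun y hy => (min_le_left _ _).trans (h y (hy.trans_le (min_le_left _ _)))⟩
  have h0' : ∀ y, ‖y‖ < δ → ε ≤ ‖F y‖ :=
    fun y hy => (min_le_right _ _).trans (h0 y (hy.trans_le (min_le_right _ _)))
  -- the sequence
  let St := {q : ℕ × Finset (Fin 2 → ℝ) // (∀ ξ, ∑ x ∈ q.2, ‖Fk m T q.1 (ξ - x)‖ ^ 2 = 1) ∧
      ∀ x ∈ q.2, ∀ y, ‖y‖ < δ / 2 → ε ≤ ‖F (y - (T ^ q.1) x)‖}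
  have hstep : ∀ q : St, ∃ q' : St, q.1.1 < q'.1.1 ∧ q.1.2 ⊆ q'.1.2 := by
    rintro ⟨⟨N, S⟩, h1, h2⟩
    obtain ⟨N', S', g1, g2, g3, g4⟩ := hb.step hε hδ hcan h0' hcomp' h1
    exact ⟨⟨(N', S'), g3, g4⟩, g1, g2⟩
  choose nx hnx1 hnx2 using hstep
  let q0 : St := ⟨(0, {0}), by intro ξ; simp [Fk_zero'], by
    intro x hx y hy
    rw [Finset.mem_singleton] at hx
    subst hx
    simp only [map_zero, sub_zero]
    exact h0' y (by linarith)⟩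
  let sq : ℕ → St := fun n => nx^[n] q0
  have hsq : ∀ n, sq (n + 1) = nx (sq n) := fun n => Function.iterate_succ_apply' _ _ _
  set Nn : ℕ → ℕ := fun n => (sq n).1.1 with hNn
  set Sn : ℕ → Finset (Fin 2 → ℝ) := fun n => (sq n).1.2 with hSn
  have hNmono : StrictMono Nn := strictMono_nat_of_lt_succ fun n => by
    simp only [hNn, hsq]; exact hnx1 _
  have hSmono : Monotone Sn := monotone_nat_of_le_succ fun n => by
    simp only [hSn, hsq]; exact hnx2 _
  have hP1 : ∀ n ξ, ∑ x ∈ Sn n, ‖Fk m T (Nn n) (ξ - x)‖ ^ 2 = 1 := fun n => (sq n).2.1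
  have hP2 : ∀ n, ∀ x ∈ Sn n, ∀ y, ‖y‖ < δ / 2 → ε ≤ ‖F (y - (T ^ (Nn n)) x)‖ := fun n => (sq n).2.2
  have hNtend : Filter.Tendsto Nn Filter.atTop Filter.atTop := hNmono.tendsto_atTop
  have hOrth : Orth F (⋃ n, (Sn n : Set (Fin 2 → ℝ))) := by
    intro x hx x' hx' hne
    obtain ⟨i, hi⟩ := Set.mem_iUnion.1 hx
    obtain ⟨j, hj⟩ := Set.mem_iUnion.1 hx'
    have hi' : x ∈ Sn (max i j) := hSmono (le_max_left i j) hi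
    have hj' : x' ∈ Sn (max i j) := hSmono (le_max_right i j) hj
    have hG : Good m T (Nn (max i j)) (fun x : Sn (max i j) => (x : Fin 2 → ℝ)) := by
      intro ξ
      rw [← hP1 _ ξ, ← Finset.sum_coe_sort (Sn (max i j))]
    have := hb.good_inj hG (i := ⟨x, hi'⟩) (j := ⟨x', hj'⟩) (fun h => hne (congrArg Subtype.val h))
    rw [hb.sys.F_eq (Nn (max i j)), this, zero_mul]
  refine ⟨_, Set.countable_iUnion fun n => (Sn n).countable_toSet, hOrth, ?_⟩
  intro ξ η hη
  set A : ℕ → ℝ := fun n => ∑ x ∈ Sn n, ‖F (ξ - x)‖ ^ 2 with hA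
  have hAmono : Monotone A := fun i j hij =>
    Finset.sum_le_sum_of_subset_of_nonneg (hSmono hij) (fun _ _ _ => by positivity)
  have hA1 : ∀ n, A n ≤ 1 := fun n =>
    hb.sys.cfF.bessel (hOrth.mono (Set.subset_iUnion (fun n => (Sn n : Set (Fin 2 → ℝ))) n)) ξ
  have hAbdd : BddAbove (Set.range A) := ⟨1, by rintro _ ⟨n, rfl⟩; exact hA1 n⟩
  set σ := ⨆ n, A n with hσ
  have hAσ : Filter.Tendsto A Filter.atTop (nhds σ) := tendsto_atTop_ciSup hAmono hAbdd
  have hAle : ∀ n, A n ≤ σ := fun n => le_ciSup hAbdd n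
  have hFN : ∀ y, Filter.Tendsto (fun n => Fk m T (Nn n) y) Filter.atTop (nhds (F y)) := by
    intro y
    rw [tendsto_iff_norm_sub_tendsto_zero]
    have h1 : Filter.Tendsto (fun n => ‖1 - F ((T ^ (Nn n)) y)‖) Filter.atTop (nhds 0) := by
      have h2 := (hb.sys.cfF.continuous.tendsto 0).comp ((hb.sys.tend y).comp hNtend)
      rw [hb.sys.cfF.zero] at h2
      have := (h2.const_sub 1).norm
      simpa using this
    refine squeeze_zero (fun _ => norm_nonneg _) (fun n => ?_) h1
    rw [hb.sys.F_eq (Nn n) y]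
    have e : Fk m T (Nn n) y - Fk m T (Nn n) y * F ((T ^ (Nn n)) y)
      = Fk m T (Nn n) y * (1 - F ((T ^ (Nn n)) y)) := by ring
    rw [e, norm_mul]
    exact mul_le_of_le_one_left (norm_nonneg _) ((hb.sys.cfFk _).norm_le _)
  obtain ⟨n0, hn0⟩ : ∃ n0, ∀ n ≥ n0, ‖(T ^ (Nn n)) ξ‖ < δ / 2 := by
    have := ((hb.sys.tend ξ).comp hNtend).norm
    rw [norm_zero] at this
    exact Filter.eventually_atTop.1 (this.eventually_lt_const (by positivity))
  have key : ∀ n, 1 ≤ A n + (ε ^ 2)⁻¹ * (σ - A n) := by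
    intro n
    have hlim : Filter.Tendsto (fun k => ∑ x ∈ Sn n, ‖Fk m T (Nn k) (ξ - x)‖ ^ 2 + (ε ^ 2)⁻¹ * (σ - A n))
        Filter.atTop (nhds (A n + (ε ^ 2)⁻¹ * (σ - A n))) := by
      refine Filter.Tendsto.add_const _ ?_
      exact tendsto_finsetSum _ fun x _ => ((hFN (ξ - x)).norm.pow 2)
    refine ge_of_tendsto hlim ?_
    filter_upwards [Filter.eventually_ge_atTop (max n n0)] with k hk
    have hnk : Sn n ⊆ Sn k := hSmono ((le_max_left _ _).trans hk)
    rw [← hP1 k ξ, ← Finset.sum_sdiff hnk, add_comm]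
    have h3 : ∑ x ∈ Sn k \ Sn n, ‖Fk m T (Nn k) (ξ - x)‖ ^ 2
        ≤ (ε ^ 2)⁻¹ * ∑ x ∈ Sn k \ Sn n, ‖F (ξ - x)‖ ^ 2 := by
      rw [Finset.mul_sum]
      refine Finset.sum_le_sum fun x hx => ?_
      have hxk : x ∈ Sn k := (Finset.mem_sdiff.1 hx).1
      have h4 := hP2 k x hxk _ (hn0 k ((le_max_right _ _).trans hk))
      rw [← map_sub] at h4
      rw [hb.sys.F_eq (Nn k) (ξ - x), norm_mul, mul_pow, inv_mul_eq_div, le_div_iff₀ (by positivity)]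
      exact mul_le_mul_of_nonneg_left (pow_le_pow_left₀ hε.le h4 2) (by positivity)
    have h5 : ∑ x ∈ Sn k \ Sn n, ‖F (ξ - x)‖ ^ 2 ≤ σ - A n := by
      have := Finset.sum_sdiff (f := fun x => ‖F (ξ - x)‖ ^ 2) hnk
      have h6 := hAle k
      simp only [hA] at h6 ⊢
      linarith
    have h7 := mul_le_mul_of_nonneg_left h5 (show 0 ≤ (ε ^ 2)⁻¹ by positivity)
    linarith
  have hσ1 : 1 ≤ σ := by
    have hlim : Filter.Tendsto (fun n => A n + (ε ^ 2)⁻¹ * (σ - A n)) Filter.atTop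
        (nhds (σ + (ε ^ 2)⁻¹ * (σ - σ))) :=
      hAσ.add ((hAσ.const_sub σ).const_mul _)
    rw [sub_self, mul_zero, add_zero] at hlim
    exact ge_of_tendsto hlim (Filter.Eventually.of_forall key)
  obtain ⟨n, hn⟩ := (hAσ.eventually_const_lt (show 1 - η < σ by linarith)).exists
  exact ⟨Sn n, Set.subset_iUnion (fun n => (Sn n : Set (Fin 2 → ℝ))) n, hn⟩

end Build

lemma real_zero_of_ft {μ : Measure (Fin 2 → ℝ)} [IsProbabilityMeasure μ] {g : (Fin 2 → ℝ) → ℝ}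
    (hgm : Measurable g) (hgi : Integrable g μ)
    (h : ∀ ξ, ∫ x, (g x : ℂ) * expChar ξ x ∂μ = 0) : g =ᵐ[μ] 0 := by
  have f1 : IsFiniteMeasure (μ.withDensity fun x => ENNReal.ofReal (g x)) :=
    isFiniteMeasure_withDensity_ofReal hgi.2
  have f2 : IsFiniteMeasure (μ.withDensity fun x => ENNReal.ofReal (-g x)) :=
    isFiniteMeasure_withDensity_ofReal hgi.neg.2
  have key : (μ.withDensity fun x => ENNReal.ofReal (g x))
      = (μ.withDensity fun x => ENNReal.ofReal (-g x)) := by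
    apply Measure.ext_of_charFunDual
    ext L
    rw [charFunDual_apply, charFunDual_apply]
    set ξ : Fin 2 → ℝ := fun i => -(L (Pi.single i 1)) / (2 * Real.pi) with hξ
    have hL : ∀ x, cexp (L x * I) = expChar ξ x := by
      intro x
      have hx : x = x 0 • Pi.single 0 1 + x 1 • Pi.single 1 1 := by
        ext i; fin_cases i <;> simp
      have e : L x = x 0 * L (Pi.single 0 1) + x 1 * L (Pi.single 1 1) := by
        conv_lhs => rw [hx]
        simp
      unfold expChar
      congr 1
      rw [e]
      have hpi : (Real.pi : ℂ) ≠ 0 := by exact_mod_cast Real.pi_ne_zero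
      simp only [hξ]
      push_cast
      field_simp
      ring
    simp only [hL]
    have e1 : ∀ g' : (Fin 2 → ℝ) → ℝ, Measurable g' →
        ∫ x, expChar ξ x ∂(μ.withDensity fun x => ENNReal.ofReal (g' x))
        = ∫ x, ((max (g' x) 0 : ℝ) : ℂ) * expChar ξ x ∂μ := by
      intro g' hg'
      rw [integral_withDensity_eq_integral_toReal_smul (by fun_prop) (by simp)]
      refine integral_congr_ae (Filter.Eventually.of_forall fun x => ?_)
      simp only [ENNReal.toReal_ofReal', Complex.real_smul]
    rw [e1 g hgm, e1 (fun x => -g x) hgm.neg, ← sub_eq_zero]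
    have hintg : ∀ g' : (Fin 2 → ℝ) → ℝ, Integrable g' μ →
        Integrable (fun x => ((max (g' x) 0 : ℝ) : ℂ) * expChar ξ x) μ := by
      intro g' hg'
      refine Integrable.mul_bdd (c := 1) (Integrable.ofReal hg'.pos_part) (expChar_continuous ξ).aestronglyMeasurable
        (Filter.Eventually.of_forall fun x => (expChar_norm ξ x).le)
    rw [← integral_sub (hintg g hgi) (hintg (fun x => -g x) hgi.neg), ← h ξ]
    refine integral_congr_ae (Filter.Eventually.of_forall fun x => ?_)
    simp only
    rw [← sub_mul, ← Complex.ofReal_sub]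
    congr 2
    rcases le_total (g x) 0 with h | h
    · rw [max_eq_right h, max_eq_left (by linarith)]; ring
    · rw [max_eq_left h, max_eq_right (by linarith)]; ring
  have h2 := (withDensity_eq_iff_of_sigmaFinite (by fun_prop) (by fun_prop)).1 key
  filter_upwards [h2] with x hx
  rcases le_total (g x) 0 with h | h
  · rw [ENNReal.ofReal_of_nonpos h] at hx
    have := ENNReal.ofReal_eq_zero.1 hx.symm
    simp; linarith
  · rw [ENNReal.ofReal_of_nonpos (show -g x ≤ 0 by linarith)] at hx
    have := ENNReal.ofReal_eq_zero.1 hx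
    simp; linarith

lemma eL_total {μ : Measure (Fin 2 → ℝ)} [IsProbabilityMeasure μ] (f : Lp ℂ 2 μ)
    (h : ∀ ξ, inner ℂ (eL μ ξ) f = 0) : f = 0 := by
  have hfi : Integrable f μ := (Lp.memLp f).integrable (by norm_num)
  have hfm : Measurable f := (Lp.stronglyMeasurable f).measurable
  have h1 : ∀ ξ, ∫ x, f x * expChar ξ x ∂μ = 0 := by
    intro ξ
    have := h (-ξ)
    rw [L2.inner_def] at this
    rw [← this]
    refine integral_congr_ae ?_
    filter_upwards [(expChar_memLp μ (-ξ)).coeFn_toLp] with x hx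
    change _ = inner ℂ ((expChar_memLp μ (-ξ)).toLp _ x) (f x)
    rw [hx, RCLike.inner_apply, expChar_conj, neg_neg]
  have h2 : ∀ ξ, ∫ x, (starRingEnd ℂ) (f x) * expChar ξ x ∂μ = 0 := by
    intro ξ
    have := congrArg (starRingEnd ℂ) (h1 (-ξ))
    rw [← integral_conj, map_zero] at this
    rw [← this]
    refine integral_congr_ae (Filter.Eventually.of_forall fun x => ?_)
    simp only [map_mul, expChar_conj, neg_neg]
  have hci : Integrable (fun x => (starRingEnd ℂ) (f x)) μ := by
    refine hfi.congr' (by fun_prop) (Filter.Eventually.of_forall fun x => ?_)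
    simp
  have hb : ∀ (q : (Fin 2 → ℝ) → ℂ), Integrable q μ → ∀ ξ, Integrable (fun x => q x * expChar ξ x) μ := by
    intro q hq ξ
    exact Integrable.mul_bdd (c := 1) hq (expChar_continuous ξ).aestronglyMeasurable
        (Filter.Eventually.of_forall fun x => (expChar_norm ξ x).le)
  have r1 : (fun x => (f x).re) =ᵐ[μ] 0 := by
    refine real_zero_of_ft (by fun_prop) hfi.re fun ξ => ?_
    have e : ∀ x, (((f x).re : ℝ) : ℂ) * expChar ξ x
        = (1 / 2 : ℂ) * (f x * expChar ξ x + (starRingEnd ℂ) (f x) * expChar ξ x) := by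
      intro x; rw [Complex.re_eq_add_conj]; ring
    simp only [e]
    rw [integral_const_mul, integral_add (hb _ hfi ξ) (hb _ hci ξ), h1, h2]; simp
  have r2 : (fun x => (f x).im) =ᵐ[μ] 0 := by
    refine real_zero_of_ft (by fun_prop) hfi.im fun ξ => ?_
    have e : ∀ x, (((f x).im : ℝ) : ℂ) * expChar ξ x
        = (1 / (2 * I) : ℂ) * (f x * expChar ξ x - (starRingEnd ℂ) (f x) * expChar ξ x) := by
      intro x; rw [Complex.im_eq_sub_conj]; ring
    simp only [e]
    rw [integral_const_mul, integral_sub (hb _ hfi ξ) (hb _ hci ξ), h1, h2]; simp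
  rw [Lp.eq_zero_iff_ae_eq_zero]
  filter_upwards [r1, r2] with x hx1 hx2
  exact Complex.ext hx1 hx2

lemma isSpectral_of_spec {μ : Measure (Fin 2 → ℝ)} [IsProbabilityMeasure μ] {Λ : Set (Fin 2 → ℝ)}
    (hc : Λ.Countable) (hS : Spec (ftMeasure μ) Λ) : IsSpectral μ := by
  have ho := orthonormal_eL μ hS.1
  have hsp : (Submodule.span ℂ (Set.range (fun l : Λ => eL μ l)))ᗮ = ⊥ := by
    rw [Submodule.eq_bot_iff]
    intro f hf
    have hf' : ∀ l ∈ Λ, inner ℂ (eL μ l) f = 0 := fun l hl =>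
      (Submodule.mem_orthogonal _ _).1 hf _ (Submodule.subset_span ⟨⟨l, hl⟩, rfl⟩)
    apply eL_total
    intro ξ
    have hle : ∀ t : ℂ, 1 ≤ ‖eL μ ξ - t • f‖ ^ 2 := by
      intro t
      refine le_of_forall_pos_lt_add fun ε hε => ?_
      obtain ⟨S, hSΛ, hS2⟩ := hS.2 ξ ε hε
      have := bessel_L2 μ (hS.1.mono hSΛ) (eL μ ξ - t • f)
      have e : ∑ l ∈ S, ‖inner ℂ (eL μ l) (eL μ ξ - t • f)‖ ^ 2 = ∑ l ∈ S, ‖ftMeasure μ (ξ - l)‖ ^ 2 := by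
        refine Finset.sum_congr rfl fun l hl => ?_
        rw [inner_sub_right, inner_smul_right, hf' l (hSΛ hl), mul_zero, sub_zero, eL_inner]
      rw [e] at this
      linarith
    set z := inner ℂ f (eL μ ξ) with hz
    have hz0 : z = 0 := by
      have h1 := hle (((1 / (‖f‖ ^ 2 + 1) : ℝ) : ℂ) * z)
      rw [norm_sub_sq (𝕜 := ℂ), eL_norm, inner_smul_right, ← inner_conj_symm, ← hz, norm_smul, norm_mul,
        mul_assoc, Complex.mul_conj, Complex.norm_real, Complex.normSq_eq_norm_sq, ← Complex.ofReal_mul] at h1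
      simp only [RCLike.re_to_complex, Complex.ofReal_re, one_pow] at h1
      set s := 1 / (‖f‖ ^ 2 + 1) with hs
      have hs0 : 0 < s := by positivity
      have hs1 : s * (‖f‖ ^ 2 + 1) = 1 := by rw [hs]; field_simp
      rw [Real.norm_of_nonneg hs0.le] at h1
      have h2 : 2 * (s * ‖z‖ ^ 2) ≤ s * ‖z‖ ^ 2 * (s * ‖f‖ ^ 2) := by nlinarith
      have h3 : s * ‖f‖ ^ 2 ≤ 1 := by nlinarith
      have h4 : s * ‖z‖ ^ 2 * (s * ‖f‖ ^ 2) ≤ s * ‖z‖ ^ 2 := mul_le_of_le_one_right (by positivity) h3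
      have h5 : s * ‖z‖ ^ 2 ≤ 0 := by linarith
      have h6 : ‖z‖ ^ 2 ≤ 0 := by
        by_contra hcon
        push Not at hcon
        have := mul_pos hs0 hcon
        linarith
      have : ‖z‖ = 0 := by
        have := sq_nonneg ‖z‖
        exact pow_eq_zero_iff (two_ne_zero) |>.1 (le_antisymm h6 this)
      exact norm_eq_zero.1 this
    rw [← inner_conj_symm, ← hz, hz0, map_zero]
  refine ⟨Λ, hc, HilbertBasis.mkOfOrthogonalEqBot ho hsp, fun l => ?_⟩
  rw [HilbertBasis.coe_mkOfOrthogonalEqBot]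
  exact (expChar_memLp μ l).coeFn_toLp

/-- Parseval identity for the mask -/
lemma mask_pars {p : ℕ} (hp : 0 < p) (D : Fin p → (Fin 2 → ℝ)) (v : Fin 2 → ℝ)
    (hv : ∀ j : ℤ, ¬ (p : ℤ) ∣ j → mask D ((j : ℝ) • v) = 0) (y : Fin 2 → ℝ) :
    ∑ j : Fin p, ‖mask D (y - ((j : ℕ) : ℝ) • v)‖ ^ 2 = 1 := by
  classical
  have hpC : (p : ℂ) ≠ 0 := by exact_mod_cast hp.ne'
  set U : Matrix (Fin p) (Fin p) ℂ := fun j k => expChar (-(((j : ℕ) : ℝ) • v)) (D k) with hU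
  have h1 : U * Uᴴ = (p : ℂ) • 1 := by
    ext i j
    rw [Matrix.mul_apply]
    have e : ∀ k, U i k * Uᴴ k j = expChar ((((j : ℕ) : ℤ) - ((i : ℕ) : ℤ) : ℤ) • v) (D k) := by
      intro k
      rw [Matrix.conjTranspose_apply]
      simp only [hU]
      rw [RCLike.star_def, expChar_conj, neg_neg, ← expChar_add_left]
      congr 1
      rw [sub_smul, Nat.cast_smul_eq_nsmul]
      simp
      abel
    simp only [e]
    rcases eq_or_ne i j with rfl | hij
    · simp [expChar_zero]
    · have hnd : ¬ (p : ℤ) ∣ (((j : ℕ) : ℤ) - ((i : ℕ) : ℤ)) := by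
        intro hd
        have := Int.eq_zero_of_abs_lt_dvd hd (by
          rw [abs_lt]; have := i.2; have := j.2; constructor <;> omega)
        apply hij; ext; omega
      have := hv _ hnd
      unfold mask at this
      rw [mul_eq_zero] at this
      have h3 := this.resolve_left (inv_ne_zero hpC)
      rw [Matrix.smul_apply, Matrix.one_apply_ne hij, smul_zero, ← h3]
      simp only [Int.cast_smul_eq_zsmul]
  have h2 : Uᴴ * U = (p : ℂ) • 1 := by
    have : ((p : ℂ)⁻¹ • U) * Uᴴ = 1 := by
      rw [Matrix.smul_mul, h1, smul_smul, inv_mul_cancel₀ hpC, one_smul]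
    have := mul_eq_one_comm.1 this
    rw [Matrix.mul_smul] at this
    rw [← this, smul_smul, mul_inv_cancel₀ hpC, one_smul]
  set x : Fin p → ℂ := fun k => expChar y (D k) with hx
  have hm : ∀ j : Fin p, mask D (y - ((j : ℕ) : ℝ) • v) = (p : ℂ)⁻¹ * (U *ᵥ x) j := by
    intro j
    unfold mask
    congr 1
    refine Finset.sum_congr rfl fun k _ => ?_
    rw [sub_eq_add_neg, expChar_add_left, mul_comm]
  have h4 : star (U *ᵥ x) ⬝ᵥ (U *ᵥ x) = (p : ℂ) * p := by
    rw [Matrix.star_mulVec, ← Matrix.dotProduct_mulVec, Matrix.mulVec_mulVec, h2, Matrix.smul_mulVec,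
      Matrix.one_mulVec, dotProduct_smul, smul_eq_mul]
    congr 1
    simp only [dotProduct, Pi.star_apply, hx]
    have : ∀ k, star (expChar y (D k)) * expChar y (D k) = 1 := by
      intro k
      rw [RCLike.star_def, mul_comm, Complex.mul_conj, Complex.normSq_eq_norm_sq, expChar_norm]; simp
    rw [Finset.sum_congr rfl fun k _ => this k]; simp
  have h5 : ∑ j : Fin p, ‖(U *ᵥ x) j‖ ^ 2 = (p : ℝ) * p := by
    have : ((∑ j : Fin p, ‖(U *ᵥ x) j‖ ^ 2 : ℝ) : ℂ) = ((p * p : ℝ) : ℂ) := by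
      push_cast
      rw [← h4, dotProduct]
      refine Finset.sum_congr rfl fun j _ => ?_
      rw [Pi.star_apply, RCLike.star_def, mul_comm, Complex.mul_conj, Complex.normSq_eq_norm_sq]
      push_cast; rfl
    exact_mod_cast this
  have hpR : (p : ℝ) ≠ 0 := by exact_mod_cast hp.ne'
  simp only [hm, norm_mul, mul_pow]
  rw [← Finset.mul_sum, h5]
  simp
  field_simp

lemma pow_eig (T : Module.End ℝ (Fin 2 → ℝ)) {w : Fin 2 → ℝ} {r : ℝ} (h : T w = r • w) (k : ℕ) :
    (T ^ k) w = r ^ k • w := by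
  induction k with
  | zero => simp
  | succ k ih => rw [pow_succ, Module.End.mul_apply, h, map_smul, ih, smul_smul, pow_succ']

lemma Tm_pow_0 (n1 n2 c : ℝ) (k : ℕ) (x) : (Tm n1 n2 c ^ k) x 0 = n1⁻¹ ^ k * x 0 := by
  induction k with
  | zero => simp
  | succ k ih => rw [pow_succ', Module.End.mul_apply, Tm_0, ih]; ring

/-- inverse modulo a prime -/
lemma exists_mod_mul {p : ℕ} (hp : p.Prime) {b : ℤ} (hb : ¬ (p : ℤ) ∣ b) (d : ℤ) :
    ∃ i : ℤ, (p : ℤ) ∣ d - i * b := by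
  have hc : IsCoprime (p : ℤ) b := (Nat.prime_iff_prime_int.1 hp).coprime_iff_not_dvd.2 hb
  obtain ⟨u, v, h⟩ := hc
  refine ⟨d * v, d * u, ?_⟩
  linear_combination (-d) * h

lemma build_one {p : ℕ} (hp : p.Prime) {D : Fin p → (Fin 2 → ℝ)} {a : Fin 2 → ℤ} {n1 n2 c : ℝ}
    {F : (Fin 2 → ℝ) → ℂ} (h1 : 1 < n1)
    (hs : Sys p a (Rm n1 n2 c) (Tm n1 n2 c) (mask D) F) (hne : n1 ≠ n2)
    (hn : ∃ n : ℤ, (p : ℤ) ∣ n ∧ n1 = n) (hq : ∃ q : ℚ, c / (n1 - n2) = q)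
    (hE : c / (n1 - n2) ∉ Ea p a) :
    ∃ Λ : Set (Fin 2 → ℝ), Λ.Countable ∧ Spec F Λ := by
  obtain ⟨_, ⟨n, rfl⟩, hn⟩ := hn
  obtain ⟨q, hq⟩ := hq
  have hpp : Prime (p : ℤ) := Nat.prime_iff_prime_int.1 hp
  have hpR : (p : ℝ) ≠ 0 := by exact_mod_cast hp.ne_zero
  have hn12 : n1 - n2 ≠ 0 := sub_ne_zero.2 hne
  set h := q.num with hh
  set l : ℤ := ((q.den : ℕ) : ℤ) with hl
  have hl0 : (l : ℝ) ≠ 0 := by rw [hl]; exact_mod_cast q.den_ne_zero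
  have hcop : IsCoprime h l := by
    rw [Int.isCoprime_iff_gcd_eq_one]; exact q.reduced
  have hqr : c / (n1 - n2) = (h : ℝ) / l := by
    rw [hq, hh, hl]
    conv_lhs => rw [← Rat.num_div_den q]
    push_cast; rfl
  have hdvd : (p : ℤ) ∣ l * a 1 - h * a 0 := by
    by_contra hnd
    exact hE (Or.inl ⟨h, l, Int.isCoprime_iff_gcd_eq_one.1 hcop, hnd, hqr⟩)
  have hcl : c * l = h * (n1 - n2) := by
    rw [div_eq_div_iff hn12 hl0] at hqr
    exact hqr
  have hpl : ¬ (p : ℤ) ∣ l := by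
    intro hd
    have h2 : (p : ℤ) ∣ h * a 0 := by
      have := dvd_sub (hd.mul_right (a 1)) hdvd
      simpa using this
    have h3 := (hpp.dvd_or_dvd h2).resolve_right (hs.a_nd 0)
    exact hpp.not_isUnit (hcop.isUnit_of_dvd' h3 hd)
  obtain ⟨i0, hi0⟩ := exists_mod_mul hp (hs.a_nd 0) l
  have hi1 : (p : ℤ) ∣ h - i0 * a 1 := by
    have h2 : (p : ℤ) ∣ (h - i0 * a 1) * a 0 := by
      have := dvd_sub (hi0.mul_right (a 1)) hdvd
      have e : (h - i0 * a 1) * a 0 = (l - i0 * a 0) * a 1 - (l * a 1 - h * a 0) := by ring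
      rwa [e]
    exact (hpp.dvd_or_dvd h2).resolve_right (hs.a_nd 0)
  have hi0p : ¬ (p : ℤ) ∣ i0 := by
    intro hd
    apply hpl
    have := dvd_add hi0 (hd.mul_right (a 0))
    simpa using this
  obtain ⟨z0, hz0⟩ := hi0
  obtain ⟨z1, hz1⟩ := hi1
  set w : Fin 2 → ℝ := ![(l : ℝ), (h : ℝ)] with hw
  have w0 : w 0 = l := rfl
  have w1 : w 1 = h := rfl
  have hRw : Rm n1 n2 c w = n1 • w := by
    ext i; fin_cases i
    · simp [w0]
    · simp only [Fin.mk_one, Rm_1, Pi.smul_apply, smul_eq_mul, w0, w1]; linear_combination hcl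
  have hTw : Tm n1 n2 c w = n1⁻¹ • w := by
    have := congrArg (Tm n1 n2 c) hRw
    rw [hs.TR, map_smul] at this
    rw [this, smul_smul, inv_mul_cancel₀ (by linarith), one_smul, ← this]
  have hzero : ∀ j : ℤ, ¬ (p : ℤ) ∣ j → mask D ((j : ℝ) • ((p : ℝ)⁻¹ • w)) = 0 := by
    intro j hj
    rw [hs.zero]
    refine ⟨j * i0, fun hd => ((hpp.dvd_or_dvd hd).elim hj hi0p), ?_⟩
    refine mem_intLat.2 ⟨![j * z0, j * z1], fun i => ?_⟩
    have hz0' : (l : ℝ) - i0 * a 0 = p * z0 := by exact_mod_cast hz0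
    have hz1' : (h : ℝ) - i0 * a 1 = p * z1 := by exact_mod_cast hz1
    fin_cases i
    · simp [aR, w0]; field_simp; linear_combination (j : ℝ) * hz0'
    · simp [aR, w1]; field_simp; linear_combination (j : ℝ) * hz1'
  have hn' : n1 = p * n := by rw [hn]; push_cast; ring
  have hb : Build p a (Rm n1 n2 c) (Tm n1 n2 c) (mask D) F (AddSubgroup.zmultiples w)
      ((p : ℝ)⁻¹ • w) (Submodule.span ℝ {w}) := by
    refine ⟨hs, ?_, ?_, ?_, mask_pars hp.pos D _ hzero, ?_, ?_, ?_⟩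
    · rintro g hg
      obtain ⟨z, rfl⟩ := AddSubgroup.mem_zmultiples_iff.1 hg
      refine AddSubgroup.zsmul_mem _ ?_ _
      refine mem_intLat.2 ⟨![l, h], fun i => ?_⟩
      fin_cases i <;> rfl
    · rintro g hg
      obtain ⟨z, rfl⟩ := AddSubgroup.mem_zmultiples_iff.1 hg
      rw [map_zsmul, hRw]
      refine AddSubgroup.zsmul_mem _ ?_ _
      refine AddSubgroup.mem_zmultiples_iff.2 ⟨p * n, ?_⟩
      rw [← Int.cast_smul_eq_zsmul ℝ, hn]
    · rw [map_smul, hRw, smul_smul]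
      refine AddSubgroup.mem_zmultiples_iff.2 ⟨n, ?_⟩
      rw [← Int.cast_smul_eq_zsmul ℝ]
      congr 1
      rw [hn']; field_simp
    · exact Submodule.smul_mem _ _ (Submodule.mem_span_singleton_self w)
    · intro x hx
      obtain ⟨t, rfl⟩ := Submodule.mem_span_singleton.1 hx
      rw [map_smul, hTw]
      exact Submodule.smul_mem _ _ (Submodule.smul_mem _ _ (Submodule.mem_span_singleton_self w))
    · intro x hx
      obtain ⟨s, rfl⟩ := Submodule.mem_span_singleton.1 hx
      refine ⟨(-round s : ℤ) • w, AddSubgroup.zsmul_mem _ (AddSubgroup.mem_zmultiples w) _, ?_⟩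
      rw [← Int.cast_smul_eq_zsmul ℝ, ← add_smul]
      set t : ℝ := s + ((-round s : ℤ) : ℝ) with ht
      have ht2 : |t| ≤ 1 / 2 := by
        rw [ht]; push_cast; rw [← sub_eq_add_neg]; exact abs_sub_round s
      intro hF
      obtain ⟨k, hk, hm⟩ := hs.F_zero_iff.1 hF
      rw [map_smul, pow_eig _ hTw, smul_smul, hs.zero] at hm
      obtain ⟨j, hj, hm⟩ := hm
      obtain ⟨kk, hkk⟩ := mem_intLat.1 hm
      have e0 := hkk 0
      have e1 := hkk 1
      simp only [Pi.sub_apply, Pi.smul_apply, smul_eq_mul, aR, w0, w1] at e0 e1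
      set u := t * n1⁻¹ ^ k with hu
      obtain ⟨α, β, hαβ⟩ := hcop
      set N : ℤ := α * (j * a 1 + p * kk 1) + β * (j * a 0 + p * kk 0) with hN
      have e0' : p * u * l = j * a 0 + p * kk 0 := by
        field_simp at e0; linear_combination e0
      have e1' : p * u * h = j * a 1 + p * kk 1 := by
        field_simp at e1; linear_combination e1
      have hαβ' : (α : ℝ) * h + β * l = 1 := by exact_mod_cast hαβ
      have huN : p * u = N := by
        rw [hN]; push_cast
        linear_combination (-(p * u)) * hαβ' + α * e1' + β * e0'
      have hN0 : N ≠ 0 := by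
        intro h0
        rw [h0] at huN
        rw [huN] at e0'
        have e3 : (0 : ℤ) = j * a 0 + p * kk 0 := by
          have : ((0 : ℤ) : ℝ) = ((j * a 0 + p * kk 0 : ℤ) : ℝ) := by push_cast; simpa using e0'
          exact_mod_cast this
        have : (p : ℤ) ∣ j * a 0 := ⟨-kk 0, by linear_combination -e3⟩
        exact (hpp.dvd_or_dvd this).elim hj (hs.a_nd 0)
      have hN1 : (1 : ℝ) ≤ |(N : ℝ)| := by exact_mod_cast Int.one_le_abs hN0
      have hn0 : n1 ≠ 0 := by linarith
      have htu : p * t = n1 ^ k * N := by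
        rw [← huN, hu, inv_pow]
        field_simp
      have hge : (p : ℝ) ≤ n1 ^ k := by
        have hnp : 0 < n := by
          by_contra hcon
          push Not at hcon
          have : (p : ℝ) * n ≤ 0 := mul_nonpos_of_nonneg_of_nonpos (by positivity) (by exact_mod_cast hcon)
          linarith
        have hpn : (p : ℝ) ≤ n1 := by
          rw [hn']
          exact le_mul_of_one_le_right (by positivity) (by exact_mod_cast hnp)
        exact hpn.trans (le_self_pow₀ h1.le (by omega))
      have habs : (p : ℝ) * |t| = n1 ^ k * |(N : ℝ)| := by
        have := congrArg abs htu
        rwa [abs_mul, abs_mul, abs_of_nonneg (show (0 : ℝ) ≤ p by positivity),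
          abs_of_nonneg (show (0 : ℝ) ≤ n1 ^ k by positivity)] at this
      have hpp0 : (0 : ℝ) < p := by exact_mod_cast hp.pos
      have : (p : ℝ) * 1 ≤ n1 ^ k * |(N : ℝ)| := mul_le_mul hge hN1 (by norm_num) (by positivity)
      have := mul_le_mul_of_nonneg_left ht2 hpp0.le
      linarith
  exact hb.exists_spec

/-- the lattice used in the second construction -/
def latM (m' : ℤ) : AddSubgroup (Fin 2 → ℝ) where
  carrier := {x | ∃ i j : ℤ, x 0 = m' * i ∧ x 1 = j}
  zero_mem' := ⟨0, 0, by simp, by simp⟩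
  add_mem' := by
    rintro x y ⟨i, j, h1, h2⟩ ⟨i', j', h1', h2'⟩
    exact ⟨i + i', j + j', by simp [h1, h1', mul_add], by simp [h2, h2']⟩
  neg_mem' := by
    rintro x ⟨i, j, h1, h2⟩
    exact ⟨-i, -j, by simp [h1], by simp [h2]⟩

lemma mem_latM {m' : ℤ} {x : Fin 2 → ℝ} : x ∈ latM m' ↔ ∃ i j : ℤ, x 0 = m' * i ∧ x 1 = j := Iff.rfl

lemma build_two {p : ℕ} (hp : p.Prime) {D : Fin p → (Fin 2 → ℝ)} {a : Fin 2 → ℤ} {n1 n2 c : ℝ}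
    {F : (Fin 2 → ℝ) → ℂ} (h1 : 1 < n1) (h2 : 1 < n2)
    (hs : Sys p a (Rm n1 n2 c) (Tm n1 n2 c) (mask D) F)
    (hn : ∃ n : ℤ, (p : ℤ) ∣ n ∧ n1 = n) (hn2 : ∃ n : ℤ, (p : ℤ) ∣ n ∧ n2 = n)
    {u m' : ℤ} (hm' : ¬ (p : ℤ) ∣ m') (hc : c * m' = p * u) :
    ∃ Λ : Set (Fin 2 → ℝ), Λ.Countable ∧ Spec F Λ := by
  obtain ⟨_, ⟨N1, rfl⟩, hn1⟩ := hn
  obtain ⟨_, ⟨N2, rfl⟩, hn2⟩ := hn2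
  push_cast at hn1 hn2
  have hpp : Prime (p : ℤ) := Nat.prime_iff_prime_int.1 hp
  have hpR : (p : ℝ) ≠ 0 := by exact_mod_cast hp.ne_zero
  obtain ⟨α, z, hz⟩ := exists_mod_mul hp hm' (a 0)
  have hz' : (a 0 : ℝ) - α * m' = p * z := by exact_mod_cast hz
  set w : Fin 2 → ℝ := ![(m' : ℝ) * α, (a 1 : ℝ)] with hw
  have w0 : w 0 = m' * α := rfl
  have w1 : w 1 = a 1 := rfl
  have hzero : ∀ j : ℤ, ¬ (p : ℤ) ∣ j → mask D ((j : ℝ) • ((p : ℝ)⁻¹ • w)) = 0 := by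
    intro j hj
    rw [hs.zero]
    refine ⟨j, hj, ?_⟩
    refine mem_intLat.2 ⟨![-j * z, 0], fun i => ?_⟩
    fin_cases i
    · simp [aR, w0]; field_simp; linear_combination (-j : ℝ) * hz'
    · simp [aR, w1]; field_simp; ring
  have hb : Build p a (Rm n1 n2 c) (Tm n1 n2 c) (mask D) F (latM m') ((p : ℝ)⁻¹ • w) ⊤ := by
    refine ⟨hs, ?_, ?_, ?_, mask_pars hp.pos D _ hzero, Submodule.mem_top, fun _ _ => Submodule.mem_top, ?_⟩
    · rintro g ⟨i, j, e0, e1⟩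
      refine mem_intLat.2 ⟨![m' * i, j], fun k => ?_⟩
      fin_cases k
      · simpa using e0
      · simpa using e1
    · rintro g ⟨i, j, e0, e1⟩
      refine mem_latM.2 ⟨p * N1 * i, p * u * i + p * N2 * j, ?_, ?_⟩
      · rw [Rm_0, e0, hn1]; push_cast; ring
      · rw [Rm_1, e0, e1, hn2]; push_cast; linear_combination (i : ℝ) * hc
    · refine mem_latM.2 ⟨N1 * α, u * α + N2 * a 1, ?_, ?_⟩
      · rw [Rm_0, Pi.smul_apply, w0, hn1, smul_eq_mul]; push_cast; field_simp
      · rw [Rm_1, Pi.smul_apply, Pi.smul_apply, w0, w1, hn2, smul_eq_mul, smul_eq_mul]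
        push_cast; field_simp; linear_combination (α : ℝ) * hc
    · intro x _
      by_cases hx : F x = 0
      swap
      · exact ⟨0, (latM m').zero_mem, by rwa [add_zero]⟩
      set e2 : Fin 2 → ℝ := ![0, 1] with he2
      refine ⟨e2, mem_latM.2 ⟨0, 1, by simp [he2], by simp [he2]⟩, ?_⟩
      intro hx2
      obtain ⟨k, hk, hm⟩ := hs.F_zero_iff.1 hx
      obtain ⟨k', hk', hm'⟩ := hs.F_zero_iff.1 hx2
      rw [hs.zero] at hm hm'
      obtain ⟨j, hj, hm⟩ := hm
      obtain ⟨j', hj', hm'⟩ := hm'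
      obtain ⟨b, hb⟩ := mem_intLat.1 hm
      obtain ⟨b', hb'⟩ := mem_intLat.1 hm'
      have e0 := hb 0
      have e0' := hb' 0
      simp only [Pi.sub_apply, Pi.smul_apply, smul_eq_mul, aR, Tm_pow_0, Pi.add_apply] at e0 e0'
      have he20 : e2 0 = 0 := rfl
      rw [he20, add_zero] at e0'
      have hn0 : n1 ≠ 0 := by linarith
      have f0 : p * x 0 = n1 ^ k * ((j * a 0 + p * b 0 : ℤ) : ℝ) := by
        rw [inv_pow] at e0; push_cast; field_simp at e0; linear_combination e0
      have f0' : p * x 0 = n1 ^ k' * ((j' * a 0 + p * b' 0 : ℤ) : ℝ) := by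
        rw [inv_pow] at e0'; push_cast; field_simp at e0'; linear_combination e0'
      have hnd : ∀ j b : ℤ, ¬ (p : ℤ) ∣ j → ¬ (p : ℤ) ∣ j * a 0 + p * b := by
        intro j b hj hd
        have := (Int.dvd_add_left (Dvd.intro b rfl)).1 hd
        exact (hpp.dvd_or_dvd this).elim hj (hs.a_nd 0)
      have hlt : ∀ (k k' : ℕ) (A B : ℤ), n1 ^ k * (A : ℝ) = n1 ^ k' * (B : ℝ) → ¬ (p : ℤ) ∣ A → ¬ k < k' := by
        intro k k' A B hAB hA hkk
        apply hA
        have e : (A : ℝ) = n1 ^ (k' - k) * B := by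
          have e3 : n1 ^ k' = n1 ^ k * n1 ^ (k' - k) := by rw [← pow_add]; congr 1; omega
          rw [e3, mul_assoc] at hAB
          exact mul_left_cancel₀ (pow_ne_zero _ hn0) hAB
        have e4 : A = (p * N1) ^ (k' - k) * B := by
          rw [hn1] at e; exact_mod_cast e
        rw [e4]
        exact Dvd.dvd.mul_right (dvd_pow (Dvd.intro N1 rfl) (by omega)) B
      have hkk : k = k' := by
        have g1 := hlt k k' _ _ (f0.symm.trans f0') (hnd j (b 0) hj)
        have g2 := hlt k' k _ _ (f0'.symm.trans f0) (hnd j' (b' 0) hj')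
        omega
      subst hkk
      have hjj : (p : ℤ) ∣ j - j' := by
        have e5 := mul_left_cancel₀ (pow_ne_zero _ hn0) (f0.symm.trans f0')
        have e6 : j * a 0 + p * b 0 = j' * a 0 + p * b' 0 := by exact_mod_cast e5
        have : (p : ℤ) ∣ (j - j') * a 0 := ⟨b' 0 - b 0, by linear_combination e6⟩
        exact (hpp.dvd_or_dvd this).resolve_right (hs.a_nd 0)
      obtain ⟨y, hy⟩ := hjj
      have hTe : Tm n1 n2 c e2 = n2⁻¹ • e2 := by
        ext i; fin_cases i <;> simp [he2]
      have g0 := hb 1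
      have g0' := hb' 1
      rw [map_add, pow_eig _ hTe] at g0'
      have he21 : e2 1 = 1 := rfl
      simp only [Pi.sub_apply, Pi.smul_apply, smul_eq_mul, aR, Pi.add_apply, he21, mul_one] at g0 g0'
      have hyR : (j : ℝ) - j' = p * y := by exact_mod_cast hy
      have hintg : n2⁻¹ ^ k = ((b' 1 - b 1 - y * a 1 : ℤ) : ℝ) := by
        push_cast
        have e7 : (j : ℝ) / p - j' / p = y := by rw [← sub_div, hyR]; field_simp
        linear_combination g0' - g0 - (a 1 : ℝ) * e7
      have hpos : 0 < n2⁻¹ ^ k := by positivity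
      have hlt1 : n2⁻¹ ^ k < 1 := pow_lt_one₀ (by positivity) (inv_lt_one_of_one_lt₀ h2) (by omega)
      rw [hintg] at hpos hlt1
      have q1 : 0 < b' 1 - b 1 - y * a 1 := by exact_mod_cast hpos
      have q2 : b' 1 - b 1 - y * a 1 < 1 := by exact_mod_cast hlt1
      omega
  exact hb.exists_spec

/-- Theorem 1.7: full characterization of when `μ_{M,D}` is a spectral measure. -/
theorem stmt8 (p : ℕ) (hp : p.Prime) (ρ₁ ρ₂ c : ℝ)
    (hρ10 : 0 < ρ₁) (hρ11 : ρ₁ < 1) (hρ20 : 0 < ρ₂) (hρ21 : ρ₂ < 1)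
    (D : Fin p → (Fin 2 → ℤ)) (hD : Function.Injective D)
    (a : Fin 2 → ℤ) (hZ : ZeroSetCond p D a)
    (hD0 : D ⟨0, hp.pos⟩ = 0)
    (hD11 : D ⟨1, hp.one_lt⟩ 1 = 0) (hD10 : D ⟨1, hp.one_lt⟩ 0 ≠ 0)
    (μ : Measure (Fin 2 → ℝ)) (hμ : IsSelfAffine μ (Mupper ρ₁ ρ₂ c) (digitR D)) :
    IsSpectral μ ↔
      ((ρ₁ ≠ ρ₂ ∧ (∃ n : ℤ, (p : ℤ) ∣ n ∧ ρ₁⁻¹ = (n : ℝ)) ∧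
          (∃ q : ℚ, c / (ρ₁⁻¹ - ρ₂⁻¹) = (q : ℝ)) ∧ c / (ρ₁⁻¹ - ρ₂⁻¹) ∉ Ea p a) ∨
        (ρ₁ ≠ ρ₂ ∧ (∃ n₁ n₂ : ℤ, (p : ℤ) ∣ n₁ ∧ (p : ℤ) ∣ n₂ ∧
            ρ₁⁻¹ = (n₁ : ℝ) ∧ ρ₂⁻¹ = (n₂ : ℝ) ∧
            ∃ s t : ℤ, ∃ ℓ : ℕ, ∃ m : ℤ, Int.gcd s t = 1 ∧ t = (p : ℤ) ^ ℓ * m ∧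
              ¬ (p : ℤ) ∣ m ∧ c / (ρ₁⁻¹ - ρ₂⁻¹) = (s : ℝ) / (t : ℝ) ∧
              c / (ρ₁⁻¹ - ρ₂⁻¹) ∈ Ea p a ∧ (p : ℤ) ^ (ℓ + 1) ∣ (n₁ - n₂))) ∨
        (ρ₁ = ρ₂ ∧ (∃ n : ℤ, (p : ℤ) ∣ n ∧ ρ₁⁻¹ = (n : ℝ)) ∧
          (c = 0 ∨ ∃ t s : ℤ, (p : ℤ) ∣ t ∧ Int.gcd s t = 1 ∧ c = (t : ℝ) / (s : ℝ)))) := by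
  have hprob : IsProbabilityMeasure μ := hμ.1
  have hs := sys_of p hp ρ₁ ρ₂ c hρ10 hρ11 hρ20 hρ21 D a hZ hD0 hD11 hD10 μ hμ
  have h1 : 1 < ρ₁⁻¹ := (one_lt_inv₀ hρ10).2 hρ11
  have h2 : 1 < ρ₂⁻¹ := (one_lt_inv₀ hρ20).2 hρ21
  have hpR : (p : ℝ) ≠ 0 := by exact_mod_cast hp.ne_zero
  have hpp : Prime (p : ℤ) := Nat.prime_iff_prime_int.1 hp
  constructor
  · intro hsp
    obtain ⟨Λ, hΛ⟩ := exists_spec_of_isSpectral hsp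
    have := necessity h1 h2 hs hΛ
    simpa only [ne_eq, _root_.inv_inj] using this
  · intro hcond
    suffices H : ∃ Λ : Set (Fin 2 → ℝ), Λ.Countable ∧ Spec (ftMeasure μ) Λ by
      obtain ⟨Λ, hc, hΛ⟩ := H
      exact isSpectral_of_spec hc hΛ
    rcases hcond with ⟨hne, hn, hq, hE⟩ | ⟨hne, n₁, n₂, hd1, hd2, e1, e2, s, t, ℓ, m, -, ht, hm, hc, -, hdd⟩ |
      ⟨heq, ⟨n, hd, e⟩, hc⟩
    · exact build_one hp h1 hs (by simpa using hne) hn hq hE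
    · obtain ⟨y, hy⟩ := hdd
      refine build_two hp h1 h2 hs ⟨n₁, hd1, e1⟩ ⟨n₂, hd2, e2⟩ (u := s * y) hm ?_
      have hm0 : (m : ℝ) ≠ 0 := by
        intro h
        have : m = 0 := by exact_mod_cast h
        exact hm (this ▸ dvd_zero _)
      have hne' : ρ₁⁻¹ - ρ₂⁻¹ ≠ 0 := sub_ne_zero.2 (by simpa using hne)
      have hyR : ρ₁⁻¹ - ρ₂⁻¹ = (p : ℝ) ^ (ℓ + 1) * y := by rw [e1, e2]; exact_mod_cast hy
      have htR : (t : ℝ) = (p : ℝ) ^ ℓ * m := by rw [ht]; push_cast; rfl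
      have hpl : (p : ℝ) ^ ℓ ≠ 0 := pow_ne_zero _ hpR
      rw [div_eq_div_iff hne' (by rw [htR]; exact mul_ne_zero hpl hm0), htR, hyR] at hc
      have : (p : ℝ) ^ ℓ * (c * m) = (p : ℝ) ^ ℓ * (p * ((s * y : ℤ) : ℝ)) := by
        push_cast; rw [pow_succ] at hc; linear_combination hc
      exact mul_left_cancel₀ hpl this
    · have hn2 : ∃ n : ℤ, (p : ℤ) ∣ n ∧ ρ₂⁻¹ = (n : ℝ) := ⟨n, hd, heq ▸ e⟩
      rcases hc with rfl | ⟨t, s, ⟨y, hy⟩, hg, hc⟩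
      · exact build_two hp h1 h2 hs ⟨n, hd, e⟩ hn2 (u := 0) (m' := 1)
          (fun h => hpp.not_isUnit (isUnit_of_dvd_one h)) (by simp)
      · have hsd : ¬ (p : ℤ) ∣ s := by
          intro h
          exact hpp.not_isUnit ((Int.isCoprime_iff_gcd_eq_one.2 hg).isUnit_of_dvd' h ⟨y, hy⟩)
        have hs0 : (s : ℝ) ≠ 0 := by
          intro h
          have : s = 0 := by exact_mod_cast h
          exact hsd (this ▸ dvd_zero _)
        refine build_two hp h1 h2 hs ⟨n, hd, e⟩ hn2 (u := y) hsd ?_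
        rw [hc, div_mul_cancel₀ _ hs0, hy]; push_cast; rfl

end
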